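/- For every prime p there exists a group Ω which is finitely generated, infinite, and residually finite, such that every element of Ω has finite order equal to a power of p, and every finitely generated subgroup of Ω is either finite or of finite index in Ω (i.e., Ω is a residually finite locally zero-one p-torsion group). -/

import Mathlib

/-- A group is residually finite if every nontrivial element avoids some
finite-index normal subgroup. -/
def ResiduallyFinite (G : Type*) [Group G] : Prop :=
  ∀ g : G, g ≠ 1 → ∃ N : Subgroup G, N.Normal ∧ N.FiniteIndex ∧ g ∉ N

set_option linter.unusedSectionVars false
set_option linter.unusedSimpArgs false
namespace LZO

abbrev Alg (p : ℕ) (G : Type) [Group G] := MonoidAlgebra (ZMod p) G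

section basics
variable {p : ℕ} {G : Type} [Group G]

noncomputable def dl (p : ℕ) {G : Type} [Group G] : G →* Alg p G := MonoidAlgebra.of (ZMod p) G

noncomputable def linExt {M : Type*} [AddCommGroup M] [Module (ZMod p) M] (f : G → M) :
    Alg p G →ₗ[ZMod p] M :=
  (Finsupp.linearCombination (ZMod p) f).comp
    (MonoidAlgebra.coeffLinearEquiv (ZMod p)).toLinearMap

@[simp] lemma linExt_dl {M : Type*} [AddCommGroup M] [Module (ZMod p) M] (f : G → M) (g : G) :
    linExt (p := p) f (dl p g) = f g := by
  simp [linExt, dl, MonoidAlgebra.of]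

noncomputable def AV (p : ℕ) {G : Type} [Group G] (V : Subgroup G) : Subalgebra (ZMod p) (Alg p G) :=
  Algebra.adjoin (ZMod p) (dl p '' (V : Set G))

lemma dl_mem {V : Subgroup G} {g : G} (h : g ∈ V) : dl p g ∈ AV p V :=
  Algebra.subset_adjoin ⟨g, h, rfl⟩

lemma AV_mono {V W : Subgroup G} (h : V ≤ W) : AV p V ≤ AV p W :=
  Algebra.adjoin_mono (Set.image_mono h)

lemma AV_induction {V : Subgroup G} {P : Alg p G → Prop}
    (hd : ∀ g ∈ V, P (dl p g)) (h0 : P 0) (ha : ∀ a b, P a → P b → P (a + b))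
    (hs : ∀ (c : ZMod p) a, P a → P (c • a)) {a : Alg p G} (h : a ∈ AV p V) : P a := by
  have hsp : (AV p V).toSubmodule = Submodule.span (ZMod p) (dl p '' (V : Set G)) := by
    have := Algebra.adjoin_eq_span (R := ZMod p) (dl p '' (V : Set G))
    have h2 : (Submonoid.closure (dl p '' (V : Set G)) : Set (Alg p G)) = dl p '' (V : Set G) := by
      have : (dl p '' (V : Set G)) = ((V.toSubmonoid.map (dl p) : Submonoid (Alg p G)) : Set _) := rfl
      rw [this, Submonoid.closure_eq]
    rw [h2] at this
    exact this
  have h' : a ∈ Submodule.span (ZMod p) (dl p '' (V : Set G)) := by rw [← hsp]; exact h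
  induction h' using Submodule.span_induction with
  | mem x hx => obtain ⟨g, hg, rfl⟩ := hx; exact hd g hg
  | zero => exact h0
  | add x y hx hy h1 h2 =>
    exact ha _ _ (h1 (by rw [← hsp] at hx; exact hx)) (h2 (by rw [← hsp] at hy; exact hy))
  | smul c x hx h1 => exact hs _ _ (h1 (by rw [← hsp] at hx; exact hx))

lemma mem_AV_top (a : Alg p G) : a ∈ AV p (⊤ : Subgroup G) := by
  induction a using MonoidAlgebra.induction_linear with
  | zero => exact zero_mem _
  | add f g hf hg => exact add_mem hf hg
  | single g c =>
    have : MonoidAlgebra.single g c = c • dl p g := by simp [dl]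
    rw [this]
    exact Subalgebra.smul_mem _ (dl_mem (Subgroup.mem_top g)) c

lemma alg_ext {M : Type*} [AddCommGroup M] [Module (ZMod p) M] {f g : Alg p G →ₗ[ZMod p] M}
    (h : ∀ x, f (dl p x) = g (dl p x)) : f = g := by
  refine LinearMap.ext fun a => ?_
  refine AV_induction (P := fun a => f a = g a) (fun x _ => h x) (by simp) ?_ ?_ (mem_AV_top a)
  · intro a b ha hb; simp [ha, hb]
  · intro c a ha; simp [ha]

open Classical in
noncomputable def prj (V : Subgroup G) : Alg p G →ₗ[ZMod p] Alg p G :=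
  linExt (fun g => if g ∈ V then dl p g else 0)

open Classical in
lemma prj_mul {V : Subgroup G} {a : Alg p G} (ha : a ∈ AV p V) (g : G) :
    prj V (a * dl p g) = if g ∈ V then a * dl p g else 0 := by
  refine AV_induction (P := fun a => prj V (a * dl p g) = if g ∈ V then a * dl p g else 0)
    ?_ ?_ ?_ ?_ ha
  · intro v hv
    rw [← map_mul, prj, linExt_dl]
    simp [V.mul_mem_cancel_left hv]
  · simp
  · intro a b h1 h2
    rw [add_mul, map_add, h1, h2]; split_ifs <;> simp
  · intro c a h1
    rw [smul_mul_assoc, map_smul, h1]; split_ifs <;> simp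

lemma prj_of_mem {V : Subgroup G} {a : Alg p G} (ha : a ∈ AV p V) : prj V a = a := by
  have := prj_mul ha 1
  simpa [V.one_mem] using this

lemma prj_mem {V : Subgroup G} (a : Alg p G) : prj V a ∈ AV p V := by
  refine AV_induction (P := fun a => prj V a ∈ AV p V) ?_ ?_ ?_ ?_ (mem_AV_top a)
  · intro g _
    simp only [prj, linExt_dl]
    split_ifs with h
    · exact dl_mem h
    · exact zero_mem _
  · simp [zero_mem]
  · intro a b ha hb; rw [map_add]; exact add_mem ha hb
  · intro c a ha; rw [map_smul]; exact Subalgebra.smul_mem _ ha c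

variable [Fact p.Prime]

lemma dl_ne_zero (g : G) : dl p g ≠ 0 := by
  intro h
  have := linExt_dl (p := p) (fun _ : G => (1 : ZMod p)) g
  rw [h, map_zero] at this
  exact zero_ne_one this

lemma mem_of_dl_mem {V : Subgroup G} {g : G} (h : dl p g ∈ AV p V) : g ∈ V := by
  by_contra hg
  have h1 := prj_of_mem h
  simp only [prj, linExt_dl, hg, if_false] at h1
  exact dl_ne_zero g h1.symm

instance : CharP (Alg p G) p := by
  have hi : Function.Injective (algebraMap (ZMod p) (Alg p G)) :=
    FaithfulSMul.algebraMap_injective _ _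
  exact charP_of_injective_algebraMap hi p

/-- augmentation -/
noncomputable def aug : Alg p G →ₐ[ZMod p] ZMod p := MonoidAlgebra.lift (ZMod p) (ZMod p) G 1

@[simp] lemma aug_dl (g : G) : aug (dl p g) = 1 := by
  simp [aug, dl]

/-- conjugation -/
noncomputable def cj (f : G) : Alg p G →ₐ[ZMod p] Alg p G :=
  MonoidAlgebra.mapDomainAlgHom (ZMod p) (ZMod p) (MulAut.conj f).toMonoidHom

@[simp] lemma cj_dl (f g : G) : cj f (dl p g) = dl p (f * g * f⁻¹) := by
  simp [cj, dl]

lemma cj_eq (f : G) (a : Alg p G) : cj f a = dl p f * a * dl p f⁻¹ := by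
  refine AV_induction (P := fun a => cj f a = dl p f * a * dl p f⁻¹) ?_ ?_ ?_ ?_ (mem_AV_top a)
  · intro g _; simp
  · simp
  · intro a b ha hb; rw [map_add, ha, hb, mul_add, add_mul]
  · intro c a ha; rw [map_smul, ha]; simp

end basics

section JMsec
variable {p : ℕ} {G : Type} [Group G] {ι : Type}

abbrev cl (y : ι → G) : Subgroup G := Subgroup.closure (Set.range y)

inductive JM (p : ℕ) {G : Type} [Group G] {ι : Type} (y : ι → G) (w : ι → ℝ) :
    ℝ → Alg p G → Prop
  | top {u : ℝ} {a : Alg p G} : a ∈ AV p (cl y) → 1 ≤ u → JM p y w u a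
  | gen (i : ι) : JM p y w (w i) (dl p (y i) - 1)
  | mul {u t : ℝ} {a b : Alg p G} : JM p y w u a → JM p y w t b → JM p y w (u * t) (a * b)
  | add {u : ℝ} {a b : Alg p G} : JM p y w u a → JM p y w u b → JM p y w u (a + b)
  | zero (u : ℝ) : JM p y w u 0
  | mono {u t : ℝ} {a : Alg p G} : u ≤ t → JM p y w u a → JM p y w t a

variable {y : ι → G} {w : ι → ℝ}

lemma y_mem (i : ι) : y i ∈ cl y := Subgroup.subset_closure ⟨i, rfl⟩

lemma JM.mem {u : ℝ} {a : Alg p G} (h : JM p y w u a) : a ∈ AV p (cl y) := by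
  induction h with
  | top h _ => exact h
  | gen i => exact sub_mem (dl_mem (y_mem i)) (one_mem _)
  | mul _ _ h1 h2 => exact mul_mem h1 h2
  | add _ _ h1 h2 => exact add_mem h1 h2
  | zero => exact zero_mem _
  | mono _ _ h => exact h

lemma JM.pos (hw : ∀ i, 0 < w i) {u : ℝ} {a : Alg p G} (h : JM p y w u a) : a = 0 ∨ 0 < u := by
  induction h with
  | top h h1 => right; linarith
  | gen i => right; exact hw i
  | mul _ _ h1 h2 =>
    rcases h1 with rfl | h1
    · simp
    rcases h2 with rfl | h2
    · simp
    right; positivity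
  | add _ _ h1 h2 =>
    rcases h1 with rfl | h1
    · simpa using h2
    · exact Or.inr h1
  | zero => simp
  | mono h _ h1 =>
    rcases h1 with rfl | h1
    · simp
    · right; linarith

lemma JM.mul_left {u : ℝ} {a b : Alg p G} (ha : a ∈ AV p (cl y)) (h : JM p y w u b) :
    JM p y w u (a * b) := by
  have := JM.mul (JM.top (y := y) (w := w) ha le_rfl) h
  rwa [one_mul] at this

lemma JM.mul_right {u : ℝ} {a b : Alg p G} (h : JM p y w u b) (ha : a ∈ AV p (cl y)) :
    JM p y w u (b * a) := by
  have := JM.mul h (JM.top (y := y) (w := w) ha le_rfl)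
  rwa [mul_one] at this

lemma JM.neg {u : ℝ} {a : Alg p G} (h : JM p y w u a) : JM p y w u (-a) := by
  have := h.mul_left (neg_mem (one_mem (AV p (cl y))))
  simpa using this

lemma JM.sub {u : ℝ} {a b : Alg p G} (h : JM p y w u a) (h' : JM p y w u b) :
    JM p y w u (a - b) := by
  rw [sub_eq_add_neg]; exact h.add h'.neg

lemma JM.smul {u : ℝ} {a : Alg p G} (c : ZMod p) (h : JM p y w u a) : JM p y w u (c • a) := by
  have := h.mul_left (Subalgebra.algebraMap_mem (AV p (cl y)) c)
  rwa [← Algebra.smul_def] at this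

lemma JM.sum {u : ℝ} {α : Type*} {s : Finset α} {f : α → Alg p G}
    (h : ∀ i ∈ s, JM p y w u (f i)) : JM p y w u (∑ i ∈ s, f i) := by
  classical
  induction s using Finset.induction_on with
  | empty => exact JM.zero _
  | insert i s hi ih =>
    rw [Finset.sum_insert hi]
    exact (h i (by simp)).add (ih (fun j hj => h j (by simp [hj])))

lemma JM.pow {u : ℝ} {a : Alg p G} (h : JM p y w u a) (n : ℕ) : JM p y w (u ^ n) (a ^ n) := by
  induction n with
  | zero => simpa using JM.top (one_mem _) le_rfl
  | succ n ih => rw [pow_succ, pow_succ]; exact ih.mul h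

/-- general transfer -/
lemma JM.transfer {ι' : Type} {y' : ι' → G} {w' : ι' → ℝ} (φ : Alg p G →ₐ[ZMod p] Alg p G)
    (hV : ∀ i, φ (dl p (y i)) ∈ AV p (cl y') ∧ φ (dl p (y i)⁻¹) ∈ AV p (cl y'))
    (hy : ∀ i, JM p y' w' (w i) (φ (dl p (y i) - 1)))
    {u : ℝ} {a : Alg p G} (h : JM p y w u a) : JM p y' w' u (φ a) := by
  have hV' : ∀ g ∈ cl y, φ (dl p g) ∈ AV p (cl y') := by
    intro g hg
    have : φ (dl p g) ∈ AV p (cl y') ∧ φ (dl p g⁻¹) ∈ AV p (cl y') := by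
      induction hg using Subgroup.closure_induction with
      | mem x hx => obtain ⟨i, rfl⟩ := hx; exact hV i
      | one => simp [one_mem]
      | mul a b _ _ h1 h2 =>
        rw [mul_inv_rev, map_mul, map_mul, map_mul, map_mul]
        exact ⟨mul_mem h1.1 h2.1, mul_mem h2.2 h1.2⟩
      | inv a _ h => rw [inv_inv]; exact ⟨h.2, h.1⟩
    exact this.1
  induction h with
  | top h h1 =>
    refine JM.top ?_ h1
    refine AV_induction (P := fun a => φ a ∈ AV p (cl y')) hV' (by simp [zero_mem]) ?_ ?_ h
    · intro a b h1 h2; rw [map_add]; exact add_mem h1 h2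
    · intro c a h1; rw [map_smul]; exact Subalgebra.smul_mem _ h1 c
  | gen i => exact hy i
  | mul _ _ h1 h2 => rw [map_mul]; exact h1.mul h2
  | add _ _ h1 h2 => rw [map_add]; exact h1.add h2
  | zero => rw [map_zero]; exact JM.zero _
  | mono h _ h1 => exact JM.mono h h1

lemma JM.transfer_id {ι' : Type} {y' : ι' → G} {w' : ι' → ℝ} 
    (hV : ∀ i, y i ∈ cl y')
    (hy : ∀ i, JM p y' w' (w i) (dl p (y i) - 1))
    {u : ℝ} {a : Alg p G} (h : JM p y w u a) : JM p y' w' u a :=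
  JM.transfer (AlgHom.id _ _) (fun i => ⟨dl_mem (hV i), dl_mem (inv_mem (hV i))⟩) hy h

lemma JM.scale (hw : ∀ i, 0 < w i) {c : ℝ} (hc : 0 < c) (hc1 : c ≤ 1) {u : ℝ} {a : Alg p G}
    (h : JM p y w u a) (hu : u < 1) : JM p y (fun i => c * w i) (c * u) a := by
  induction h with
  | top h h1 => linarith
  | gen i => exact JM.gen (w := fun i => c * w i) i
  | @mul u t a b ha hb h1 h2 =>
    rcases ha.pos hw with rfl | hu0
    · rw [zero_mul]; exact JM.zero _
    rcases hb.pos hw with rfl | ht0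
    · rw [mul_zero]; exact JM.zero _
    by_cases hu1 : u < 1
    · by_cases ht1 : t < 1
      · refine JM.mono ?_ ((h1 hu1).mul (h2 ht1))
        have : 0 ≤ c * (u * t) := by positivity
        nlinarith
      · refine JM.mono ?_ ((h1 hu1).mul_right hb.mem)
        push Not at ht1
        have : 0 ≤ c * u := by positivity
        nlinarith
    · by_cases ht1 : t < 1
      · refine JM.mono ?_ ((h2 ht1).mul_left ha.mem)
        push Not at hu1
        have : 0 ≤ c * t := by positivity
        nlinarith
      · push Not at hu1 ht1
        nlinarith
  | add _ _ h1 h2 => exact (h1 hu).add (h2 hu)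
  | zero => exact JM.zero _
  | mono h _ h1 => exact JM.mono (by gcongr) (h1 (by linarith))

variable [Fact p.Prime]

/-- the group filtration -/
def Vf (p : ℕ) [Fact p.Prime] {G : Type} [Group G] {ι : Type} (y : ι → G) (w : ι → ℝ) (u : ℝ) : Subgroup G where
  carrier := {v | JM p y w u (dl p v - 1)}
  one_mem' := by simpa using JM.zero _
  mul_mem' := by
    intro a b ha hb
    have hb' : dl p b ∈ AV p (cl y) := by
      have := add_mem hb.mem (one_mem (AV p (cl y)))
      simpa using this
    have := (JM.mul_right ha hb').add hb
    have e : (dl p a - 1) * dl p b + (dl p b - 1) = dl p (a * b) - 1 := by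
      rw [map_mul]; noncomm_ring
    rw [e] at this; exact this
  inv_mem' := by
    intro a ha
    have ha' : dl p a ∈ AV p (cl y) := by
      have := add_mem ha.mem (one_mem (AV p (cl y)))
      simpa using this
    have := (JM.mul_left (dl_mem (inv_mem (mem_of_dl_mem ha'))) ha).neg
    have e : -(dl p a⁻¹ * (dl p a - 1)) = dl p a⁻¹ - 1 := by
      rw [mul_sub, ← map_mul]; simp
    rw [e] at this; exact this

lemma mem_Vf {u : ℝ} {v : G} : v ∈ Vf p y w u ↔ JM p y w u (dl p v - 1) := Iff.rfl

lemma Vf_le (u : ℝ) : Vf p y w u ≤ cl y := by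
  intro v hv
  have := add_mem (JM.mem hv) (one_mem (AV p (cl y)))
  exact mem_of_dl_mem (by simpa using this)

lemma Vf_mono {u t : ℝ} (h : u ≤ t) : Vf p y w u ≤ Vf p y w t := fun _ hv => JM.mono h hv

lemma Vf_top {u : ℝ} (h : 1 ≤ u) : Vf p y w u = cl y :=
  le_antisymm (Vf_le u) fun _ hv => JM.top (sub_mem (dl_mem hv) (one_mem _)) h

lemma Vf_conj {u : ℝ} {v g : G} (hv : v ∈ cl y) (hg : g ∈ Vf p y w u) :
    v * g * v⁻¹ ∈ Vf p y w u := by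
  have := (JM.mul_left (dl_mem hv) hg).mul_right (dl_mem (p := p) (inv_mem hv))
  have e : dl p v * (dl p g - 1) * dl p v⁻¹ = dl p (v * g * v⁻¹) - 1 := by
    rw [mul_sub, sub_mul, ← map_mul, ← map_mul, mul_one, ← map_mul]; simp
  rw [e] at this; exact this

lemma Vf_comm {u t : ℝ} {a b : G} (ha : a ∈ Vf p y w u) (hb : b ∈ Vf p y w t) :
    a * b * a⁻¹ * b⁻¹ ∈ Vf p y w (u * t) := by
  have h1 := JM.mul ha hb
  have h2 := JM.mul hb ha
  rw [mul_comm t u] at h2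
  have hc : dl p (a⁻¹ * b⁻¹) ∈ AV p (cl y) :=
    dl_mem (mul_mem (inv_mem (Vf_le _ ha)) (inv_mem (Vf_le _ hb)))
  have := (h1.sub h2).mul_right hc
  have e : ((dl p a - 1) * (dl p b - 1) - (dl p b - 1) * (dl p a - 1)) * dl p (a⁻¹ * b⁻¹) 
      = dl p (a * b * a⁻¹ * b⁻¹) - 1 := by
    have : (dl p a - 1) * (dl p b - 1) - (dl p b - 1) * (dl p a - 1) =
      dl p (a * b) - dl p (b * a) := by simp only [map_mul]; noncomm_ring
    rw [this, sub_mul, ← map_mul, ← map_mul]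
    simp [mul_assoc]
  rw [e] at this; exact this

lemma dl_pow_sub (g : G) (n : ℕ) : dl p (g ^ p ^ n) - 1 = (dl p g - 1) ^ p ^ n := by
  rw [sub_pow_char_pow_of_commute p n (Commute.one_right _)]
  simp

lemma Vf_pow {u : ℝ} {g : G} (hg : g ∈ Vf p y w u) (n : ℕ) :
    g ^ p ^ n ∈ Vf p y w (u ^ p ^ n) := by
  rw [mem_Vf, dl_pow_sub]; exact JM.pow hg _

end JMsec

end LZO

set_option linter.unusedSectionVars false
set_option linter.unusedSimpArgs false
namespace LZO
section fr
variable {p : ℕ} {G : Type} [Group G] {ι : Type}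

def Fr (p : ℕ) {G : Type} [Group G] {ι : Type} [Fintype ι] (y : ι → G) : Prop :=
  ∀ a : ι → Alg p G, (∀ i, a i ∈ AV p (cl y)) → ∑ i, a i * (dl p (y i) - 1) = 0 → ∀ i, a i = 0

lemma span_gen [Fintype ι] (y : ι → G) {v : G} (hv : v ∈ cl y) :
    ∃ a : ι → Alg p G, (∀ i, a i ∈ AV p (cl y)) ∧ dl p v - 1 = ∑ i, a i * (dl p (y i) - 1) := by
  classical
  induction hv using Subgroup.closure_induction with
  | mem x hx =>
    obtain ⟨i, rfl⟩ := hx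
    refine ⟨fun j => if j = i then 1 else 0, ?_, by simp⟩
    intro j; dsimp only; split_ifs
    · exact one_mem _
    · exact zero_mem _
  | one => exact ⟨0, fun _ => zero_mem _, by simp⟩
  | mul x z hx hz h1 h2 =>
    obtain ⟨a, ha, h1⟩ := h1
    obtain ⟨b, hb, h2⟩ := h2
    refine ⟨fun i => a i + dl p x * b i, fun i => add_mem (ha i) (mul_mem (dl_mem hx) (hb i)), ?_⟩
    simp only [add_mul, Finset.sum_add_distrib, mul_assoc, ← Finset.mul_sum]
    rw [← h1, ← h2, map_mul]; noncomm_ring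
  | inv x hx h1 =>
    obtain ⟨a, ha, h1⟩ := h1
    refine ⟨fun i => - dl p x⁻¹ * a i,
      fun i => mul_mem (neg_mem (dl_mem (inv_mem hx))) (ha i), ?_⟩
    simp only [mul_assoc, ← Finset.mul_sum]
    rw [← h1, neg_mul, mul_sub, ← map_mul]; simp

def IsChar (V : Subgroup G) (χ : G → ZMod p) : Prop := ∀ a ∈ V, ∀ b ∈ V, χ (a * b) = χ a + χ b

lemma IsChar.one {V : Subgroup G} {χ : G → ZMod p} (h : IsChar V χ) : χ 1 = 0 := by
  have := h 1 V.one_mem 1 V.one_mem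
  simpa using this

lemma IsChar.inv {V : Subgroup G} {χ : G → ZMod p} (h : IsChar V χ) {a : G} (ha : a ∈ V) :
    χ a⁻¹ = - χ a := by
  have := h a ha a⁻¹ (inv_mem ha)
  rw [mul_inv_cancel, h.one] at this
  exact (neg_eq_of_add_eq_zero_right this.symm).symm

lemma IsChar.pow {V : Subgroup G} {χ : G → ZMod p} (h : IsChar V χ) {a : G} (ha : a ∈ V) (n : ℕ) :
    χ (a ^ n) = n * χ a := by
  induction n with
  | zero => simp [h.one]
  | succ n ih => rw [pow_succ, h _ (pow_mem ha n) _ ha, ih]; push_cast; ring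

def kerc {V : Subgroup G} {χ : G → ZMod p} (h : IsChar V χ) : Subgroup G where
  carrier := {v | v ∈ V ∧ χ v = 0}
  one_mem' := ⟨V.one_mem, h.one⟩
  mul_mem' := fun {a b} ha hb => ⟨mul_mem ha.1 hb.1, by rw [h a ha.1 b hb.1, ha.2, hb.2, add_zero]⟩
  inv_mem' := fun {a} ha => ⟨inv_mem ha.1, by rw [h.inv ha.1, ha.2, neg_zero]⟩

lemma mem_kerc {V : Subgroup G} {χ : G → ZMod p} (h : IsChar V χ) {v : G} :
    v ∈ kerc h ↔ v ∈ V ∧ χ v = 0 := Iff.rfl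

variable [Fact p.Prime]

lemma exists_char [Fintype ι] {y : ι → G} (hF : Fr p y) (c : ι → ZMod p) :
    ∃ χ : G → ZMod p, IsChar (cl y) χ ∧ ∀ i, χ (y i) = c i := by
  classical
  choose! a ha using fun v (hv : v ∈ cl y) => span_gen (p := p) y hv
  have uniq : ∀ v ∈ cl y, ∀ b : ι → Alg p G, (∀ i, b i ∈ AV p (cl y)) →
      dl p v - 1 = ∑ i, b i * (dl p (y i) - 1) → a v = b := by
    intro v hv b hb h
    funext i
    have h2 := (ha v hv).2
    rw [h2] at h
    have := hF (fun i => a v i - b i) (fun i => sub_mem ((ha v hv).1 i) (hb i))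
      (by simp only [sub_mul, Finset.sum_sub_distrib]; rw [h, sub_self]) i
    exact sub_eq_zero.1 this
  refine ⟨fun v => ∑ i, aug (a v i) * c i, ?_, ?_⟩
  · intro x hx z hz
    have : a (x * z) = fun i => a x i + dl p x * a z i := by
      refine uniq _ (mul_mem hx hz) _
        (fun i => add_mem ((ha x hx).1 i) (mul_mem (dl_mem hx) ((ha z hz).1 i))) ?_
      simp only [add_mul, Finset.sum_add_distrib, mul_assoc, ← Finset.mul_sum]
      rw [← (ha x hx).2, ← (ha z hz).2, map_mul]; noncomm_ring
    dsimp only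
    rw [this, ← Finset.sum_add_distrib]
    refine Finset.sum_congr rfl fun i _ => ?_
    simp [add_mul]
  · intro i
    have : a (y i) = fun j => if j = i then 1 else 0 := by
      refine uniq _ (y_mem i) _ (fun j => ?_) (by simp)
      split_ifs
      · exact one_mem _
      · exact zero_mem _
    dsimp only
    rw [this]
    rw [Finset.sum_eq_single i]
    · simp
    · intro j _ hj; simp [hj]
    · simp

/-- base case : Fox calculus -/
lemma Fr_free {ι : Type} [Fintype ι] : Fr p (FreeGroup.of : ι → FreeGroup ι) := by
  classical
  let A := Alg p (FreeGroup ι)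
  have hinv : ∀ g : FreeGroup ι, dl p g⁻¹ * dl p g = 1 := fun g => by rw [← map_mul]; simp
  have hinv' : ∀ g : FreeGroup ι, dl p g * dl p g⁻¹ = 1 := fun g => by rw [← map_mul]; simp
  let T : ι → Equiv.Perm (ι → A) := fun i =>
    { toFun := fun v => dl p (FreeGroup.of i) • v + Pi.single i 1
      invFun := fun v => dl p (FreeGroup.of i)⁻¹ • (v - Pi.single i 1)
      left_inv := by
        intro v; dsimp only; rw [add_sub_cancel_right, smul_smul, hinv, one_smul]
      right_inv := by
        intro v; dsimp only; rw [smul_smul, hinv', one_smul, sub_add_cancel] }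
  let φ : FreeGroup ι →* Equiv.Perm (ι → A) := FreeGroup.lift T
  have hφ : ∀ g v, φ g v = dl p g • v + φ g 0 := by
    intro g
    induction g using FreeGroup.induction_on with
    | C1 => intro v; simp
    | of i =>
      intro v
      simp [φ, T]
    | inv_of i h =>
      intro v
      have e : φ (FreeGroup.of i)⁻¹ = (T i)⁻¹ := by simp [φ]
      have e2 : ∀ v, (T i)⁻¹ v = dl p (FreeGroup.of i)⁻¹ • (v - Pi.single i 1) := fun v => rfl
      change φ (FreeGroup.of i)⁻¹ v = dl p (FreeGroup.of i)⁻¹ • v + φ (FreeGroup.of i)⁻¹ 0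
      rw [e, e2, e2, smul_sub, smul_sub, smul_zero]; abel
    | mul a b ha hb =>
      intro v
      rw [map_mul, Equiv.Perm.mul_apply, Equiv.Perm.mul_apply, hb v, ha, ha (φ b 0), map_mul,
        smul_add, smul_smul, add_assoc]
  let D : FreeGroup ι → (ι → A) := fun g => φ g 0
  have hD : ∀ g h, D (g * h) = dl p g • D h + D g := by
    intro g h
    simp only [D]
    rw [map_mul, Equiv.Perm.mul_apply, hφ g]
  have hDi : ∀ i, D (FreeGroup.of i) = Pi.single i 1 := by intro i; simp [D, φ, T]
  let E : A →ₗ[ZMod p] (ι → A) := linExt D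
  have hE : ∀ (a : A) i, E (a * (dl p (FreeGroup.of i) - 1)) = a • Pi.single i 1 := by
    intro a i
    refine AV_induction (P := fun a => E (a * (dl p (FreeGroup.of i) - 1)) = a • Pi.single i 1)
      ?_ ?_ ?_ ?_ (mem_AV_top a)
    · intro g _
      rw [mul_sub, ← map_mul, mul_one, map_sub]
      simp only [E]
      rw [linExt_dl (p := p) D, linExt_dl (p := p) D, hD, hDi]; abel
    · simp
    · intro a b h1 h2; rw [add_mul, map_add, h1, h2, add_smul]
    · intro c a h1; rw [smul_mul_assoc, map_smul, h1, smul_assoc]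
  intro a _ h i
  have h2 := congrArg E h
  rw [map_sum, map_zero] at h2
  simp only [hE] at h2
  have := congrFun h2 i
  rw [Finset.sum_apply] at this
  rw [Finset.sum_eq_single i] at this
  · simpa using this
  · intro j _ hj; simp [Pi.single_apply, hj.symm]
  · simp

/-- detection -/
lemma detect {y : ι → G} {w : ι → ℝ} (hw : ∀ i, 0 < w i) {χ : G → ZMod p}
    (hχ : IsChar (cl y) χ) {u : ℝ} (hu : u < 1) {v : G} (hv : v ∈ Vf p y w u)
    (h0 : ∀ i, w i ≤ u → χ (y i) = 0) : χ v = 0 := by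
  have hmul : ∀ a ∈ AV p (cl y), ∀ b ∈ AV p (cl y),
      linExt χ (a * b) = linExt χ a * aug b + aug a * linExt (p := p) χ b := by
    intro a ha b hb
    refine AV_induction (P := fun a => linExt χ (a * b) =
      linExt χ a * aug b + aug a * linExt (p := p) χ b) ?_ ?_ ?_ ?_ ha
    · intro g hg
      refine AV_induction (P := fun b => linExt χ (dl p g * b) =
        linExt χ (dl p g) * aug b + aug (dl p g) * linExt (p := p) χ b) ?_ ?_ ?_ ?_ hb
      · intro h hh
        rw [← map_mul, linExt_dl, hχ g hg h hh]; simp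
      · simp
      · intro a b h1 h2; rw [mul_add, map_add, h1, h2, map_add, map_add]; ring
      · intro c a h1
        rw [mul_smul_comm, map_smul, h1, map_smul, map_smul]; simp only [smul_eq_mul]; ring
    · simp
    · intro a b h1 h2; rw [add_mul, map_add, h1, h2, map_add, map_add]; ring
    · intro c a h1
      rw [smul_mul_assoc, map_smul, h1, map_smul, map_smul]; simp only [smul_eq_mul]; ring
  have main : ∀ {u : ℝ} {a : Alg p G}, JM p y w u a → u < 1 →
      aug a = 0 ∧ ((∀ i, w i ≤ u → χ (y i) = 0) → linExt χ a = 0) := by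
    intro u a h
    induction h with
    | top h h1 => intro h2; linarith
    | gen i =>
      intro _
      refine ⟨by simp, fun h => ?_⟩
      rw [map_sub, ← map_one (dl p), linExt_dl, linExt_dl, hχ.one, h i le_rfl, sub_zero]
    | @mul u t a b ha hb h1 h2 =>
      intro hut
      rcases ha.pos hw with rfl | hu0
      · simp
      rcases hb.pos hw with rfl | ht0
      · simp
      rw [hmul _ ha.mem _ hb.mem, map_mul]
      by_cases hu1 : u < 1
      · rw [(h1 hu1).1]
        by_cases ht1 : t < 1
        · rw [(h2 ht1).1]; simp
        · push Not at ht1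
          refine ⟨by simp, fun h => ?_⟩
          rw [(h1 hu1).2 (fun i hi => h i (by nlinarith))]; simp
      · push Not at hu1
        have ht1 : t < 1 := by nlinarith
        rw [(h2 ht1).1]
        refine ⟨by simp, fun h => ?_⟩
        rw [(h2 ht1).2 (fun i hi => h i (by nlinarith))]; simp
    | add _ _ h1 h2 =>
      intro hu
      rw [map_add, map_add, (h1 hu).1, (h2 hu).1]
      exact ⟨by simp, fun h => by rw [(h1 hu).2 h, (h2 hu).2 h, add_zero]⟩
    | zero => simp
    | mono h _ h1 =>
      intro hu
      exact ⟨(h1 (by linarith)).1, fun h' => (h1 (by linarith)).2 fun i hi => h' i (hi.trans h)⟩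
  have := (main hv hu).2 h0
  rwa [map_sub, ← map_one (dl p), linExt_dl, linExt_dl, hχ.one, sub_zero] at this

/-! coset lemma -/

noncomputable def Lx (p : ℕ) {G : Type} [Group G] (W : Subgroup G) (x : G) (j : ℕ) :
    Submodule (ZMod p) (Alg p G) :=
  Submodule.span (ZMod p) {b | ∃ l < j, ∃ a ∈ AV p W, b = a * dl p (x ^ l)}

lemma Lx_mono {W : Subgroup G} {x : G} {j k : ℕ} (h : j ≤ k) : Lx p W x j ≤ Lx p W x k :=
  Submodule.span_mono fun _ ⟨l, hl, a, ha⟩ => ⟨l, hl.trans_le h, a, ha⟩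

lemma Lx_mul {W : Subgroup G} {x : G} {j : ℕ} {a b : Alg p G} (ha : a ∈ AV p W)
    (hb : b ∈ Lx p W x j) : a * b ∈ Lx p W x j := by
  induction hb using Submodule.span_induction with
  | mem b hb =>
    obtain ⟨l, hl, c, hc, rfl⟩ := hb
    exact Submodule.subset_span ⟨l, hl, a * c, mul_mem ha hc, by rw [mul_assoc]⟩
  | zero => simp
  | add b c _ _ h1 h2 => rw [mul_add]; exact add_mem h1 h2
  | smul c b _ h => rw [mul_smul_comm]; exact Submodule.smul_mem _ _ h

lemma cj_mem {W : Subgroup G} {x : G} (hx : ∀ g ∈ W, x * g * x⁻¹ ∈ W) {a : Alg p G}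
    (ha : a ∈ AV p W) : cj x a ∈ AV p W := by
  refine AV_induction (P := fun a => cj x a ∈ AV p W) ?_ (by simp [zero_mem]) ?_ ?_ ha
  · intro g hg; rw [cj_dl]; exact dl_mem (hx g hg)
  · intro a b h1 h2; rw [map_add]; exact add_mem h1 h2
  · intro c a h1; rw [map_smul]; exact Subalgebra.smul_mem _ h1 c

lemma x_mul_eq (x : G) (a : Alg p G) : dl p x * a = cj x a * dl p x := by
  rw [cj_eq, mul_assoc, ← map_mul]; simp

lemma Lx_x {W : Subgroup G} {x : G} (hx : ∀ g ∈ W, x * g * x⁻¹ ∈ W) {j : ℕ} {b : Alg p G}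
    (hb : b ∈ Lx p W x j) : dl p x * b ∈ Lx p W x (j + 1) := by
  induction hb using Submodule.span_induction with
  | mem b hb =>
    obtain ⟨l, hl, c, hc, rfl⟩ := hb
    refine Submodule.subset_span ⟨l + 1, by omega, cj x c, cj_mem hx hc, ?_⟩
    rw [← mul_assoc, x_mul_eq, mul_assoc, ← map_mul, pow_succ']
  | zero => simp
  | add b c _ _ h1 h2 => rw [mul_add]; exact add_mem h1 h2
  | smul c b _ h => rw [mul_smul_comm]; exact Submodule.smul_mem _ _ h

lemma Lx_E_succ {W : Subgroup G} {x : G} (hx : ∀ g ∈ W, x * g * x⁻¹ ∈ W) {j : ℕ} {e a : Alg p G}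
    (ha : a ∈ AV p W) (he : e - dl p (x ^ j) ∈ Lx p W x j) :
    (dl p x - a) * e - dl p (x ^ (j + 1)) ∈ Lx p W x (j + 1) := by
  have h1 := Lx_x hx he
  have h2 : e ∈ Lx p W x (j + 1) := by
    have h3 : dl p (x ^ j) ∈ Lx p W x (j + 1) :=
      Submodule.subset_span ⟨j, by omega, 1, one_mem _, by simp⟩
    have := add_mem (Lx_mono (Nat.le_succ j) he) h3
    simpa using this
  have := sub_mem h1 (Lx_mul ha h2)
  rw [mul_sub, ← map_mul, ← pow_succ'] at this
  rw [sub_mul]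
  convert this using 1
  abel

lemma tri_single {W : Subgroup G} {x : G} {m : ℕ} (hm : ∀ l < m, x ^ (m - l) ∉ W) {a e : Alg p G}
    (ha : a ∈ AV p W) (he : e - dl p (x ^ m) ∈ Lx p W x m) (h : a * e ∈ Lx p W x m) : a = 0 := by
  have h1 : a * dl p (x ^ m) ∈ Lx p W x m := by
    have := sub_mem h (Lx_mul ha he)
    rw [mul_sub] at this
    simpa using this
  have h2 : ∀ b ∈ Lx p W x m, prj W (b * dl p (x ^ m)⁻¹) = 0 := by
    intro b hb
    induction hb using Submodule.span_induction with
    | mem b hb =>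
      obtain ⟨l, hl, c, hc, rfl⟩ := hb
      rw [mul_assoc, ← map_mul, prj_mul hc, if_neg]
      intro h
      have := W.inv_mem h
      apply hm l hl
      convert this using 1
      rw [mul_inv_rev, inv_inv, ← pow_sub _ hl.le]
    | zero => simp
    | add b c _ _ h1 h2 => rw [add_mul, map_add, h1, h2, add_zero]
    | smul c b _ h => rw [smul_mul_assoc, map_smul, h, smul_zero]
  have h3 := h2 _ h1
  rw [mul_assoc, ← map_mul, mul_inv_cancel, map_one, mul_one, prj_of_mem ha] at h3
  exact h3

lemma tri {W : Subgroup G} {x : G} (m : ℕ) (hm : ∀ l, 0 < l → l < m → x ^ l ∉ W)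
    (a e : ℕ → Alg p G)
    (ha : ∀ j < m, a j ∈ AV p W) (he : ∀ j < m, e j - dl p (x ^ j) ∈ Lx p W x j)
    (h : ∑ j ∈ Finset.range m, a j * e j = 0) : ∀ j < m, a j = 0 := by
  induction m with
  | zero => intro j hj; omega
  | succ m ih =>
    rw [Finset.sum_range_succ] at h
    have hmem : ∀ j < m, a j * e j ∈ Lx p W x m := by
      intro j hj
      refine Lx_mul (ha j (by omega)) ?_
      have h3 : dl p (x ^ j) ∈ Lx p W x m :=
        Submodule.subset_span ⟨j, by omega, 1, one_mem _, by simp⟩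
      have := add_mem (Lx_mono hj.le (he j (by omega))) h3
      simpa using this
    have ham : a m = 0 := by
      refine tri_single (x := x) (W := W) (m := m) (fun l hl => hm _ (by omega) (by omega))
        (ha m (by omega)) (he m (by omega)) ?_
      rw [eq_neg_of_add_eq_zero_right h]
      exact neg_mem (sum_mem fun j hj => hmem j (Finset.mem_range.1 hj))
    rw [ham, zero_mul, add_zero] at h
    have := ih (fun l h1 h2 => hm l h1 (by omega)) (fun j hj => ha j (by omega))
      (fun j hj => he j (by omega)) h
    intro j hj
    rcases Nat.lt_succ_iff_lt_or_eq.1 hj with h | rfl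
    · exact this j h
    · exact ham

end fr
end LZO

set_option linter.unusedSectionVars false
set_option linter.unusedSimpArgs false
namespace LZO
section grp
variable {p : ℕ} {G : Type} [Group G] {ι : Type}

def cm (x0 : G) : ℕ → G → G
  | 0, g => g
  | j + 1, g => x0 * cm x0 j g * x0⁻¹ * (cm x0 j g)⁻¹

def ny (p : ℕ) (x : ι → G) (i0 : ι) : Option ({i // i ≠ i0} × Fin p) → G
  | none => x i0 ^ p
  | some ij => cm (x i0) ij.2 (x ij.1)

def nw (p : ℕ) (w : ι → ℝ) (i0 : ι) : Option ({i // i ≠ i0} × Fin p) → ℝ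
  | none => w i0 ^ p
  | some ij => w ij.1 * w i0 ^ (ij.2 : ℕ)

lemma cm_conj (x0 g : G) (j : ℕ) : x0 * cm x0 j g * x0⁻¹ = cm x0 (j + 1) g * cm x0 j g := by
  simp [cm]

/-- `σ^i` applied to `cm j` stays inside -/
lemma sig_cm_mem {M : Subgroup G} {x0 g : G} {n : ℕ} (h : ∀ j < n, cm x0 j g ∈ M) (i : ℕ) :
    ∀ j, i + j < n → x0 ^ i * cm x0 j g * (x0 ^ i)⁻¹ ∈ M := by
  induction i with
  | zero => intro j hj; simpa using h j (by omega)
  | succ i ih =>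
    intro j hj
    have : x0 ^ (i + 1) * cm x0 j g * (x0 ^ (i + 1))⁻¹ =
        (x0 ^ i * cm x0 (j + 1) g * (x0 ^ i)⁻¹) * (x0 ^ i * cm x0 j g * (x0 ^ i)⁻¹) := by
      have := cm_conj x0 g j
      have e : x0 ^ (i + 1) * cm x0 j g * (x0 ^ (i + 1))⁻¹ =
        x0 ^ i * (x0 * cm x0 j g * x0⁻¹) * (x0 ^ i)⁻¹ := by rw [pow_succ]; group
      rw [e, this]; group
    rw [this]
    exact mul_mem (ih _ (by omega)) (ih _ (by omega))

lemma cm_sig_mem {M : Subgroup G} {x0 g : G} {n : ℕ}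
    (h : ∀ i < n, x0 ^ i * g * (x0 ^ i)⁻¹ ∈ M) (j : ℕ) :
    ∀ i, i + j < n → x0 ^ i * cm x0 j g * (x0 ^ i)⁻¹ ∈ M := by
  induction j with
  | zero => intro i hi; exact h i (by omega)
  | succ j ih =>
    intro i hi
    have : x0 ^ i * cm x0 (j + 1) g * (x0 ^ i)⁻¹ =
      (x0 ^ (i + 1) * cm x0 j g * (x0 ^ (i + 1))⁻¹) * (x0 ^ i * cm x0 j g * (x0 ^ i)⁻¹)⁻¹ := by
      simp only [cm]; rw [pow_succ]; group
    rw [this]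
    exact mul_mem (ih _ (by omega)) (inv_mem (ih _ (by omega)))

variable [Fact p.Prime]

lemma p_pos : 0 < p := (Fact.out : p.Prime).pos

lemma z_mem (x : ι → G) (i0 : ι) : x i0 ^ p ∈ cl (ny p x i0) := y_mem (y := ny p x i0) none

lemma cm_mem (x : ι → G) {i0 i : ι} (hi : i ≠ i0) {j : ℕ} (hj : j < p) :
    cm (x i0) j (x i) ∈ cl (ny p x i0) := y_mem (y := ny p x i0) (some (⟨i, hi⟩, ⟨j, hj⟩))

lemma sig_mem (x : ι → G) (i0 : ι) {g : G} (hg : g ∈ cl (ny p x i0)) :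
    x i0 * g * (x i0)⁻¹ ∈ cl (ny p x i0) := by
  induction hg using Subgroup.closure_induction with
  | mem g hg =>
    obtain ⟨o, rfl⟩ := hg
    match o with
    | none =>
      have : x i0 * (x i0 ^ p) * (x i0)⁻¹ = x i0 ^ p := by group
      change x i0 * (x i0 ^ p) * (x i0)⁻¹ ∈ _
      rw [this]; exact z_mem x i0
    | some (⟨i, hi⟩, ⟨j, hj⟩) =>
      change x i0 * (cm (x i0) j (x i)) * (x i0)⁻¹ ∈ _
      have h1 : ∀ k < p + 1, x i0 ^ k * x i * (x i0 ^ k)⁻¹ ∈ cl (ny p x i0) := by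
        intro k hk
        rcases Nat.lt_succ_iff_lt_or_eq.1 hk with h | rfl
        · exact sig_cm_mem (fun j hj => cm_mem x hi hj) k 0 h
        · exact mul_mem (mul_mem (z_mem x i0) (cm_mem x hi (j := 0) p_pos)) (inv_mem (z_mem x i0))
      simpa using cm_sig_mem h1 j 1 (by omega)
  | one => simp
  | mul a b _ _ h1 h2 =>
    have : x i0 * (a * b) * (x i0)⁻¹ = (x i0 * a * (x i0)⁻¹) * (x i0 * b * (x i0)⁻¹) := by group
    rw [this]; exact mul_mem h1 h2
  | inv a _ h =>
    have : x i0 * a⁻¹ * (x i0)⁻¹ = (x i0 * a * (x i0)⁻¹)⁻¹ := by group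
    rw [this]; exact inv_mem h

lemma sig_pow_mem (x : ι → G) (i0 : ι) (k : ℕ) {g : G} (hg : g ∈ cl (ny p x i0)) :
    x i0 ^ k * g * (x i0 ^ k)⁻¹ ∈ cl (ny p x i0) := by
  induction k with
  | zero => simpa using hg
  | succ k ih =>
    have := sig_mem x i0 ih
    rw [pow_succ']
    convert this using 1
    group

/-- G2 -/
lemma G2 (x : ι → G) (i0 : ι) {g : G} (hg : g ∈ cl x) :
    ∃ c ∈ cl (ny p x i0), ∃ k < p, g = c * x i0 ^ k := by
  suffices h : ∃ c ∈ cl (ny p x i0), ∃ k : ℕ, g = c * x i0 ^ k by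
    obtain ⟨c, hc, k, rfl⟩ := h
    refine ⟨c * (x i0 ^ p) ^ (k / p), mul_mem hc (pow_mem (z_mem x i0) _), k % p,
      Nat.mod_lt _ p_pos, ?_⟩
    rw [mul_assoc, ← pow_mul, ← pow_add, Nat.div_add_mod]
  have hmul : ∀ a b : G, (∃ c ∈ cl (ny p x i0), ∃ k : ℕ, a = c * x i0 ^ k) →
     (∃ c ∈ cl (ny p x i0), ∃ k : ℕ, b = c * x i0 ^ k) →
     (∃ c ∈ cl (ny p x i0), ∃ k : ℕ, a * b = c * x i0 ^ k) := by
    rintro _ _ ⟨c, hc, k, rfl⟩ ⟨d, hd, l, rfl⟩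
    refine ⟨c * (x i0 ^ k * d * (x i0 ^ k)⁻¹), mul_mem hc (sig_pow_mem x i0 k hd), k + l, ?_⟩
    rw [pow_add]; group
  have hx0 : ∀ k : ℕ, ∃ m : ℕ, ∃ c ∈ cl (ny p x i0), (x i0 ^ k)⁻¹ = c * x i0 ^ m := by
    intro k
    refine ⟨k * (p - 1), ((x i0 ^ p) ^ k)⁻¹, inv_mem (pow_mem (z_mem x i0) _), ?_⟩
    rw [eq_inv_mul_iff_mul_eq, mul_inv_eq_iff_eq_mul, ← pow_mul, ← pow_add]
    congr 1
    have := p_pos (p := p)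
    obtain ⟨q, hq⟩ : ∃ q, p = q + 1 := ⟨p - 1, by omega⟩
    rw [hq]; simp; ring
  induction hg using Subgroup.closure_induction with
  | mem g hg =>
    obtain ⟨i, rfl⟩ := hg
    by_cases hi : i = i0
    · subst hi; exact ⟨1, one_mem _, 1, by simp⟩
    · exact ⟨_, cm_mem x hi (j := 0) p_pos, 0, by simp [cm]⟩
  | one => exact ⟨1, one_mem _, 0, by simp⟩
  | mul a b _ _ h1 h2 => exact hmul a b h1 h2
  | inv a _ h =>
    obtain ⟨c, hc, k, rfl⟩ := h
    rw [mul_inv_rev]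
    refine hmul _ _ ?_ ⟨c⁻¹, inv_mem hc, 0, by simp⟩
    obtain ⟨m, c, hc, h⟩ := hx0 k
    exact ⟨c, hc, m, h⟩

lemma cm_in {V : Subgroup G} {x0 g : G} (h0 : x0 ∈ V) (hg : g ∈ V) (j : ℕ) : cm x0 j g ∈ V := by
  induction j with
  | zero => exact hg
  | succ j ih => exact mul_mem (mul_mem (mul_mem h0 ih) (inv_mem h0)) (inv_mem ih)

lemma ny_le (x : ι → G) (i0 : ι) : cl (ny p x i0) ≤ cl x := by
  rw [Subgroup.closure_le]
  rintro _ ⟨o, rfl⟩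
  match o with
  | none => exact pow_mem (y_mem i0) p
  | some (i, j) => exact cm_in (y_mem i0) (y_mem _) _

lemma char_cm {V : Subgroup G} {χ : G → ZMod p} (h : IsChar V χ) {x0 g : G} (h0 : x0 ∈ V)
    (hg : g ∈ V) (hχ : χ g = 0) (j : ℕ) : χ (cm x0 j g) = 0 := by
  cases j with
  | zero => exact hχ
  | succ j =>
    have := cm_in h0 hg j
    simp only [cm]
    rw [h _ (mul_mem (mul_mem h0 this) (inv_mem h0)) _ (inv_mem this),
      h _ (mul_mem h0 this) _ (inv_mem h0), h _ h0 _ this, h.inv h0, h.inv this]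
    ring

/-- G1 -/
lemma G1 (x : ι → G) (i0 : ι) {χ : G → ZMod p} (h : IsChar (cl x) χ) (h1 : χ (x i0) = 1)
    (h0 : ∀ i, i ≠ i0 → χ (x i) = 0) : cl (ny p x i0) = kerc h := by
  apply le_antisymm
  · rw [Subgroup.closure_le]
    rintro _ ⟨o, rfl⟩
    match o with
    | none =>
      refine ⟨pow_mem (y_mem i0) p, ?_⟩
      change χ (x i0 ^ p) = 0
      rw [h.pow (y_mem i0)]; simp
    | some (⟨i, hi⟩, j) =>
      exact ⟨cm_in (y_mem i0) (y_mem _) _, char_cm h (y_mem i0) (y_mem _) (h0 i hi) _⟩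
  · rintro v ⟨hv, hχ⟩
    obtain ⟨c, hc, k, hk, rfl⟩ := G2 (p := p) x i0 hv
    have hcχ : χ c = 0 := by
      have := hc
      clear hv hχ
      induction hc using Subgroup.closure_induction with
      | mem c hc =>
        obtain ⟨o, rfl⟩ := hc
        match o with
        | none =>
          change χ (x i0 ^ p) = 0
          rw [h.pow (y_mem i0)]; simp
        | some (⟨i, hi⟩, j) =>
          exact char_cm h (y_mem i0) (y_mem _) (h0 i hi) _
      | one => exact h.one
      | mul a b ha hb h1 h2 => rw [h _ (ny_le x i0 ha) _ (ny_le x i0 hb), h1 ha, h2 hb, add_zero]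
      | inv a ha h1 => rw [h.inv (ny_le x i0 ha), h1 ha, neg_zero]
    rw [h _ (ny_le x i0 hc) _ (pow_mem (y_mem i0) _), hcχ, zero_add, h.pow (y_mem i0), h1,
      mul_one] at hχ
    have : k = 0 := by
      rw [ZMod.natCast_eq_zero_iff] at hχ
      exact Nat.eq_zero_of_dvd_of_lt hχ hk
    subst this
    simpa using hc

lemma not_mem_ny (x : ι → G) (i0 : ι) {χ : G → ZMod p} (h : IsChar (cl x) χ) (h1 : χ (x i0) = 1)
    (h0 : ∀ i, i ≠ i0 → χ (x i) = 0) : ∀ l, 0 < l → l < p → x i0 ^ l ∉ cl (ny p x i0) := by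
  intro l hl hlp hm
  rw [G1 x i0 h h1 h0] at hm
  have := hm.2
  rw [h.pow (y_mem i0), h1, mul_one, ZMod.natCast_eq_zero_iff] at this
  exact absurd (Nat.le_of_dvd hl this) (by omega)

/-- Freeness for the new family -/
lemma Fr_ny [Fintype ι] [DecidableEq ι] (x : ι → G) (i0 : ι) (hF : Fr p x)
    (hnm : ∀ l, 0 < l → l < p → x i0 ^ l ∉ cl (ny p x i0)) : Fr p (ny p x i0) := by
  classical
  set W := cl (ny p x i0) with hW
  have hWV : W ≤ cl x := ny_le x i0
  set x0 := x i0 with hx0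
  have hn : ∀ g ∈ W, x0 * g * x0⁻¹ ∈ W := fun g hg => sig_mem x i0 hg
  -- Fox coefficients
  let pd : G → ℕ → Alg p G := fun g => Nat.rec 1 (fun j e => (dl p x0 - dl p (cm x0 (j + 1) g)) * e)
  have pd0 : ∀ g, pd g 0 = 1 := fun g => rfl
  have pds : ∀ g j, pd g (j + 1) = (dl p x0 - dl p (cm x0 (j + 1) g)) * pd g j := fun g j => rfl
  have pdV : ∀ i j, pd (x i) j ∈ AV p (cl x) := by
    intro i j
    induction j with
    | zero => exact one_mem _
    | succ j ih =>
      rw [pds]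
      exact mul_mem (sub_mem (dl_mem (y_mem i0)) (dl_mem (cm_in (y_mem i0) (y_mem _) _))) ih
  have pdE : ∀ i, i ≠ i0 → ∀ j < p, pd (x i) j - dl p (x0 ^ j) ∈ Lx p W x0 j := by
    intro i hi j
    induction j with
    | zero => intro _; simp [pd0]
    | succ j ih =>
      intro hj
      rw [pds]
      exact Lx_E_succ hn (dl_mem (cm_mem x hi hj)) (ih (by omega))
  have om : ∀ i j, ∃ o ∈ AV p (cl x),
      dl p (cm x0 j (x i)) - 1 = pd (x i) j * (dl p (x i) - 1) + o * (dl p x0 - 1) := by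
    intro i j
    induction j with
    | zero => exact ⟨0, zero_mem _, by simp [pd0, cm]⟩
    | succ j ih =>
      obtain ⟨o, ho, h⟩ := ih
      set c := cm x0 j (x i) with hc
      set c' := cm x0 (j + 1) (x i) with hc'
      have hcV : c ∈ cl x := cm_in (y_mem i0) (y_mem _) _
      have hcV' : c' ∈ cl x := cm_in (y_mem i0) (y_mem _) _
      have e : dl p c' * dl p c * dl p x0 = dl p x0 * dl p c := by
        rw [← map_mul, ← map_mul, ← map_mul]; congr 1; simp [hc', hc, cm]
      refine ⟨(dl p x0 - dl p c') * o + 1 - dl p c' * dl p c,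
        sub_mem (add_mem (mul_mem (sub_mem (dl_mem (y_mem i0)) (dl_mem hcV')) ho) (one_mem _))
          (mul_mem (dl_mem hcV') (dl_mem hcV)), ?_⟩
      have e2 : dl p c' - 1 = (dl p x0 - dl p c') * (dl p c - 1) +
          (1 - dl p c' * dl p c) * (dl p x0 - 1) := by
        have : (dl p x0 - dl p c') * (dl p c - 1) + (1 - dl p c' * dl p c) * (dl p x0 - 1) =
          dl p x0 * dl p c - dl p c' * dl p c * dl p x0 + dl p c' - 1 := by noncomm_ring
        rw [this, e]; noncomm_ring
      rw [e2, h, pds]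
      noncomm_ring
  choose om omV omE using om
  set S : Alg p G := ∑ k ∈ Finset.range p, dl p x0 ^ k with hS
  have hSz : dl p (x0 ^ p) - 1 = S * (dl p x0 - 1) := by
    rw [hS, geom_sum_mul, map_pow]
  have hSV : S ∈ AV p (cl x) := sum_mem fun k _ => pow_mem (dl_mem (y_mem i0)) k
  have hSE : S - dl p (x0 ^ (p - 1)) ∈ Lx p W x0 (p - 1) := by
    obtain ⟨q, hq⟩ : ∃ q, p = q + 1 := ⟨p - 1, by have := p_pos (p := p); omega⟩
    have : S = ∑ k ∈ Finset.range (q + 1), dl p x0 ^ k := by rw [hS, ← hq]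
    rw [this, Finset.sum_range_succ]
    have hq' : p - 1 = q := by omega
    rw [hq', map_pow, add_sub_cancel_right]
    exact sum_mem fun k hk => Submodule.subset_span
      ⟨k, Finset.mem_range.1 hk, 1, one_mem _, by simp⟩
  intro a ha hsum
  rw [Fintype.sum_option, Fintype.sum_prod_type] at hsum
  change a none * (dl p (x0 ^ p) - 1) + ∑ i : {i // i ≠ i0}, ∑ j : Fin p,
    a (some (i, j)) * (dl p (cm x0 j (x i)) - 1) = 0 at hsum
  let B : ι → Alg p G := fun i => if h : i ≠ i0 then
      ∑ j : Fin p, a (some (⟨i, h⟩, j)) * pd (x i) j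
    else a none * S + ∑ i : {i // i ≠ i0}, ∑ j : Fin p, a (some (i, j)) * om i j
  have hB1 : ∀ i : {i // i ≠ i0}, B i = ∑ j : Fin p, a (some (i, j)) * pd (x i) j := by
    intro i; simp only [B]; rw [dif_pos i.2]
  have hB0 : B i0 = a none * S + ∑ i : {i // i ≠ i0}, ∑ j : Fin p, a (some (i, j)) * om i j := by
    simp [B]
  have haV : ∀ o, a o ∈ AV p (cl x) := fun o => AV_mono hWV (ha o)
  have hBV : ∀ i, B i ∈ AV p (cl x) := by
    intro i
    simp only [B]
    split_ifs with h
    · exact sum_mem fun j _ => mul_mem (haV _) (pdV _ _)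
    · exact add_mem (mul_mem (haV _) hSV) (sum_mem fun i _ => sum_mem fun j _ =>
        mul_mem (haV _) (omV _ _))
  have hBsum : ∑ i, B i * (dl p (x i) - 1) = 0 := by
    rw [← hsum, Fintype.sum_eq_add_sum_subtype_ne _ i0, hB0, hSz]
    simp only [omE, hB1]
    simp only [mul_add, Finset.sum_add_distrib, add_mul, Finset.sum_mul, mul_assoc]
    rw [← hx0]
    abel
  have hB := hF B hBV hBsum
  have hs : ∀ ij, a (some ij) = 0 := by
    rintro ⟨⟨i, hi⟩, j⟩
    have h1 := hB i
    rw [hB1 ⟨i, hi⟩] at h1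
    have h2 := tri (W := W) (x := x0) p hnm
      (fun j => if h : j < p then a (some (⟨i, hi⟩, ⟨j, h⟩)) else 0) (fun j => pd (x i) j)
      (fun j hj => by simp only [hj, dif_pos]; exact ha _)
      (fun j hj => pdE i hi j hj)
      (by rw [← h1, Finset.sum_range]; simp) j j.2
    simpa using h2
  have hnone : a none = 0 := by
    have h1 := hB i0
    rw [hB0] at h1
    simp only [hs, zero_mul, Finset.sum_const_zero, add_zero] at h1
    refine tri_single (W := W) (x := x0) (m := p - 1) (e := S)
      (fun l hl => hnm _ (by omega) (by omega)) (ha none) hSE ?_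
    rw [h1]; exact zero_mem _
  intro o
  match o with
  | none => exact hnone
  | some ij => exact hs ij

end grp
end LZO

set_option linter.unusedSectionVars false
set_option linter.unusedSimpArgs false
namespace LZO
section contr
variable {p : ℕ} [Fact p.Prime] {G : Type} [Group G] {ι : Type}

noncomputable def Dt (x0 : G) : Alg p G →ₗ[ZMod p] Alg p G := (cj x0).toLinearMap - LinearMap.id

lemma Dt_apply (x0 : G) (a : Alg p G) : Dt x0 a = cj x0 a - a := rfl

lemma cj_eq_Dt (x0 : G) (a : Alg p G) : cj x0 a = a + Dt x0 a := by rw [Dt_apply]; abel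

lemma Dt_mul (x0 : G) (a b : Alg p G) : Dt x0 (a * b) = Dt x0 a * cj x0 b + a * Dt x0 b := by
  simp only [Dt_apply, map_mul]; noncomm_ring

lemma Dt_one (x0 : G) : Dt x0 (1 : Alg p G) = 0 := by simp [Dt_apply]

lemma Dt_inv (x0 g : G) : Dt x0 (dl p g⁻¹) = - dl p g⁻¹ * Dt x0 (dl p g) * cj x0 (dl p g⁻¹) := by
  rw [Dt_apply, Dt_apply, mul_sub, sub_mul, ← neg_inj]
  have h1 : cj x0 (dl p g) * cj x0 (dl p g⁻¹) = 1 := by rw [← map_mul, ← map_mul]; simp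
  have h2 : dl p g⁻¹ * dl p g = 1 := by rw [← map_mul]; simp
  simp only [neg_mul, mul_assoc, h1]
  rw [← mul_assoc (dl p g⁻¹) (dl p g), h2]; simp; abel

lemma Dt_cm (x0 g : G) (j : ℕ) :
    Dt x0 (dl p (cm x0 j g) - 1) = (dl p (cm x0 (j + 1) g) - 1) * dl p (cm x0 j g) := by
  rw [map_sub, Dt_one, sub_zero, Dt_apply, cj_dl, cm_conj, sub_mul, one_mul, map_mul]

lemma Dt_pow_p (x0 : G) (a : Alg p G) : (Dt x0 ^ p) a = cj (x0 ^ p) a - a := by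
  have : CharP (Module.End (ZMod p) (Alg p G)) p := by
    refine Module.charP_end ⟨1, ?_⟩
    rw [eq_bot_iff]
    intro c hc
    rw [Ideal.mem_torsionOf_iff] at hc
    have := congrArg aug hc
    simpa using this
  have h := sub_pow_char_of_commute (R := Module.End (ZMod p) (Alg p G)) p
    (x := (cj x0).toLinearMap) (y := 1) (Commute.one_right _)
  have h2 : (Dt x0 : Module.End (ZMod p) (Alg p G)) = (cj x0).toLinearMap - 1 := rfl
  rw [h2, h, one_pow]
  have h3 : ∀ n : ℕ, ((cj x0).toLinearMap ^ n : Module.End (ZMod p) (Alg p G)) a = cj (x0 ^ n) a := by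
    intro n
    induction n with
    | zero => simp [cj_eq]
    | succ n ih =>
      rw [pow_succ', Module.End.mul_apply, ih]
      rw [AlgHom.toLinearMap_apply, cj_eq, cj_eq, cj_eq, pow_succ' x0, mul_inv_rev, map_mul, map_mul]
      simp only [mul_assoc]
  rw [LinearMap.sub_apply, h3]; rfl

variable {y : ι → G} {w : ι → ℝ} {x0 : G} {s : ℝ}

def Good (p : ℕ) [Fact p.Prime] {G : Type} [Group G] {ι : Type} (y : ι → G) (w : ι → ℝ) (x0 : G) (s : ℝ) :
    ℕ → ℝ → Alg p G → Prop
  | 0, α, a => JM p y w α a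
  | m + 1, α, a => JM p y w α a ∧ Good p y w x0 s m (α * s) (Dt x0 a)

lemma Good.jm {m : ℕ} {α : ℝ} {a : Alg p G} (h : Good p y w x0 s m α a) : JM p y w α a := by
  cases m with
  | zero => exact h
  | succ m => exact h.1

lemma Good.pred {m : ℕ} : ∀ {α : ℝ} {a : Alg p G}, Good p y w x0 s (m + 1) α a →
    Good p y w x0 s m α a := by
  induction m with
  | zero => intro α a h; exact h.1
  | succ m ih => intro α a h; exact ⟨h.1, ih h.2⟩

lemma Good.add {m : ℕ} : ∀ {α : ℝ} {a b : Alg p G}, Good p y w x0 s m α a →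
    Good p y w x0 s m α b → Good p y w x0 s m α (a + b) := by
  induction m with
  | zero => intro α a b h1 h2; exact JM.add h1 h2
  | succ m ih => intro α a b h1 h2; exact ⟨h1.1.add h2.1, by rw [map_add]; exact ih h1.2 h2.2⟩

lemma Good.mono (hs : 0 < s) {m : ℕ} : ∀ {α β : ℝ} {a : Alg p G}, α ≤ β →
    Good p y w x0 s m α a → Good p y w x0 s m β a := by
  induction m with
  | zero => intro α β a h h1; exact JM.mono h h1
  | succ m ih => intro α β a h h1; exact ⟨h1.1.mono h, ih (by gcongr) h1.2⟩

lemma Good.zero {m : ℕ} : ∀ {α : ℝ}, Good p y w x0 s m α (0 : Alg p G) := by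
  induction m with
  | zero => intro α; exact JM.zero _
  | succ m ih => intro α; exact ⟨JM.zero _, by rw [map_zero]; exact ih⟩

lemma Good.one {m : ℕ} : Good p y w x0 s m 1 (1 : Alg p G) := by
  cases m with
  | zero => exact JM.top (one_mem _) le_rfl
  | succ m => exact ⟨JM.top (one_mem _) le_rfl, by rw [Dt_one]; exact Good.zero⟩

lemma Good.neg {m : ℕ} : ∀ {α : ℝ} {a : Alg p G}, Good p y w x0 s m α a →
    Good p y w x0 s m α (-a) := by
  induction m with
  | zero => intro α a h1; exact JM.neg h1
  | succ m ih => intro α a h1; exact ⟨h1.1.neg, by rw [map_neg]; exact ih h1.2⟩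

lemma Good.cj (hs : 0 < s) (hs1 : s ≤ 1) {m : ℕ} {α : ℝ} (hα : 0 ≤ α) {a : Alg p G}
    (h : Good p y w x0 s (m + 1) α a) : Good p y w x0 s m α (cj x0 a) := by
  rw [cj_eq_Dt]
  exact h.pred.add (Good.mono hs (by nlinarith) h.2)

lemma Good.mul (hs : 0 < s) (hs1 : s ≤ 1) {m : ℕ} : ∀ {α β : ℝ} (_ : 0 ≤ α) (_ : 0 ≤ β)
    {a b : Alg p G}, Good p y w x0 s m α a →
    Good p y w x0 s m β b → Good p y w x0 s m (α * β) (a * b) := by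
  induction m with
  | zero => intro α β _ _ a b h1 h2; exact JM.mul h1 h2
  | succ m ih =>
    intro α β hα hβ a b h1 h2
    refine ⟨h1.1.mul h2.1, ?_⟩
    rw [Dt_mul]
    refine Good.add ?_ ?_
    · have := ih (by positivity) hβ h1.2 (h2.cj hs hs1 hβ)
      convert this using 1; ring
    · have := ih hα (by positivity) h1.pred h2.2
      convert this using 1; ring

lemma Good.inv (hs : 0 < s) (hs1 : s ≤ 1) (hn : ∀ g ∈ cl y, x0 * g * x0⁻¹ ∈ cl y) {m : ℕ} :
    ∀ {g : G}, g ∈ cl y → Good p y w x0 s m 1 (dl p g) → Good p y w x0 s m 1 (dl p g⁻¹) := by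
  induction m with
  | zero => intro g hg _; exact JM.top (dl_mem (inv_mem hg)) le_rfl
  | succ m ih =>
    intro g hg h
    refine ⟨JM.top (dl_mem (inv_mem hg)) le_rfl, ?_⟩
    rw [Dt_inv, cj_dl]
    have e : x0 * g⁻¹ * x0⁻¹ = (x0 * g * x0⁻¹)⁻¹ := by group
    rw [e]
    have h1 := ih hg h.pred
    have h2 := ih (hn g hg) (by rw [← cj_dl]; exact h.cj hs hs1 zero_le_one)
    have := Good.mul hs hs1 (by simpa using hs.le) zero_le_one
      (Good.mul hs hs1 zero_le_one (by simpa using hs.le) h1.neg h.2) h2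
    simpa using this

lemma Good.extend {m : ℕ} : ∀ {α : ℝ} {a : Alg p G}, Good p y w x0 s m α a →
    JM p y w (α * s ^ (m + 1)) ((Dt x0 ^ (m + 1)) a) → Good p y w x0 s (m + 1) α a := by
  induction m with
  | zero => intro α a h h1; exact ⟨h, by simpa [Good] using h1⟩
  | succ m ih =>
    intro α a h h1
    refine ⟨h.1, ih h.2 ?_⟩
    have e : α * s ^ (m + 1 + 1) = α * s * s ^ (m + 1) := by ring
    have e2 : (Dt x0 ^ (m + 1 + 1)) a = (Dt x0 ^ (m + 1)) (Dt x0 a) := by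
      rw [pow_succ, Module.End.mul_apply]
    rw [e, e2] at h1
    exact h1

end contr

section restr
variable {p : ℕ} [Fact p.Prime] {G : Type} [Group G] {ι : Type} (x : ι → G) (w : ι → ℝ) (i0 : ι)

lemma nw_pos (hw : ∀ i, 0 < w i) (o) : 0 < nw p w i0 o := by
  have := hw i0
  match o with
  | none => simp only [nw]; positivity
  | some (i, j) => have := hw i; simp only [nw]; positivity

lemma nw_lt (hw : ∀ i, 0 < w i) (hw1 : ∀ i, w i < 1) (o) : nw p w i0 o < 1 := by
  have := hw i0
  match o with
  | none => exact pow_lt_one₀ (hw i0).le (hw1 i0) (p_pos.ne')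
  | some (i, j) =>
    have h1 := hw i
    have h2 : w i0 ^ (j : ℕ) ≤ 1 := pow_le_one₀ (hw i0).le (hw1 i0).le
    have := hw1 i
    simp only [nw]; nlinarith

lemma jm_cm {i : ι} (hi : i ≠ i0) {j : ℕ} (hj : j < p) :
    JM p (ny p x i0) (nw p w i0) (w i * w i0 ^ j) (dl p (cm (x i0) j (x i)) - 1) :=
  JM.gen (y := ny p x i0) (w := nw p w i0) (some (⟨i, hi⟩, ⟨j, hj⟩))

lemma jm_z : JM p (ny p x i0) (nw p w i0) (w i0 ^ p) (dl p (x i0 ^ p) - 1) :=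
  JM.gen (y := ny p x i0) (w := nw p w i0) none

lemma good1 (hw : ∀ i, 0 < w i) (hw1 : ∀ i, w i < 1) {i : ι} (hi : i ≠ i0) (m : ℕ) :
    ∀ j, j + m < p → Good p (ny p x i0) (nw p w i0) (x i0) (w i0) m (w i * w i0 ^ j)
      (dl p (cm (x i0) j (x i)) - 1) := by
  induction m with
  | zero => intro j hj; exact jm_cm x w i0 hi (by omega)
  | succ m ih =>
    intro j hj
    have h0 := hw i0
    have hi0 := hw i
    refine ⟨jm_cm x w i0 hi (by omega), ?_⟩
    rw [Dt_cm]
    have h1 := ih (j + 1) (by omega)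
    have h2 : Good p (ny p x i0) (nw p w i0) (x i0) (w i0) m 1 (dl p (cm (x i0) j (x i))) := by
      have h3 := (Good.mono (β := 1) (hw i0) ?_ (ih j (by omega))).add Good.one
      · simpa using h3
      · have : w i0 ^ j ≤ 1 := pow_le_one₀ (hw i0).le (hw1 i0).le
        have := hw1 i
        nlinarith
    have := Good.mul (hw i0) (hw1 i0).le (by positivity) zero_le_one h1 h2
    convert this using 1; ring

lemma good2 (hw : ∀ i, 0 < w i) (hw1 : ∀ i, w i < 1) {i : ι} (hi : i ≠ i0) :
    Good p (ny p x i0) (nw p w i0) (x i0) (w i0) p (w i) (dl p (x i) - 1) := by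
  obtain ⟨q, hq⟩ : ∃ q, p = q + 1 := ⟨p - 1, by have := p_pos (p := p); omega⟩
  have h1 := good1 (p := p) x w i0 hw hw1 hi q 0 (by omega)
  simp only [pow_zero, mul_one, cm] at h1
  have h2 : JM p (ny p x i0) (nw p w i0) (w i * w i0 ^ p)
      ((Dt (x i0) ^ p) (dl p (x i) - 1)) := by
    rw [Dt_pow_p, cj_eq]
    have h3 : JM p (ny p x i0) (nw p w i0) (w i) (dl p (x i) - 1) := by
      have := jm_cm x w i0 hi (p_pos (p := p)); simpa [cm] using this
    have h4 := jm_z (p := p) x w i0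
    have h5 := ((h4.mul h3).mono (mul_comm _ _).le).sub (h3.mul h4)
    have h6 := h5.mul_right (dl_mem (p := p) (inv_mem (z_mem (p := p) x i0)))
    convert h6 using 1
    have e : dl p (x i0 ^ p) * dl p (x i0 ^ p)⁻¹ = 1 := by rw [← map_mul]; simp
    have : ((dl p (x i0 ^ p) - 1) * (dl p (x i) - 1) - (dl p (x i) - 1) * (dl p (x i0 ^ p) - 1)) =
      dl p (x i0 ^ p) * (dl p (x i) - 1) - (dl p (x i) - 1) * dl p (x i0 ^ p) := by noncomm_ring
    rw [this, sub_mul, mul_assoc (dl p (x i) - 1), e, mul_one]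
  have hq' : ∀ n, p = n + 1 → Good p (ny p x i0) (nw p w i0) (x i0) (w i0) n (w i) (dl p (x i) - 1) →
     Good p (ny p x i0) (nw p w i0) (x i0) (w i0) p (w i) (dl p (x i) - 1) := by
    intro n hn h
    have h2' : JM p (ny p x i0) (nw p w i0) (w i * w i0 ^ (n + 1))
      ((Dt (x i0) ^ (n + 1)) (dl p (x i) - 1)) := by
      have h7 := h2
      generalize hm : (Dt (x i0) : Module.End (ZMod p) (Alg p G)) = D at h7 ⊢
      have : ∀ k, k = n + 1 → JM p (ny p x i0) (nw p w i0) (w i * w i0 ^ k)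
        ((D ^ k) (dl p (x i) - 1)) → JM p (ny p x i0) (nw p w i0) (w i * w i0 ^ (n + 1))
        ((D ^ (n + 1)) (dl p (x i) - 1)) := by rintro k rfl h; exact h
      exact this p hn h7
    have h3 := h.extend h2'
    have : ∀ k, k = n + 1 → Good p (ny p x i0) (nw p w i0) (x i0) (w i0) k (w i) (dl p (x i) - 1) := by
      rintro k rfl; exact h3
    exact this p hn
  exact hq' q hq h1

lemma good3 (hw : ∀ i, 0 < w i) (hw1 : ∀ i, w i < 1) {i : ι} (hi : i ≠ i0) (j : ℕ) :
    ∀ m, j + m = p → Good p (ny p x i0) (nw p w i0) (x i0) (w i0) m (w i * w i0 ^ j)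
      (dl p (cm (x i0) j (x i)) - 1) := by
  induction j with
  | zero =>
    intro m hm
    have : m = p := by omega
    have h := good2 (p := p) x w i0 hw hw1 hi
    simp only [pow_zero, mul_one, cm]
    have : ∀ k, k = p → Good p (ny p x i0) (nw p w i0) (x i0) (w i0) k (w i) (dl p (x i) - 1) := by
      rintro k rfl; exact h
    exact this m (by omega)
  | succ j ih =>
    intro m hm
    have h0 := hw i0
    have hi0 := hw i
    have h1 := ih (m + 1) (by omega)
    have hle : w i * w i0 ^ j ≤ 1 := by
        have : w i0 ^ j ≤ 1 := pow_le_one₀ (hw i0).le (hw1 i0).le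
        have := hw1 i
        nlinarith
    have h2 : Good p (ny p x i0) (nw p w i0) (x i0) (w i0) m 1 (dl p (cm (x i0) j (x i))⁻¹) := by
      refine Good.inv h0 (hw1 i0).le (fun g hg => sig_mem x i0 hg) (cm_mem x hi (by omega)) ?_
      have h3 := (Good.mono (β := 1) (hw i0) hle h1.pred).add Good.one
      simpa using h3
    have h3 := Good.mul h0 (hw1 i0).le (by positivity) zero_le_one h1.2 h2
    have e3 : Dt (x i0) (dl p (cm (x i0) j (x i)) - 1) * dl p (cm (x i0) j (x i))⁻¹ =
        dl p (cm (x i0) (j + 1) (x i)) - 1 := by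
      rw [Dt_cm, mul_assoc, ← map_mul, mul_inv_cancel, map_one, mul_one]
    rw [e3] at h3
    have e4 : w i * w i0 ^ j * w i0 * 1 = w i * w i0 ^ (j + 1) := by ring
    rw [e4] at h3
    exact h3

/-- contraction -/
lemma contract (hw : ∀ i, 0 < w i) (hw1 : ∀ i, w i < 1) {u : ℝ} {a : Alg p G}
    (h : JM p (ny p x i0) (nw p w i0) u a) :
    JM p (ny p x i0) (nw p w i0) (u * w i0) (Dt (x i0) a) := by
  have hs := hw i0
  have hs1 := hw1 i0
  have hgen : ∀ o, JM p (ny p x i0) (nw p w i0) (nw p w i0 o * w i0)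
      (Dt (x i0) (dl p (ny p x i0 o) - 1)) := by
    intro o
    match o with
    | none =>
      have : Dt (x i0) (dl p (ny p x i0 none) - 1) = 0 := by
        rw [map_sub, Dt_one, Dt_apply, cj_dl, sub_zero]
        have : x i0 * ny p x i0 none * (x i0)⁻¹ = ny p x i0 none := by simp only [ny]; group
        rw [this, sub_self]
      rw [this]; exact JM.zero _
    | some (⟨i, hi⟩, ⟨j, hj⟩) =>
      obtain ⟨m, hm⟩ : ∃ m, j + (m + 1) = p := ⟨p - 1 - j, by omega⟩
      have := (good3 (p := p) x w i0 hw hw1 hi j (m + 1) hm).2.jm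
      exact this
  have hcj : ∀ g ∈ cl (ny p x i0), cj (x i0) (dl p g) ∈ AV p (cl (ny p x i0)) := by
    intro g hg; rw [cj_dl]; exact dl_mem (sig_mem x i0 hg)
  induction h with
  | top h h1 =>
    refine JM.mono (u := w i0) (by nlinarith) ?_
    refine AV_induction (P := fun a => JM p (ny p x i0) (nw p w i0) (w i0) (Dt (x i0) a)) ?_
      (by rw [map_zero]; exact JM.zero _) (fun a b h1 h2 => by rw [map_add]; exact h1.add h2)
      (fun c a h => by rw [map_smul]; exact h.smul c) h
    intro g hg
    induction hg using Subgroup.closure_induction with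
    | mem g hg =>
      obtain ⟨o, rfl⟩ := hg
      have := hgen o
      rw [map_sub, Dt_one, sub_zero] at this
      refine this.mono ?_
      have := nw_lt (p := p) w i0 hw hw1 o
      nlinarith
    | one => rw [map_one, Dt_one]; exact JM.zero _
    | mul a b ha hb h1 h2 =>
      rw [map_mul, Dt_mul]
      exact (h1.mul_right (hcj b hb)).add (h2.mul_left (dl_mem ha))
    | inv a ha h1 =>
      rw [Dt_inv]
      exact (h1.mul_left (neg_mem (dl_mem (inv_mem ha)))).mul_right (hcj _ (inv_mem ha))
  | gen o => exact hgen o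
  | @mul u t a b ha hb h1 h2 =>
    rw [Dt_mul]
    rcases hb.pos (nw_pos w i0 hw) with rfl | ht
    · simpa using JM.zero _
    refine JM.add ?_ ?_
    · have h3 : JM p (ny p x i0) (nw p w i0) t (cj (x i0) b) := by
        rw [cj_eq_Dt]; exact hb.add (h2.mono (by nlinarith))
      exact (h1.mul h3).mono (le_of_eq (by ring))
    · exact (ha.mul h2).mono (le_of_eq (by ring))
  | add _ _ h1 h2 => rw [map_add]; exact h1.add h2
  | zero => rw [map_zero]; exact JM.zero _
  | mono h _ h1 => exact h1.mono (by gcongr)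

lemma cj_jm (hw : ∀ i, 0 < w i) (hw1 : ∀ i, w i < 1) {u : ℝ} {a : Alg p G}
    (h : JM p (ny p x i0) (nw p w i0) u a) :
    JM p (ny p x i0) (nw p w i0) u (cj (x i0) a) := by
  rcases h.pos (nw_pos w i0 hw) with rfl | ht
  · simpa using JM.zero _
  rw [cj_eq_Dt]
  have := hw1 i0
  exact h.add ((contract x w i0 hw hw1 h).mono (by nlinarith))

def Tx (p : ℕ) [Fact p.Prime] {G : Type} [Group G] {ι : Type} (x : ι → G) (w : ι → ℝ) (i0 : ι) (u : ℝ)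
    (a : Alg p G) : Prop :=
  ∃ b : ℕ → Alg p G, a = ∑ j ∈ Finset.range p, b j * (dl p (x i0) - 1) ^ j ∧
    ∀ j < p, JM p (ny p x i0) (nw p w i0) (u / w i0 ^ j) (b j)

variable {x w i0}

lemma Tx.zero (u : ℝ) : Tx p x w i0 u 0 := ⟨0, by simp, fun _ _ => JM.zero _⟩

lemma Tx.add {u : ℝ} {a b : Alg p G} (h1 : Tx p x w i0 u a) (h2 : Tx p x w i0 u b) :
    Tx p x w i0 u (a + b) := by
  obtain ⟨c, rfl, hc⟩ := h1
  obtain ⟨d, rfl, hd⟩ := h2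
  exact ⟨c + d, by simp [add_mul, Finset.sum_add_distrib], fun j hj => (hc j hj).add (hd j hj)⟩

lemma Tx.mono (hw : ∀ i, 0 < w i) {u t : ℝ} (hut : u ≤ t) {a : Alg p G} (h : Tx p x w i0 u a) :
    Tx p x w i0 t a := by
  obtain ⟨c, rfl, hc⟩ := h
  exact ⟨c, rfl, fun j hj => (hc j hj).mono (by have := hw i0; gcongr)⟩

lemma Tx.jmul {u t : ℝ} {a b : Alg p G} (h : JM p (ny p x i0) (nw p w i0) t a)
    (hb : Tx p x w i0 u b) : Tx p x w i0 (t * u) (a * b) := by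
  obtain ⟨c, rfl, hc⟩ := hb
  refine ⟨fun j => a * c j, by simp [Finset.mul_sum, mul_assoc], fun j hj => ?_⟩
  rw [mul_div_assoc]; exact h.mul (hc j hj)

lemma Tx.sum {u : ℝ} {n : ℕ} {f : ℕ → Alg p G} (h : ∀ j < n, Tx p x w i0 u (f j)) :
    Tx p x w i0 u (∑ j ∈ Finset.range n, f j) := by
  induction n with
  | zero => simpa using Tx.zero u
  | succ n ih =>
    rw [Finset.sum_range_succ]
    exact (ih fun j hj => h j (by omega)).add (h n (by omega))

lemma Tx.of_jm {u : ℝ} {a : Alg p G} (h : JM p (ny p x i0) (nw p w i0) u a) : Tx p x w i0 u a := by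
  refine ⟨fun j => if j = 0 then a else 0, ?_, ?_⟩
  · rw [Finset.sum_eq_single 0]
    · simp
    · intro j _ hj; simp [hj]
    · intro h; exact absurd (Finset.mem_range.2 p_pos) h
  · intro j _
    dsimp only; split_ifs with h0
    · subst h0; simpa using h
    · exact JM.zero _

lemma Tx.mul_xi (hw : ∀ i, 0 < w i) {u : ℝ} {a : Alg p G} (h : Tx p x w i0 u a) :
    Tx p x w i0 (u * w i0) (a * (dl p (x i0) - 1)) := by
  have hs := hw i0
  obtain ⟨c, rfl, hc⟩ := h
  obtain ⟨q, hq⟩ : ∃ q, p = q + 1 := ⟨p - 1, by have := p_pos (p := p); omega⟩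
  have hp1 : ∑ j ∈ Finset.range p, c j * (dl p (x i0) - 1) ^ j =
    ∑ j ∈ Finset.range (q + 1), c j * (dl p (x i0) - 1) ^ j := by rw [← hq]
  rw [hp1, Finset.sum_mul, Finset.sum_range_succ]
  refine Tx.add ?_ ?_
  · refine ⟨fun j => if j = 0 then 0 else c (j - 1), ?_, ?_⟩
    · have : ∀ f : ℕ → Alg p G, ∑ j ∈ Finset.range p, f j = ∑ j ∈ Finset.range (q + 1), f j := by
        intro f; rw [← hq]
      rw [this, Finset.sum_range_succ']
      simp [mul_assoc, pow_succ]
    · intro j hj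
      dsimp only
      split_ifs with h0
      · exact JM.zero _
      · obtain ⟨l, rfl⟩ := Nat.exists_eq_succ_of_ne_zero h0
        refine (hc l (by omega)).mono (le_of_eq ?_)
        rw [Nat.succ_eq_add_one, pow_succ]; field_simp
  · apply Tx.of_jm
    have e : c q * (dl p (x i0) - 1) ^ q * (dl p (x i0) - 1) = c q * (dl p (x i0 ^ p) - 1) := by
      have := dl_pow_sub (p := p) (x i0) 1
      rw [pow_one] at this
      have h2 : (dl p (x i0) - 1) ^ p = (dl p (x i0) - 1) ^ (q + 1) := by rw [← hq]
      rw [this, h2, pow_succ, mul_assoc]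
    rw [e]
    refine ((hc q (by omega)).mul (jm_z x w i0)).mono (le_of_eq ?_)
    have h2 : w i0 ^ p = w i0 ^ (q + 1) := by rw [← hq]
    rw [h2, pow_succ]; field_simp

lemma Tx.xi_mul (hw : ∀ i, 0 < w i) (hw1 : ∀ i, w i < 1) {u : ℝ} {a : Alg p G}
    (h : Tx p x w i0 u a) : Tx p x w i0 (u * w i0) ((dl p (x i0) - 1) * a) := by
  have hs := hw i0
  obtain ⟨c, rfl, hc⟩ := h
  have e : (dl p (x i0) - 1) * ∑ j ∈ Finset.range p, c j * (dl p (x i0) - 1) ^ j =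
    (∑ j ∈ Finset.range p, cj (x i0) (c j) * (dl p (x i0) - 1) ^ j) * (dl p (x i0) - 1) +
    ∑ j ∈ Finset.range p, Dt (x i0) (c j) * (dl p (x i0) - 1) ^ j := by
    rw [Finset.mul_sum, Finset.sum_mul, ← Finset.sum_add_distrib]
    refine Finset.sum_congr rfl fun j _ => ?_
    rw [← mul_assoc, mul_assoc _ _ (dl p (x i0) - 1), ← pow_succ, pow_succ', ← mul_assoc, ← add_mul]
    congr 1
    rw [sub_mul, x_mul_eq, Dt_apply]; noncomm_ring
  rw [e]
  refine Tx.add (Tx.mul_xi hw ⟨_, rfl, fun j hj => cj_jm x w i0 hw hw1 (hc j hj)⟩)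
    ⟨_, rfl, fun j hj => (contract x w i0 hw hw1 (hc j hj)).mono (le_of_eq (by ring))⟩

lemma Tx.mul (hw : ∀ i, 0 < w i) (hw1 : ∀ i, w i < 1) {u t : ℝ} {a b : Alg p G}
    (ha : Tx p x w i0 u a) (hb : Tx p x w i0 t b) : Tx p x w i0 (u * t) (a * b) := by
  have hs := hw i0
  obtain ⟨c, rfl, hc⟩ := ha
  rw [Finset.sum_mul]
  refine Tx.sum fun j hj => ?_
  have h1 : ∀ j : ℕ, Tx p x w i0 (t * w i0 ^ j) ((dl p (x i0) - 1) ^ j * b) := by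
    intro j
    induction j with
    | zero => simpa using hb
    | succ j ih =>
      have e1 : (dl p (x i0) - 1) ^ (j + 1) * b = (dl p (x i0) - 1) * ((dl p (x i0) - 1) ^ j * b) := by
        rw [pow_succ', mul_assoc]
      have e2 : t * w i0 ^ (j + 1) = t * w i0 ^ j * w i0 := by rw [pow_succ, mul_assoc]
      rw [e1, e2]
      exact Tx.xi_mul hw hw1 ih
  have e3 : c j * (dl p (x i0) - 1) ^ j * b = c j * ((dl p (x i0) - 1) ^ j * b) := mul_assoc _ _ _
  rw [e3]
  have := Tx.jmul (hc j hj) (h1 j)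
  refine this.mono hw (le_of_eq ?_)
  field_simp

lemma Tx.of (hw : ∀ i, 0 < w i) (hw1 : ∀ i, w i < 1) {u : ℝ} {a : Alg p G} (h : JM p x w u a) :
    Tx p x w i0 u a := by
  have hs := hw i0
  have hone : Tx p x w i0 1 1 := Tx.of_jm (JM.top (one_mem _) le_rfl)
  have hxi : Tx p x w i0 (w i0) (dl p (x i0) - 1) := by
    have := Tx.mul_xi hw hone; simpa using this
  induction h with
  | top h h1 =>
    refine Tx.mono hw h1 ?_
    refine AV_induction (P := fun a => Tx p x w i0 1 a) ?_ (Tx.zero _)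
      (fun a b h1 h2 => h1.add h2) ?_ h
    · intro g hg
      obtain ⟨c, hcm, k, _, rfl⟩ := G2 (p := p) x i0 hg
      have hk : ∀ k : ℕ, Tx p x w i0 1 (dl p (x i0 ^ k)) := by
        intro k
        induction k with
        | zero => simpa using hone
        | succ k ih =>
          rw [pow_succ, map_mul]
          have : Tx p x w i0 1 (dl p (x i0)) := by
            have := (Tx.mono hw (hw1 i0).le hxi).add hone
            simpa using this
          simpa using Tx.mul hw hw1 ih this
      rw [map_mul]
      simpa using Tx.jmul (JM.top (dl_mem hcm) le_rfl) (hk k)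
    · intro c a h
      have := Tx.jmul (JM.top (Subalgebra.algebraMap_mem _ c) le_rfl) h
      rw [← Algebra.smul_def] at this
      simpa using this
  | gen i =>
    by_cases hi : i = i0
    · subst hi; exact hxi
    · apply Tx.of_jm
      have := jm_cm x w i0 hi (p_pos (p := p))
      simpa [cm] using this
  | mul _ _ h1 h2 => exact Tx.mul hw hw1 h1 h2
  | add _ _ h1 h2 => exact h1.add h2
  | zero => exact Tx.zero _
  | mono h _ h1 => exact h1.mono hw h

/-- restriction -/
lemma restrict (hw : ∀ i, 0 < w i) (hw1 : ∀ i, w i < 1)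
    (hnm : ∀ l, 0 < l → l < p → x i0 ^ l ∉ cl (ny p x i0)) {u : ℝ} {a : Alg p G}
    (h : JM p x w u a) (ha : a ∈ AV p (cl (ny p x i0))) : JM p (ny p x i0) (nw p w i0) u a := by
  obtain ⟨b, hb, hj⟩ := Tx.of (i0 := i0) hw hw1 h
  have hE : ∀ j, (dl p (x i0) - 1) ^ j - dl p (x i0 ^ j) ∈ Lx p (cl (ny p x i0)) (x i0) j := by
    intro j
    induction j with
    | zero => simp
    | succ j ih =>
      rw [pow_succ' (dl p (x i0) - 1)]
      exact Lx_E_succ (fun g hg => sig_mem x i0 hg) (one_mem _) ih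
  have h0 := tri (W := cl (ny p x i0)) (x := x i0) p hnm
    (fun j => b j - if j = 0 then a else 0) (fun j => (dl p (x i0) - 1) ^ j)
    (by
      intro j hj'
      refine sub_mem (hj j hj').mem ?_
      split_ifs
      · exact ha
      · exact zero_mem _) (fun j _ => hE j)
    (by
      simp only [sub_mul, Finset.sum_sub_distrib]
      rw [← hb, Finset.sum_eq_single 0]
      · simp
      · intro j _ hj; simp [hj]
      · intro h; exact absurd (Finset.mem_range.2 p_pos) h) 0 p_pos
  have h1 := hj 0 p_pos
  simp only [if_true] at h0
  rw [sub_eq_zero.1 h0] at h1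
  simpa using h1

lemma cm_Vf {y : ι → G} {x0 g : G} {s t : ℝ} (h0 : x0 ∈ Vf p y w s) (hg : g ∈ Vf p y w t) (j : ℕ) :
    cm x0 j g ∈ Vf p y w (t * s ^ j) := by
  induction j with
  | zero => simpa [cm] using hg
  | succ j ih =>
    have := Vf_comm h0 ih
    simp only [cm]
    convert this using 1; ring

lemma unrestrict {u : ℝ} {a : Alg p G}
    (h : JM p (ny p x i0) (nw p w i0) u a) : JM p x w u a := by
  refine JM.transfer_id (fun o => ny_le x i0 (y_mem o)) ?_ h
  intro o
  match o with
  | none =>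
    have : x i0 ∈ Vf p x w (w i0) := JM.gen i0
    have := Vf_pow this 1
    rw [pow_one] at this; exact this
  | some (i, j) =>
    exact cm_Vf (JM.gen i0) (JM.gen i.1) j

end restr
end LZO

set_option linter.unusedSectionVars false
set_option linter.unusedSimpArgs false
namespace LZO
section niel
variable {p : ℕ} [Fact p.Prime] {G : Type} [Group G] {ι : Type}

def nx (y : ι → G) (i0 : ι) (k : ι → ℕ) : ι → G := fun i => y i * (y i0 ^ k i)⁻¹

variable (y : ι → G) (i0 : ι) (k : ι → ℕ)

lemma nx_i0 (h0 : k i0 = 0) : nx y i0 k i0 = y i0 := by simp [nx, h0]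

lemma nx_eq (i : ι) : y i = nx y i0 k i * y i0 ^ k i := by simp [nx]

lemma cl_nx (h0 : k i0 = 0) : cl (nx y i0 k) = cl y := by
  apply le_antisymm
  · rw [cl, Subgroup.closure_le]
    rintro _ ⟨i, rfl⟩
    exact mul_mem (y_mem i) (inv_mem (pow_mem (y_mem i0) _))
  · rw [cl, Subgroup.closure_le]
    rintro _ ⟨i, rfl⟩
    rw [nx_eq y i0 k i]
    refine mul_mem (y_mem i) (pow_mem ?_ _)
    rw [← nx_i0 y i0 k h0]; exact y_mem i0

lemma Fr_nx [Fintype ι] [DecidableEq ι] (h0 : k i0 = 0) (hF : Fr p y) : Fr p (nx y i0 k) := by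
  intro a ha hs
  rw [cl_nx y i0 k h0] at ha
  set S : ι → Alg p G := fun j => ∑ l ∈ Finset.range (k j), dl p (y i0) ^ l with hS
  have e : ∀ i, dl p (nx y i0 k i) - 1 = (dl p (y i) - 1) - dl p (nx y i0 k i) * S i * (dl p (y i0) - 1) := by
    intro i
    have h1 : S i * (dl p (y i0) - 1) = dl p (y i0) ^ k i - 1 := geom_sum_mul _ _
    rw [mul_assoc, h1, mul_sub, ← map_pow, ← map_mul, ← nx_eq, mul_one]; abel
  have hxm : ∀ i, nx y i0 k i ∈ cl y := by
    intro i; rw [← cl_nx y i0 k h0]; exact y_mem i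
  have hSm : ∀ i, S i ∈ AV p (cl y) := by
    intro i
    exact sum_mem fun l _ => pow_mem (dl_mem (y_mem i0)) _
  have h1 := hF (fun i => a i - if i = i0 then ∑ j, a j * (dl p (nx y i0 k j) * S j) else 0) (by
      intro i
      refine sub_mem (ha i) ?_
      split_ifs
      · exact sum_mem fun j _ => mul_mem (ha j) (mul_mem (dl_mem (hxm j)) (hSm j))
      · exact zero_mem _) (by
      refine Eq.trans ?_ hs
      simp only [e, mul_sub, sub_mul, Finset.sum_sub_distrib, ite_mul, zero_mul, mul_assoc,
        Finset.sum_ite_eq', Finset.mem_univ, if_true]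
      simp only [Finset.sum_ite_eq', ite_mul, zero_mul, Finset.mem_univ, if_true, mul_sub, mul_one,
        Finset.sum_mul, mul_assoc, Finset.sum_sub_distrib]
      abel)
  have h2 : ∀ i, i ≠ i0 → a i = 0 := by
    intro i hi
    have := h1 i
    simpa [hi] using this
  intro i
  by_cases hi : i = i0
  · subst hi
    have := h1 i
    simp only [if_true] at this
    rw [Finset.sum_eq_single i] at this
    · simpa [hS, h0] using this
    · intro j _ hj; rw [h2 j hj, zero_mul]
    · intro h; exact absurd (Finset.mem_univ _) h
  · exact h2 i hi

lemma Vf_nx (w : ι → ℝ) (hw : ∀ i, k i ≠ 0 → w i0 ≤ w i) (h0 : k i0 = 0) (u : ℝ) :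
    Vf p (nx y i0 k) w u = Vf p y w u := by
  have hg : ∀ i, y i ∈ Vf p y w (w i) := fun i => JM.gen i
  have hg' : ∀ i, nx y i0 k i ∈ Vf p (nx y i0 k) w (w i) := fun i => JM.gen i
  apply le_antisymm
  · intro v hv
    refine JM.transfer_id ?_ ?_ hv
    · intro i; rw [← cl_nx y i0 k h0]; exact y_mem i
    · intro i
      by_cases hk : k i = 0
      · have : nx y i0 k i = y i := by simp [nx, hk]
        rw [this]; exact JM.gen i
      · exact mul_mem (hg i) (inv_mem (pow_mem (Vf_mono (hw i hk) (hg i0)) _))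
  · intro v hv
    refine JM.transfer_id ?_ ?_ hv
    · intro i; rw [cl_nx y i0 k h0]; exact y_mem i
    · intro i
      have h3 : y i0 ∈ Vf p (nx y i0 k) w (w i0) := by
        have := hg' i0; rwa [nx_i0 y i0 k h0] at this
      show y i ∈ Vf p (nx y i0 k) w (w i)
      rw [nx_eq y i0 k i]
      by_cases hk : k i = 0
      · rw [hk, pow_zero, mul_one]; exact hg' i
      · exact mul_mem (hg' i) ((pow_mem (Vf_mono (hw i hk) h3) _))

end niel

section fin
variable {p : ℕ} [Fact p.Prime] {G : Type} [Group G]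

lemma relIndex_of_elem {A B : Subgroup G} (_ : A ≤ B) (hB : B.FG)
    (hc : ∀ a ∈ B, ∀ b ∈ B, a * b * a⁻¹ * b⁻¹ ∈ A) (hp : ∀ b ∈ B, b ^ p ∈ A) : A.relIndex B ≠ 0 := by
  have hn : (A.subgroupOf B).Normal := by
    constructor
    intro n hn g
    rw [Subgroup.mem_subgroupOf] at hn ⊢
    have := mul_mem (hc g g.2 n n.2) hn
    simpa using this
  have : Group.FG B := (Group.fg_iff_subgroup_fg B).2 hB
  have hcomm : ∀ a b : B ⧸ A.subgroupOf B, a * b = b * a := by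
    intro a b
    induction a using QuotientGroup.induction_on with | _ a => ?_
    induction b using QuotientGroup.induction_on with | _ b => ?_
    rw [← QuotientGroup.mk_mul, ← QuotientGroup.mk_mul, QuotientGroup.eq, Subgroup.mem_subgroupOf]
    have := hc (b⁻¹ : B) (b⁻¹).2 (a⁻¹ : B) (a⁻¹).2
    simpa [mul_assoc] using this
  let _ : CommGroup (B ⧸ A.subgroupOf B) := { (inferInstance : Group (B ⧸ A.subgroupOf B)) with mul_comm := hcomm }
  have ht : IsMulTorsion (B ⧸ A.subgroupOf B) := by
    intro a
    induction a using QuotientGroup.induction_on with | _ a => ?_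
    rw [isOfFinOrder_iff_pow_eq_one]
    refine ⟨p, (Fact.out : p.Prime).pos, ?_⟩
    rw [← QuotientGroup.mk_pow, QuotientGroup.eq_one_iff, Subgroup.mem_subgroupOf]
    simpa using hp a a.2
  have hfin : Finite (B ⧸ A.subgroupOf B) := CommGroup.finite_of_fg_isMulTorsion _ ht
  exact Subgroup.index_ne_zero_of_finite

lemma fg_of_relIndex {A B : Subgroup G} (hAB : A ≤ B) (hB : B.FG) (h : A.relIndex B ≠ 0) : A.FG := by
  have : Group.FG B := (Group.fg_iff_subgroup_fg B).2 hB
  have : (A.subgroupOf B).FiniteIndex := ⟨h⟩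
  have h2 : (A.subgroupOf B).FG := (Group.fg_iff_subgroup_fg _).1 (Subgroup.fg_of_index_ne_zero _)
  obtain ⟨S, hS⟩ := h2
  classical
  refine ⟨S.image B.subtype, ?_⟩
  rw [Finset.coe_image, ← MonoidHom.map_closure, hS, Subgroup.subgroupOf_map_subtype, inf_eq_left.2 hAB]

lemma cl_fg {ι : Type} [Finite ι] (y : ι → G) : (cl y).FG :=
  (Subgroup.fg_iff _).2 ⟨_, rfl, Set.finite_range y⟩

lemma exists_mu {ι : Type} [Fintype ι] (w : ι → ℝ) (hw : ∀ i, w i < 1) :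
    ∃ μ, 0 < μ ∧ μ < 1 ∧ ∀ i, w i ≤ μ := by
  obtain ⟨M, hM⟩ : ∃ M < (1 : ℝ), ∀ i ∈ (Finset.univ : Finset ι), w i ≤ M := by
    induction (Finset.univ : Finset ι) using Finset.cons_induction with
    | empty => exact ⟨0, by norm_num, by simp⟩
    | cons a s ha ih =>
      obtain ⟨M, h1, h2⟩ := ih
      refine ⟨max M (w a), max_lt h1 (hw a), ?_⟩
      intro i hi
      rcases Finset.mem_cons.1 hi with rfl | hi
      · exact le_max_right _ _
      · exact (h2 i hi).trans (le_max_left _ _)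
  exact ⟨max M (1/2), by positivity, max_lt hM.1 (by norm_num), fun i => (hM.2 i (Finset.mem_univ _)).trans (le_max_left _ _)⟩

lemma Vf_mu {ι : Type} {y : ι → G} {w : ι → ℝ} {μ : ℝ} (h : ∀ i, w i ≤ μ) : Vf p y w μ = cl y := by
  apply le_antisymm (Vf_le _)
  rw [cl, Subgroup.closure_le]
  rintro _ ⟨i, rfl⟩
  exact JM.mono (h i) (JM.gen i)

lemma Vf_relIndex {ι : Type} [Fintype ι] {y : ι → G} {w : ι → ℝ} (hw : ∀ i, w i < 1) {u : ℝ} (hu : 0 < u) :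
    (Vf p y w u).relIndex (cl y) ≠ 0 := by
  obtain ⟨μ, hμ0, hμ1, hμ⟩ := exists_mu w hw
  have key : ∀ n : ℕ, (Vf p y w (μ ^ (n+1))).relIndex (cl y) ≠ 0 := by
    intro n
    induction n with
    | zero => rw [zero_add, pow_one, Vf_mu hμ]; simp
    | succ n ih =>
      have hp2 : 2 ≤ p := (Fact.out : p.Prime).two_le
      have hle : Vf p y w (μ ^ (n+1+1)) ≤ Vf p y w (μ ^ (n+1)) :=
        Vf_mono (pow_le_pow_of_le_one hμ0.le hμ1.le (by omega))
      have h1 : (Vf p y w (μ ^ (n+1+1))).relIndex (Vf p y w (μ ^ (n+1))) ≠ 0 := by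
        refine relIndex_of_elem (p := p) hle (fg_of_relIndex (Vf_le _) (cl_fg y) ih) ?_ ?_
        · intro a ha b hb
          have := Vf_comm ha hb
          refine Vf_mono ?_ this
          rw [← pow_add]
          exact pow_le_pow_of_le_one hμ0.le hμ1.le (by omega)
        · intro b hb
          have := Vf_pow hb 1
          rw [pow_one] at this
          refine Vf_mono ?_ this
          rw [← pow_mul]
          exact pow_le_pow_of_le_one hμ0.le hμ1.le (by nlinarith)
      exact Subgroup.relIndex_ne_zero_trans h1 ih
  obtain ⟨n, hn⟩ := exists_pow_lt_of_lt_one hu hμ1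
  refine fun h0 => key n ?_
  have hle : Vf p y w (μ ^ (n+1)) ≤ Vf p y w u := by
    refine Vf_mono (le_trans ?_ hn.le)
    exact pow_le_pow_of_le_one hμ0.le hμ1.le (by omega)
  exact Subgroup.relIndex_eq_zero_of_le_left hle h0

/-- nontrivial character of a p-group quotient -/
lemma exists_char_kill {V D : Subgroup G} (hD : D ≤ V) (hn : ∀ v ∈ V, ∀ d ∈ D, v * d * v⁻¹ ∈ D)
    (hi : D.relIndex V ≠ 0) (hp : ∀ v ∈ V, ∃ n : ℕ, v ^ p ^ n ∈ D) (hne : D ≠ V) :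
    ∃ χ : G → ZMod p, IsChar V χ ∧ (∀ d ∈ D, χ d = 0) ∧ ∃ v ∈ V, χ v ≠ 0 := by
  classical
  have hN : (D.subgroupOf V).Normal := by
    constructor
    intro n hn' g
    rw [Subgroup.mem_subgroupOf] at hn' ⊢
    exact hn g g.2 n hn'
  let Q := V ⧸ D.subgroupOf V
  have : (D.subgroupOf V).FiniteIndex := ⟨hi⟩
  have hfin : Finite Q := inferInstance
  have hpg : IsPGroup p Q := by
    intro a
    induction a using QuotientGroup.induction_on with | _ a => ?_
    obtain ⟨n, h⟩ := hp a a.2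
    refine ⟨n, ?_⟩
    rw [← QuotientGroup.mk_pow, QuotientGroup.eq_one_iff, Subgroup.mem_subgroupOf]
    simpa using h
  have hnt : Nontrivial Q := by
    by_contra h
    rw [not_nontrivial_iff_subsingleton] at h
    have := QuotientGroup.subgroup_eq_top_of_subsingleton (D.subgroupOf V) h
    rw [Subgroup.subgroupOf_eq_top] at this
    exact hne (le_antisymm hD this)
  obtain ⟨n, hcard⟩ := hpg.exists_card_eq
  have hn0 : 0 < n := by
    rcases Nat.eq_zero_or_pos n with h | h
    · subst h
      have := Finite.one_lt_card (α := Q)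
      rw [hcard] at this; simp at this
    · exact h
  obtain ⟨M, hM⟩ := Sylow.exists_subgroup_card_pow_prime (G := Q) p (n := n - 1)
    (by rw [hcard]; exact pow_dvd_pow _ (by omega))
  have hpp : p.Prime := Fact.out
  have hidx : M.index = p := by
    have := M.card_mul_index
    rw [hM, hcard] at this
    have h2 : p ^ n = p ^ (n - 1) * p := by rw [← pow_succ]; congr 1; omega
    rw [h2] at this
    exact Nat.eq_of_mul_eq_mul_left (pow_pos hpp.pos _) this
  have hMn : M.Normal := by
    refine Subgroup.normal_of_index_eq_minFac_card ?_
    rw [hidx, hcard, hpp.pow_minFac (by omega)]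
  have hc : Nat.card (Q ⧸ M) = p := by rw [← Subgroup.index_eq_card]; exact hidx
  have hc2 : Nat.card (Multiplicative (ZMod p)) = p := by
    simp
  let e : Q ⧸ M ≃* Multiplicative (ZMod p) := mulEquivOfPrimeCardEq hc hc2
  let φ : V →* Multiplicative (ZMod p) :=
    e.toMonoidHom.comp ((QuotientGroup.mk' M).comp (QuotientGroup.mk' (D.subgroupOf V)))
  have hφs : Function.Surjective φ :=
    e.surjective.comp ((QuotientGroup.mk'_surjective M).comp (QuotientGroup.mk'_surjective _))
  refine ⟨fun g => if h : g ∈ V then (φ ⟨g, h⟩).toAdd else 0, ?_, ?_, ?_⟩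
  · intro a ha b hb
    simp only [ha, hb, mul_mem ha hb, dif_pos]
    rw [← toAdd_mul, ← map_mul]; rfl
  · intro d hd
    simp only [hD hd, dif_pos]
    have h1 : (QuotientGroup.mk' (D.subgroupOf V)) ⟨d, hD hd⟩ = 1 := by
      rw [QuotientGroup.mk'_apply, QuotientGroup.eq_one_iff]; exact hd
    have : φ ⟨d, hD hd⟩ = 1 := by
      simp only [φ, MonoidHom.comp_apply, h1, map_one]
    rw [this]; rfl
  · obtain ⟨v, hv⟩ := hφs (Multiplicative.ofAdd 1)
    refine ⟨v, v.2, ?_⟩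
    have : (v : G) ∈ V := v.2
    simp only [this, dif_pos]
    have e : (⟨(v : G), this⟩ : V) = v := rfl
    rw [e, hv]
    simp
end fin
end LZO

set_option linter.unusedSectionVars false
set_option linter.unusedSimpArgs false
namespace LZO

structure Sys (p : ℕ) [Fact p.Prime] (G : Type) [Group G] where
  ι : Type
  κ : Type
  fι : Fintype ι
  fκ : Fintype κ
  y : ι → G
  w : ι → ℝ
  r : κ → G
  q : κ → ℝ
  hw : ∀ i, 0 < w i
  hw1 : ∀ i, w i < 1
  hq : ∀ i, 0 < q i
  hq1 : ∀ i, q i < 1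
  fr : Fr p y
  hr : ∀ k, r k ∈ Vf p y w (q k)

attribute [instance] Sys.fι Sys.fκ

section
variable {p : ℕ} [Fact p.Prime] {G : Type} [Group G]

namespace Sys
def V (S : Sys p G) : Subgroup G := cl S.y
def D (S : Sys p G) (u : ℝ) : Subgroup G := Vf p S.y S.w u
noncomputable def e (S : Sys p G) : ℝ := ∑ i, S.w i - ∑ k, S.q k - 1
def cset (S : Sys p G) : Set G := {g | ∃ v ∈ S.V, ∃ k, g = v * S.r k * v⁻¹}
def Gen (S : Sys p G) (N : Subgroup G) : Prop := (∀ k, S.r k ∈ N) ∧ N ≤ Subgroup.closure S.cset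
end Sys

lemma layer {ι κ : Type} [Fintype ι] [Fintype κ] (w : ι → ℝ) (q : κ → ℝ) (hq : ∀ k, 0 < q k)
    (h : ∑ k, q k < ∑ i, w i) :
    ∃ t, (Finset.univ.filter fun k => t ≤ q k).card < (Finset.univ.filter fun i => t ≤ w i).card := by
  classical
  by_contra hcon
  push Not at hcon
  obtain ⟨f, hf, hf2⟩ := (Finset.all_card_le_biUnion_card_iff_exists_injective
    (fun i => Finset.univ.filter fun k => w i ≤ q k)).1 (by
      intro s
      rcases s.eq_empty_or_nonempty with rfl | hs
      · simp
      · obtain ⟨i0, hi0, hmin⟩ := Finset.exists_min_image s w hs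
        calc s.card ≤ (Finset.univ.filter fun i => w i0 ≤ w i).card := by
              apply Finset.card_le_card
              intro i hi; simpa using hmin i hi
          _ ≤ _ := hcon (w i0)
          _ ≤ _ := by
              apply Finset.card_le_card
              intro k hk
              rw [Finset.mem_biUnion]
              exact ⟨i0, hi0, hk⟩)
  have h1 : ∑ i, w i ≤ ∑ i, q (f i) := Finset.sum_le_sum fun i _ => by simpa using hf2 i
  have h2 : ∑ i, q (f i) ≤ ∑ k, q k := by
    rw [← Finset.sum_image (f := q) (s := Finset.univ) (g := f) (fun a _ b _ hab => hf hab)]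
    exact Finset.sum_le_sum_of_subset_of_nonneg (Finset.subset_univ _) fun k _ _ => (hq k).le
  linarith

noncomputable def geo (p : ℕ) (s : ℝ) : ℝ := ∑ j ∈ Finset.range p, s ^ j

lemma exists_c {ι κ : Type} [Fintype ι] [Fintype κ] [DecidableEq ι] {y : ι → G} {w : ι → ℝ} {r : κ → G} {q : κ → ℝ}
    (hw : ∀ i, 0 < w i) (hq : ∀ k, 0 < q k) (hq1 : ∀ k, q k < 1)
    (hr : ∀ k, r k ∈ Vf p y w (q k)) (h : ∑ k, q k < ∑ i, w i)
    (ξ : ι → G → ZMod p) (hξ : ∀ i, IsChar (cl y) (ξ i)) (hξ2 : ∀ i j, ξ i (y j) = if j = i then 1 else 0) :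
    ∃ c : ι → ZMod p, c ≠ 0 ∧ ∀ k, ∑ i, c i * ξ i (r k) = 0 := by
  obtain ⟨t, ht⟩ := layer w q hq h
  let L : ({i // t ≤ w i} → ZMod p) →ₗ[ZMod p] ({k // t ≤ q k} → ZMod p) :=
    { toFun := fun c k => ∑ i, c i * ξ i.1 (r k)
      map_add' := by intro a b; ext k; simp [add_mul, Finset.sum_add_distrib]
      map_smul' := by intro a b; ext k; simp [Finset.mul_sum, mul_assoc] }
  have hk := LinearMap.ker_ne_bot_of_finrank_lt (f := L) (by
    simpa [Fintype.card_subtype] using ht)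
  obtain ⟨c, hc, hc0⟩ := (Submodule.ne_bot_iff _).1 hk
  have hsum : ∀ g, ∑ i, (if h : t ≤ w i then c ⟨i, h⟩ else 0) * ξ i g = ∑ i, c i * ξ i.1 g := by
    intro g
    have h1 := Fintype.sum_subtype_add_sum_subtype (fun i => t ≤ w i)
      (fun i => (if h : t ≤ w i then c ⟨i, h⟩ else 0) * ξ i g)
    rw [← h1, Finset.sum_eq_zero (s := (Finset.univ : Finset {i // ¬ t ≤ w i})), add_zero]
    · refine Finset.sum_congr rfl fun i _ => ?_
      rw [dif_pos i.2]
    · intro i _; rw [dif_neg i.2, zero_mul]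
  refine ⟨fun i => if h : t ≤ w i then c ⟨i, h⟩ else 0, ?_, ?_⟩
  · intro h0
    apply hc0
    ext i
    have := congrFun h0 i.1
    simpa [i.2] using this
  · intro k
    by_cases hk : t ≤ q k
    · rw [hsum]
      exact congrFun (LinearMap.mem_ker.1 hc) ⟨k, hk⟩
    · refine detect (χ := fun g => ∑ i, (if h : t ≤ w i then c ⟨i, h⟩ else 0) * ξ i g) hw ?_ (hq1 k) (hr k) ?_
      · intro a ha b hb
        simp only [hξ _ a ha b hb, mul_add, Finset.sum_add_distrib]
      · intro i hi
        simp only [hξ2, mul_ite, mul_one, mul_zero, Finset.sum_ite_eq, Finset.mem_univ, if_true]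
        rw [dif_neg]; linarith

lemma sum_nw {ι : Type} [Fintype ι] [DecidableEq ι] (w : ι → ℝ) (i0 : ι) :
    ∑ o, nw p w i0 o - 1 = geo p (w i0) * (∑ i, w i - 1) := by
  rw [Fintype.sum_option, Fintype.sum_prod_type]
  simp only [nw]
  have h1 : ∀ i, ∑ j : Fin p, w i * w i0 ^ (j : ℕ) = w i * geo p (w i0) := by
    intro i; rw [← Finset.mul_sum, geo, Finset.sum_range]
  simp only [h1]
  rw [← Finset.sum_mul, Fintype.sum_eq_add_sum_subtype_ne w i0]
  have h2 : geo p (w i0) * (w i0 - 1) = w i0 ^ p - 1 := geom_sum_mul _ _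
  linear_combination (-1) * h2

theorem step (S : Sys p G) (N : Subgroup G) (hNn : N.Normal) (hN : S.Gen N) (he : 0 < S.e) :
    ∃ (S' : Sys p G) (s : ℝ) (χ : G → ZMod p), 0 < s ∧ s < 1 ∧ IsChar S.V χ ∧
      (∀ v, v ∈ S'.V ↔ v ∈ S.V ∧ χ v = 0) ∧ (∃ v ∈ S.V, v ∉ S'.V) ∧ S'.Gen N ∧
      S'.e = geo p s * S.e ∧ (∀ u, S'.D u = S.D u ⊓ S'.V) ∧ (∀ u < s, S.D u ≤ S'.V) ∧
      S.V ≤ S.D s ⊔ N := by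
  classical
  obtain ⟨ι, κ, fι, fκ, y, w, r, q, hw, hw1, hq, hq1, fr, hr⟩ := S
  have hsum : ∑ k, q k < ∑ i, w i := by
    have : 0 < ∑ i, w i - ∑ k, q k - 1 := he
    linarith
  have hex : ∀ i, ∃ χ : G → ZMod p, IsChar (cl y) χ ∧ ∀ j, χ (y j) = if j = i then 1 else 0 := fun i =>
    exists_char fr _
  choose ξ hξ hξ2 using hex
  obtain ⟨c0, hc0, hc0r⟩ := exists_c hw hq hq1 hr hsum ξ hξ hξ2
  have hχ : ∀ c : ι → ZMod p, IsChar (cl y) (fun g => ∑ i, c i * ξ i g) := by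
    intro c a ha b hb
    simp only [hξ _ a ha b hb, mul_add, Finset.sum_add_distrib]
  have hχy : ∀ (c : ι → ZMod p) j, ∑ i, c i * ξ i (y j) = c j := by
    intro c j
    simp only [hξ2, mul_ite, mul_one, mul_zero, Finset.sum_ite_eq, Finset.mem_univ, if_true]
  let P : Set ((ι → ZMod p) × ι) := {x | (∀ k, ∑ i, x.1 i * ξ i (r k) = 0) ∧ x.1 x.2 = 1 ∧
    ∀ i, x.1 i ≠ 0 → w x.2 ≤ w i}
  have mkP : ∀ c : ι → ZMod p, c ≠ 0 → (∀ k, ∑ i, c i * ξ i (r k) = 0) →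
      ∃ x ∈ P, c x.2 ≠ 0 := by
    intro c hc hcr
    obtain ⟨i1, hi1⟩ := Function.ne_iff.1 hc
    obtain ⟨i0, hi0, hmin⟩ := Finset.exists_min_image (Finset.univ.filter fun i => c i ≠ 0) w
      ⟨i1, by simpa using hi1⟩
    rw [Finset.mem_filter] at hi0
    refine ⟨(fun i => (c i0)⁻¹ * c i, i0), ⟨?_, ?_, ?_⟩, hi0.2⟩
    · intro k
      simp only [mul_assoc, ← Finset.mul_sum, hcr k, mul_zero]
    · exact inv_mul_cancel₀ hi0.2
    · intro i hi
      refine hmin i ?_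
      simp only [Finset.mem_filter, Finset.mem_univ, true_and]
      intro h; apply hi; simp [h]
  obtain ⟨x0, hx0, _⟩ := mkP c0 hc0 hc0r
  obtain ⟨⟨c, i0⟩, hcP, hmax⟩ := Set.exists_max_image P (fun x => w x.2) (Set.toFinite _) ⟨x0, hx0⟩
  obtain ⟨hcr, hci, hcw⟩ := hcP
  simp only at hcr hci hcw hmax
  set χ : G → ZMod p := fun g => ∑ i, c i * ξ i g with hχd
  have hχc : IsChar (cl y) χ := hχ c
  have hχc_y : ∀ j, χ (y j) = c j := hχy c
  set k : ι → ℕ := fun i => if i = i0 then 0 else (c i).val with hk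
  have hk0 : k i0 = 0 := by simp [hk]
  have hkw : ∀ i, k i ≠ 0 → w i0 ≤ w i := by
    intro i hi
    apply hcw
    intro h
    apply hi
    simp [hk, h]
  set x := nx y i0 k with hx
  have hclx : cl x = cl y := cl_nx y i0 k hk0
  have hxc : IsChar (cl x) χ := by rw [hclx]; exact hχc
  have hx1 : χ (x i0) = 1 := by rw [hx, nx_i0 y i0 k hk0, hχc_y, hci]
  have hx2 : ∀ i, i ≠ i0 → χ (x i) = 0 := by
    intro i hi
    have h1 := nx_eq y i0 k i
    have hxm : x i ∈ cl y := by rw [← hclx]; exact y_mem i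
    have h2 : χ (y i) = χ (x i) + χ (y i0 ^ k i) := by
      conv_lhs => rw [h1]
      exact hχc _ hxm _ (pow_mem (y_mem i0) _)
    rw [hχc.pow (y_mem i0), hχc_y, hχc_y, hci] at h2
    simp [hk, hi] at h2
    exact h2
  have hker := G1 x i0 hxc hx1 hx2
  have hnm := not_mem_ny x i0 hxc hx1 hx2
  have hs0 := hw i0
  have hs1 := hw1 i0
  have hxVf : ∀ u, Vf p x w u = Vf p y w u := Vf_nx y i0 k w hkw hk0
  have hD : ∀ u, Vf p (ny p x i0) (nw p w i0) u = Vf p y w u ⊓ cl (ny p x i0) := by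
    intro u
    rw [← hxVf]
    apply le_antisymm
    · exact le_inf (fun v hv => unrestrict hv) (Vf_le _)
    · rintro v ⟨h1, h2⟩
      exact restrict hw hw1 hnm h1 (sub_mem (dl_mem h2) (one_mem _))
  have hrV : ∀ l, r l ∈ cl x := fun l => by rw [hclx]; exact Vf_le _ (hr l)
  have hx0V : x i0 ∈ cl x := y_mem i0
  have hcmV : ∀ l j, cm (x i0) j (r l) ∈ cl (ny p x i0) := by
    intro l j
    rw [hker, mem_kerc]
    exact ⟨cm_in hx0V (hrV l) j, char_cm hxc hx0V (hrV l) (hcr l) j⟩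
  have hx0s : x i0 ∈ Vf p y w (w i0) := by rw [← hxVf]; exact JM.gen i0
  let S' : Sys p G :=
    { ι := Option ({i // i ≠ i0} × Fin p)
      κ := κ × Fin p
      fι := inferInstance
      fκ := inferInstance
      y := ny p x i0
      w := nw p w i0
      r := fun lj => cm (x i0) lj.2 (r lj.1)
      q := fun lj => q lj.1 * w i0 ^ (lj.2 : ℕ)
      hw := nw_pos w i0 hw
      hw1 := nw_lt w i0 hw hw1
      hq := fun lj => by have := hq lj.1; positivity
      hq1 := fun lj => by
        have h1 := hq1 lj.1
        have h2 := hq lj.1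
        have h3 : w i0 ^ (lj.2 : ℕ) ≤ 1 := pow_le_one₀ hs0.le hs1.le
        have : 0 < w i0 ^ (lj.2 : ℕ) := by positivity
        nlinarith
      fr := Fr_ny x i0 (Fr_nx y i0 k hk0 fr) hnm
      hr := fun lj => by
        rw [hD]
        exact ⟨cm_Vf hx0s (hr lj.1) lj.2, hcmV _ _⟩ }
  have hV' : ∀ v, v ∈ S'.V ↔ v ∈ cl y ∧ χ v = 0 := by
    intro v
    show v ∈ cl (ny p x i0) ↔ _
    rw [hker, mem_kerc, hclx]
  refine ⟨S', w i0, χ, hs0, hs1, hχc, hV', ⟨y i0, y_mem i0, ?_⟩, ⟨?_, ?_⟩, ?_, hD, ?_, ?_⟩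
  · rw [hV', hχc_y, hci]; simp
  · rintro ⟨l, j⟩
    have : ∀ j : ℕ, cm (x i0) j (r l) ∈ N := by
      intro j
      induction j with
      | zero => exact hN.1 l
      | succ j ih => exact mul_mem (hNn.conj_mem _ ih _) (inv_mem ih)
    exact this j
  · refine hN.2.trans ?_
    rw [Subgroup.closure_le]
    rintro _ ⟨v, hv, l, rfl⟩
    have hv2 : v ∈ cl x := by rw [hclx]; exact hv
    obtain ⟨a, ha, m, hm, rfl⟩ := G2 (p := p) x i0 hv2
    have hj : ∀ j < p, cm (x i0) j (r l) ∈ Subgroup.closure S'.cset := by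
      intro j hj
      refine Subgroup.subset_closure ⟨1, one_mem _, (l, ⟨j, hj⟩), ?_⟩
      simp [S']
    have h1 := sig_cm_mem hj m 0 (by omega)
    have hconj : ∀ g ∈ Subgroup.closure S'.cset, a * g * a⁻¹ ∈ Subgroup.closure S'.cset := by
      intro g hg
      induction hg using Subgroup.closure_induction with
      | mem g hg =>
        obtain ⟨v, hv, k, rfl⟩ := hg
        refine Subgroup.subset_closure ⟨a * v, mul_mem ha hv, k, ?_⟩
        group
      | one => simp
      | mul g h _ _ h1 h2 =>
        have := mul_mem h1 h2
        convert this using 1; group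
      | inv g _ h1 =>
        have := inv_mem h1
        convert this using 1; group
    have h2 := hconj _ h1
    show a * x i0 ^ m * r l * (a * x i0 ^ m)⁻¹ ∈ Subgroup.closure S'.cset
    convert h2 using 1
    simp [cm]; group
  · have h1 := sum_nw (p := p) w i0
    have h2 : ∑ lj : κ × Fin p, q lj.1 * w i0 ^ (lj.2 : ℕ) = geo p (w i0) * ∑ l, q l := by
      rw [Fintype.sum_prod_type, geo, Finset.sum_range, mul_comm, Finset.sum_mul]
      refine Finset.sum_congr rfl fun l _ => ?_
      rw [Finset.mul_sum]
    show ∑ o, nw p w i0 o - ∑ lj : κ × Fin p, q lj.1 * w i0 ^ (lj.2 : ℕ) - 1 =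
      geo p (w i0) * (∑ i, w i - ∑ l, q l - 1)
    rw [h2]; linear_combination h1
  · intro u hu v hv
    rw [hV']
    refine ⟨Vf_le _ hv, detect hw hχc (by linarith) hv ?_⟩
    intro i hi
    rw [hχc_y]
    by_contra hne
    have := hcw i hne
    linarith
  · show cl y ≤ Vf p y w (w i0) ⊔ N
    by_contra hcon
    have hNV : N ≤ cl y := by
      refine hN.2.trans ?_
      rw [Subgroup.closure_le]
      rintro _ ⟨v, hv, l, rfl⟩
      exact mul_mem (mul_mem hv (Vf_le _ (hr l))) (inv_mem hv)
    obtain ⟨μ, hμ0, hμ1, hμ⟩ := exists_mu w hw1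
    obtain ⟨ψ, hψ, hψ0, v, hv, hψv⟩ := exists_char_kill (p := p) (V := cl y) (D := Vf p y w (w i0) ⊔ N)
      (sup_le (Vf_le _) hNV) (by
        intro v hv d hd
        obtain ⟨a, ha, n, hn, rfl⟩ := Subgroup.mem_sup_of_normal_right.1 hd
        have e : v * (a * n) * v⁻¹ = (v * a * v⁻¹) * (v * n * v⁻¹) := by group
        rw [e]
        exact mul_mem (Subgroup.mem_sup_left (Vf_conj hv ha)) (Subgroup.mem_sup_right (hNn.conj_mem _ hn _))) (by
        intro h0
        exact Vf_relIndex (p := p) (y := y) hw1 hs0 (Subgroup.relIndex_eq_zero_of_le_left le_sup_left h0)) (by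
        intro v hv
        rw [← Vf_mu (p := p) (y := y) hμ] at hv
        obtain ⟨n, hn⟩ := exists_pow_lt_of_lt_one hs0 hμ1
        refine ⟨n, Subgroup.mem_sup_left (Vf_mono ?_ (Vf_pow hv n))⟩
        refine le_trans ?_ hn.le
        exact pow_le_pow_of_le_one hμ0.le hμ1.le (Nat.lt_pow_self (Fact.out : p.Prime).one_lt).le) (by
        intro h; exact hcon h.ge)
    have hψeq : ∀ g ∈ cl y, ψ g = ∑ i, ψ (y i) * ξ i g := by
      intro g hg
      induction hg using Subgroup.closure_induction with
      | mem g hg =>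
        obtain ⟨j, rfl⟩ := hg
        rw [hχy (fun i => ψ (y i))]
      | one => 
        have := (hχ (fun i => ψ (y i))).one
        rw [hψ.one, this]
      | mul a b ha hb h1 h2 => 
        have := hχ (fun i => ψ (y i)) a ha b hb
        simp only at this
        rw [hψ a ha b hb, this, h1, h2]
      | inv a ha h1 => 
        have := (hχ (fun i => ψ (y i))).inv ha
        rw [hψ.inv ha, this, h1]
    obtain ⟨⟨c', i1⟩, hP', hne⟩ := mkP (fun i => ψ (y i)) (by
      intro h0
      apply hψv
      rw [hψeq v hv]
      refine Finset.sum_eq_zero fun i _ => ?_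
      have := congrFun h0 i
      simp only [Pi.zero_apply] at this
      rw [this, zero_mul]) (by
      intro l
      rw [← hψeq _ (Vf_le _ (hr l))]
      exact hψ0 _ (Subgroup.mem_sup_right (hN.1 l)))
    have h1 := hmax _ hP'
    simp only at h1 hne
    apply hne
    exact hψ0 _ (Subgroup.mem_sup_left (Vf_mono h1 (JM.gen i1)))
end
end LZO

set_option linter.unusedSectionVars false
set_option linter.unusedSimpArgs false
namespace LZO
variable {p : ℕ} [Fact p.Prime] {G : Type} [Group G]

structure St (p : ℕ) [Fact p.Prime] (G : Type) [Group G] where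
  S : Sys p G
  N : Subgroup G
  hNn : N.Normal
  gen : S.Gen N
  Vn : S.V.Normal
  Vi : S.V.index ≠ 0
  tor : ∀ g : G, ∃ a : ℕ, g ^ p ^ a ∈ S.V
  inv : ∀ f u v, v ∈ S.D u → f * v * f⁻¹ ∈ S.D u
  e_pos : 0 < S.e

structure StepRel (N : Subgroup G) (S S' : Sys p G) (s : ℝ) (χ : G → ZMod p) : Prop where
  s_pos : 0 < s
  s_lt : s < 1
  char : IsChar S.V χ
  memV : ∀ v, v ∈ S'.V ↔ v ∈ S.V ∧ χ v = 0
  strict : ∃ v ∈ S.V, v ∉ S'.V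
  gen : S'.Gen N
  e_eq : S'.e = geo p s * S.e
  D_eq : ∀ u, S'.D u = S.D u ⊓ S'.V
  c2 : ∀ u < s, S.D u ≤ S'.V
  c3 : S.V ≤ S.D s ⊔ N

lemma geo_ge {s : ℝ} (hs : 0 ≤ s) : 1 + s ≤ geo p s := by
  have hp2 : 2 ≤ p := (Fact.out : p.Prime).two_le
  have : ∑ j ∈ Finset.range 2, s ^ j ≤ geo p s := by
    refine Finset.sum_le_sum_of_subset_of_nonneg (by simpa using hp2) fun j _ _ => by positivity
  simpa [Finset.sum_range_succ] using this

structure Chain (X : St p G) where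
  C : ℕ → Sys p G
  s : ℕ → ℝ
  χ : ℕ → G → ZMod p
  h0 : C 0 = X.S
  rel : ∀ i, StepRel X.N (C i) (C (i + 1)) (s i) (χ i)

lemma exists_chain (X : St p G) : Nonempty (Chain X) := by
  let T := {S : Sys p G // S.Gen X.N ∧ 0 < S.e}
  have hstep : ∀ t : T, ∃ t' : T, ∃ s χ, StepRel X.N t.1 t'.1 s χ := by
    intro t
    obtain ⟨S', s, χ, h1, h2, h3, h4, h5, h6, h7, h8, h9, h10⟩ := step t.1 X.N X.hNn t.2.1 t.2.2
    refine ⟨⟨S', h6, ?_⟩, s, χ, ⟨h1, h2, h3, h4, h5, h6, h7, h8, h9, h10⟩⟩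
    rw [h7]
    have := geo_ge (p := p) h1.le
    exact mul_pos (by linarith) t.2.2
  choose nxt s χ hrel using hstep
  let seq : ℕ → T := fun n => Nat.rec ⟨X.S, X.gen, X.e_pos⟩ (fun _ t => nxt t) n
  exact ⟨⟨fun n => (seq n).1, fun n => s (seq n), fun n => χ (seq n), rfl, fun i => hrel (seq i)⟩⟩

namespace Sys
variable (S : Sys p G)
lemma D_le (u : ℝ) : S.D u ≤ S.V := Vf_le _
lemma D_mono {u t : ℝ} (h : u ≤ t) : S.D u ≤ S.D t := Vf_mono h
lemma D_one : S.D 1 = S.V := Vf_top le_rfl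
lemma Gen.le {N : Subgroup G} (h : S.Gen N) : N ≤ S.V := by
  refine h.2.trans ?_
  rw [Subgroup.closure_le]
  rintro _ ⟨v, hv, l, rfl⟩
  exact mul_mem (mul_mem hv (Vf_le _ (S.hr l))) (inv_mem hv)
lemma D_relIndex {u : ℝ} (hu : 0 < u) : (S.D u).relIndex S.V ≠ 0 := Vf_relIndex S.hw1 hu
lemma V_fg : S.V.FG := cl_fg _
end Sys

namespace Chain
variable {X : St p G} (Ch : Chain X)

def V (i : ℕ) : Subgroup G := (Ch.C i).V

lemma V_zero : Ch.V 0 = X.S.V := by rw [V, Ch.h0]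
lemma N_le (i : ℕ) : X.N ≤ Ch.V i := by
  cases i with
  | zero => rw [V_zero]; exact Sys.Gen.le _ X.gen
  | succ i => exact Sys.Gen.le _ (Ch.rel i).gen
lemma gen (i : ℕ) : (Ch.C i).Gen X.N := by
  cases i with
  | zero => rw [Ch.h0]; exact X.gen
  | succ i => exact (Ch.rel i).gen
lemma V_succ (i : ℕ) : Ch.V (i + 1) ≤ Ch.V i := fun v hv => (((Ch.rel i).memV v).1 hv).1
lemma V_anti : Antitone Ch.V := antitone_nat_of_succ_le Ch.V_succ
lemma strict (i : ℕ) : ∃ v ∈ Ch.V i, v ∉ Ch.V (i + 1) := (Ch.rel i).strict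
lemma D_eq (i : ℕ) (u : ℝ) : (Ch.C i).D u = X.S.D u ⊓ Ch.V i := by
  induction i with
  | zero => rw [V_zero, Ch.h0, inf_eq_left.2 (Sys.D_le _ _)]
  | succ i ih =>
    rw [(Ch.rel i).D_eq, ih, inf_assoc]
    congr 1
    exact inf_eq_right.2 (Ch.V_succ i)
lemma c2 (i : ℕ) {u : ℝ} (hu : u < Ch.s i) : X.S.D u ⊓ Ch.V i ≤ Ch.V (i + 1) := by
  rw [← D_eq]; exact (Ch.rel i).c2 u hu
lemma c3 (i : ℕ) {v : G} (hv : v ∈ Ch.V i) :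
    ∃ d ∈ X.S.D (Ch.s i), d ∈ Ch.V i ∧ ∃ n ∈ X.N, v = d * n := by
  have := X.hNn
  have h := (Ch.rel i).c3 hv
  rw [D_eq] at h
  obtain ⟨d, hd, n, hn, rfl⟩ := Subgroup.mem_sup_of_normal_right.1 h
  exact ⟨d, hd.1, hd.2, n, hn, rfl⟩
lemma s_pos (i : ℕ) : 0 < Ch.s i := (Ch.rel i).s_pos
lemma s_lt (i : ℕ) : Ch.s i < 1 := (Ch.rel i).s_lt
lemma pow_mem (i : ℕ) {v : G} (hv : v ∈ Ch.V i) : v ^ p ∈ Ch.V (i + 1) := by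
  refine ((Ch.rel i).memV _).2 ⟨_root_.pow_mem hv _, ?_⟩
  rw [(Ch.rel i).char.pow hv]; simp
/-- index p in explicit form -/
lemma cyc (i : ℕ) {x v : G} (hx : x ∈ Ch.V i) (hx' : x ∉ Ch.V (i + 1)) (hv : v ∈ Ch.V i) :
    ∃ l : ℕ, (x ^ l)⁻¹ * v ∈ Ch.V (i + 1) := by
  have hne : Ch.χ i x ≠ 0 := fun h => hx' (((Ch.rel i).memV _).2 ⟨hx, h⟩)
  refine ⟨(Ch.χ i v * (Ch.χ i x)⁻¹).val, ((Ch.rel i).memV _).2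
    ⟨mul_mem (inv_mem (_root_.pow_mem hx _)) hv, ?_⟩⟩
  rw [(Ch.rel i).char _ (inv_mem (_root_.pow_mem hx _)) _ hv, (Ch.rel i).char.inv (_root_.pow_mem hx _),
    (Ch.rel i).char.pow hx]
  simp [mul_assoc, hne]

lemma s_succ (i : ℕ) : Ch.s (i + 1) ≤ Ch.s i := by
  by_contra h
  push Not at h
  obtain ⟨v, hv, hv'⟩ := Ch.strict (i + 1)
  obtain ⟨d, hd, hdV, n, hn, rfl⟩ := Ch.c3 i (Ch.V_succ i hv)
  have hd1 : d ∈ Ch.V (i + 1) := by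
    have := mul_mem hv (inv_mem (Ch.N_le (i + 1) hn))
    simpa using this
  exact hv' (mul_mem (Ch.c2 (i + 1) h ⟨hd, hd1⟩) (Ch.N_le _ hn))
lemma s_anti : Antitone Ch.s := antitone_nat_of_succ_le Ch.s_succ

lemma relIndex_ne (i : ℕ) : (Ch.V i).relIndex (Ch.V 0) ≠ 0 := by
  induction i with
  | zero => simp
  | succ i ih =>
    refine Subgroup.relIndex_ne_zero_trans ?_ ih
    obtain ⟨x, hx, hx'⟩ := Ch.strict i
    rw [Subgroup.relIndex, Subgroup.index_ne_zero_iff_finite]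
    have : ∀ v : Ch.V i, ∃ l : ℕ, (x ^ l)⁻¹ * v ∈ Ch.V (i + 1) := fun v => Ch.cyc i hx hx' v.2
    refine Finite.of_surjective
      (fun l : Fin p => (QuotientGroup.mk (⟨x, hx⟩ ^ (l : ℕ)) : Ch.V i ⧸ (Ch.V (i + 1)).subgroupOf (Ch.V i))) ?_
    intro a
    induction a using QuotientGroup.induction_on with | _ a => ?_
    obtain ⟨l, hl⟩ := this a
    refine ⟨⟨l % p, Nat.mod_lt _ p_pos⟩, ?_⟩
    rw [QuotientGroup.eq, Subgroup.mem_subgroupOf]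
    simp only [Subgroup.coe_mul, Subgroup.coe_inv, Subgroup.coe_pow]
    have e : (x ^ (l % p))⁻¹ * (a : G) = ((x ^ p) ^ (l / p)) * ((x ^ l)⁻¹ * a) := by
      conv_rhs => rw [← Nat.mod_add_div l p, pow_add, pow_mul, Nat.mod_add_div l p]
      group
    rw [e]
    exact mul_mem (_root_.pow_mem (Ch.pow_mem i hx) _) hl

lemma index_ne (i : ℕ) : (Ch.V i).index ≠ 0 := by
  have h1 := Ch.relIndex_ne i
  have h2 : (Ch.V 0).index ≠ 0 := by rw [V_zero]; exact X.Vi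
  rw [← Subgroup.relIndex_mul_index (Ch.V_anti (Nat.zero_le i))]
  exact mul_ne_zero h1 h2

lemma s_small {u : ℝ} (hu : 0 < u) : ∃ k, ∀ i, k ≤ i → Ch.s i < u := by
  suffices h : ∃ k, Ch.s k < u by
    obtain ⟨k, hk⟩ := h
    exact ⟨k, fun i hi => (Ch.s_anti hi).trans_lt hk⟩
  by_contra hcon
  push Not at hcon
  have h1 : ∀ i, X.S.D (u / 2) ≤ Ch.V i := by
    intro i
    induction i with
    | zero => rw [V_zero]; exact Sys.D_le _ _
    | succ i ih => exact fun v hv => Ch.c2 i (lt_of_lt_of_le (by linarith) (hcon i)) ⟨hv, ih hv⟩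
  have h2 : ∀ i, i < (Ch.V i).relIndex (Ch.V 0) := by
    intro i
    induction i with
    | zero => simp
    | succ i ih =>
      have h3 := Subgroup.relIndex_mul_relIndex _ _ _ (Ch.V_succ i) (Ch.V_anti (Nat.zero_le i))
      have h4 : (Ch.V (i + 1)).relIndex (Ch.V i) ≠ 1 := by
        rw [Ne, Subgroup.relIndex_eq_one]
        obtain ⟨x, hx, hx'⟩ := Ch.strict i
        exact fun h => hx' (h hx)
      have h5 : (Ch.V (i + 1)).relIndex (Ch.V i) ≠ 0 := by
        intro h; rw [h, zero_mul] at h3; exact Ch.relIndex_ne (i + 1) h3.symm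
      have h6 : 2 ≤ (Ch.V (i + 1)).relIndex (Ch.V i) := by omega
      rw [← h3]; nlinarith
  have h7 : (X.S.D (u / 2)).relIndex (Ch.V 0) ≠ 0 := by
    rw [V_zero]; exact Sys.D_relIndex _ (by linarith)
  set n := (X.S.D (u / 2)).relIndex (Ch.V 0)
  have h8 : (Ch.V n).relIndex (Ch.V 0) ≤ n := Subgroup.relIndex_le_of_le_left (h1 n) h7
  have := h2 n
  omega

lemma D_le_of_lt (k : ℕ) {u : ℝ} (h : ∀ l < k, u < Ch.s l) : X.S.D u ≤ Ch.V k := by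
  induction k with
  | zero => rw [V_zero]; exact Sys.D_le _ _
  | succ k ih =>
    intro v hv
    exact Ch.c2 k (h k (by omega)) ⟨hv, ih (fun l hl => h l (by omega)) hv⟩

lemma exists_threshold (K : ℕ) : ∃ k, K < k ∧ ∀ l < k, Ch.s k < Ch.s l := by
  obtain ⟨m, hm⟩ := Ch.s_small (Ch.s_pos K)
  have hex : ∃ k, K < k ∧ Ch.s k < Ch.s K := ⟨max m (K + 1), by omega, hm _ (le_max_left _ _)⟩
  classical
  refine ⟨Nat.find hex, (Nat.find_spec hex).1, ?_⟩
  intro l hl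
  have h1 := (Nat.find_spec hex).2
  rcases le_or_gt l K with h | h
  · exact h1.trans_le (Ch.s_anti h)
  · have := Nat.find_min hex hl
    push Not at this
    exact h1.trans_le (this h)

lemma V_eq {k : ℕ} (hk : ∀ l < k, Ch.s k < Ch.s l) : Ch.V k = X.S.D (Ch.s k) ⊔ X.N := by
  apply le_antisymm
  · intro v hv
    obtain ⟨d, hd, _, n, hn, rfl⟩ := Ch.c3 k hv
    exact mul_mem (Subgroup.mem_sup_left hd) (Subgroup.mem_sup_right hn)
  · exact sup_le (Ch.D_le_of_lt k hk) (Ch.N_le k)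

lemma V_normal {k : ℕ} (hk : ∀ l < k, Ch.s k < Ch.s l) : (Ch.V k).Normal := by
  rw [Ch.V_eq hk]
  have h1 : (X.S.D (Ch.s k)).Normal := ⟨fun n hn g => X.inv g _ n hn⟩
  have := X.hNn
  infer_instance

lemma e_eq (k : ℕ) : (Ch.C k).e = X.S.e * ∏ l ∈ Finset.range k, geo p (Ch.s l) := by
  induction k with
  | zero => simp [Ch.h0]
  | succ k ih => rw [(Ch.rel k).e_eq, ih, Finset.prod_range_succ]; ring

lemma e_ge (k : ℕ) : 0 < (Ch.C k).e := by
  rw [e_eq]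
  refine mul_pos X.e_pos (Finset.prod_pos fun l _ => ?_)
  have := geo_ge (p := p) (Ch.s_pos l).le
  have := Ch.s_pos l
  linarith

lemma tor (k : ℕ) (g : G) : ∃ a : ℕ, g ^ p ^ a ∈ Ch.V k := by
  induction k with
  | zero => rw [V_zero]; exact X.tor g
  | succ k ih =>
    obtain ⟨a, ha⟩ := ih
    exact ⟨a + 1, by rw [pow_succ, pow_mul]; exact Ch.pow_mem k ha⟩

end Chain

theorem switch {X : St p G} (Ch : Chain X) {k : ℕ} (hk : ∀ l < k, Ch.s k < Ch.s l) {c : ℝ} (hc : 0 < c)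
    (hc1 : c ≤ 1) (hce : 1 < c * ((Ch.C k).e + 1)) :
    ∃ X' : St p G, X'.N = X.N ∧ X'.S.V = Ch.V k ∧ ∀ u < 1, X.S.D u ⊓ Ch.V k ≤ X'.S.D (c * u) := by
  have hsc : ∀ u < 1, X.S.D u ⊓ Ch.V k ≤ Vf p (Ch.C k).y (fun i => c * (Ch.C k).w i) (c * u) := by
    intro u hu v hv
    rw [← Ch.D_eq] at hv
    exact JM.scale (Ch.C k).hw hc hc1 hv hu
  let S' : Sys p G :=
    { Ch.C k with
      w := fun i => c * (Ch.C k).w i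
      q := fun i => c * (Ch.C k).q i
      hw := fun i => mul_pos hc ((Ch.C k).hw i)
      hw1 := fun i => by have := (Ch.C k).hw i; have := (Ch.C k).hw1 i; nlinarith
      hq := fun i => mul_pos hc ((Ch.C k).hq i)
      hq1 := fun i => by have := (Ch.C k).hq i; have := (Ch.C k).hq1 i; nlinarith
      fr := (Ch.C k).fr
      hr := fun j => JM.scale (Ch.C k).hw hc hc1 ((Ch.C k).hr j) ((Ch.C k).hq1 j) }
  have hVn := Ch.V_normal hk
  refine ⟨{ S := S', N := X.N, hNn := X.hNn, gen := Ch.gen k, Vn := hVn, Vi := Ch.index_ne k,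
            tor := Ch.tor k, inv := ?_, e_pos := ?_ }, rfl, rfl, hsc⟩
  · intro f u v hv
    have h1 : ∀ i, f * (Ch.C k).y i * f⁻¹ ∈ Ch.V k := fun i => hVn.conj_mem _ (y_mem i) _
    have h := JM.transfer (y' := (Ch.C k).y) (w' := S'.w) (cj f) (by
      intro i
      rw [cj_dl, cj_dl]
      refine ⟨dl_mem (h1 i), dl_mem ?_⟩
      have e : f * ((Ch.C k).y i)⁻¹ * f⁻¹ = (f * (Ch.C k).y i * f⁻¹)⁻¹ := by group
      show f * ((Ch.C k).y i)⁻¹ * f⁻¹ ∈ Ch.V k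
      rw [e]
      exact inv_mem (h1 i)) (by
      intro i
      rw [map_sub, map_one, cj_dl]
      refine hsc _ ((Ch.C k).hw1 i) ⟨X.inv _ _ _ ?_, h1 i⟩
      have : (Ch.C k).y i ∈ (Ch.C k).D ((Ch.C k).w i) := JM.gen i
      rw [Ch.D_eq] at this
      exact this.1) hv
    rw [map_sub, map_one, cj_dl] at h
    exact h
  · show 0 < ∑ i, c * (Ch.C k).w i - ∑ i, c * (Ch.C k).q i - 1
    rw [← Finset.mul_sum, ← Finset.mul_sum]
    rw [Sys.e] at hce
    linarith

theorem kill (X : St p G) {τ : Type} [Fintype τ] (t : τ → G) (q : τ → ℝ) (ht : ∀ j, t j ∈ X.S.D (q j))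
    (hq : ∀ j, 0 < q j) (hq1 : ∀ j, q j < 1) (he : X.S.V.index * ∑ j, q j < X.S.e) :
    ∃ X' : St p G, X'.S.V = X.S.V ∧ X'.S.D = X.S.D ∧ X.N ≤ X'.N ∧ (∀ j, t j ∈ X'.N) ∧
      X'.S.e = X.S.e - X.S.V.index * ∑ j, q j := by
  classical
  have hfi : X.S.V.FiniteIndex := ⟨X.Vi⟩
  let _ : Fintype (G ⧸ X.S.V) := Fintype.ofFinite _
  have hVn := X.Vn
  have hNn := X.hNn
  let S' : Sys p G :=
    { X.S with
      κ := X.S.κ ⊕ (τ × (G ⧸ X.S.V))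
      fκ := inferInstance
      r := Sum.elim X.S.r (fun a => a.2.out * t a.1 * (a.2.out)⁻¹)
      q := Sum.elim X.S.q (fun a => q a.1)
      hq := by rintro (a | a); exacts [X.S.hq a, hq _]
      hq1 := by rintro (a | a); exacts [X.S.hq1 a, hq1 _]
      hr := by rintro (a | a); exacts [X.S.hr a, X.inv _ _ _ (ht _)] }
  have hee : S'.e = X.S.e - X.S.V.index * ∑ j, q j := by
    show ∑ i, X.S.w i - ∑ a : X.S.κ ⊕ (τ × (G ⧸ X.S.V)), Sum.elim X.S.q (fun a => q a.1) a - 1 =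
      (∑ i, X.S.w i - ∑ k, X.S.q k - 1) - X.S.V.index * ∑ j, q j
    rw [Fintype.sum_sum_type, Fintype.sum_prod_type]
    simp only [Sum.elim_inl, Sum.elim_inr, Finset.sum_const, nsmul_eq_mul, Finset.card_univ]
    rw [← Finset.mul_sum, Subgroup.index_eq_card, Nat.card_eq_fintype_card]; ring
  have hsub : Subgroup.normalClosure (Set.range t) ≤ X.N ⊔ Subgroup.normalClosure (Set.range t) := le_sup_right
  refine ⟨{ S := S', N := X.N ⊔ Subgroup.normalClosure (Set.range t), hNn := inferInstance, gen := ⟨?_, ?_⟩,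
            Vn := X.Vn, Vi := X.Vi, tor := X.tor, inv := X.inv, e_pos := by rw [hee]; linarith },
            rfl, rfl, le_sup_left, ?_, hee⟩
  · have hnn : (X.N ⊔ Subgroup.normalClosure (Set.range t)).Normal := inferInstance
    rintro (a | a)
    · exact Subgroup.mem_sup_left (X.gen.1 a)
    · exact hnn.conj_mem _ (hsub (Subgroup.subset_normalClosure ⟨_, rfl⟩)) _
  · refine sup_le (X.gen.2.trans (Subgroup.closure_mono ?_)) ?_
    · rintro _ ⟨v, hv, k, rfl⟩
      exact ⟨v, hv, Sum.inl k, rfl⟩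
    · rw [Subgroup.normalClosure, Subgroup.closure_le]
      intro g hg
      obtain ⟨_, ⟨j, rfl⟩, hj⟩ := Group.mem_conjugatesOfSet_iff.1 hg
      obtain ⟨f, rfl⟩ := isConj_iff.1 hj
      refine Subgroup.subset_closure ⟨f * ((QuotientGroup.mk f : G ⧸ X.S.V).out)⁻¹, ?_,
        Sum.inr (j, QuotientGroup.mk f), ?_⟩
      · obtain ⟨h, hh⟩ := QuotientGroup.mk_out_eq_mul X.S.V f
        rw [hh]
        have e : f * (f * (h : G))⁻¹ = f * (h : G)⁻¹ * f⁻¹ := by group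
        show f * (f * (h : G))⁻¹ ∈ X.S.V
        rw [e]
        exact hVn.conj_mem _ (inv_mem h.2) f
      · show _ = _ * (_ * t j * _⁻¹) * _
        group
  · intro j
    exact hsub (Subgroup.subset_normalClosure ⟨_, rfl⟩)
end LZO

set_option linter.unusedSectionVars false
set_option linter.unusedSimpArgs false
namespace LZO
variable {p : ℕ} [Fact p.Prime] {G : Type} [Group G]

structure NSer (p : ℕ) (E : ℝ → Subgroup G) : Prop where
  comm : ∀ {u t a b}, a ∈ E u → b ∈ E t → a * b * a⁻¹ * b⁻¹ ∈ E (u * t)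
  pow : ∀ {u a}, a ∈ E u → a ^ p ∈ E (u ^ p)

namespace NSer
variable {E : ℝ → Subgroup G}
lemma cm_mem (hE : NSer p E) {s t : ℝ} {x g : G} (hx : x ∈ E s) (hg : g ∈ E t) (j : ℕ) : cm x j g ∈ E (t * s ^ j) := by
  induction j with
  | zero => simpa [cm] using hg
  | succ j ih =>
    have := hE.comm hx ih
    rw [show t * s ^ (j + 1) = s * (t * s ^ j) by ring]
    exact this

lemma ny_mem (hE : NSer p E) {ι : Type} {h : ι → G} {u : ι → ℝ} (hm : ∀ i, h i ∈ E (u i)) (i0 : ι) (o) :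
    ny p h i0 o ∈ E (nw p u i0 o) := by
  rcases o with _ | ⟨i, j⟩
  · exact hE.pow (hm i0)
  · exact hE.cm_mem (hm i0) (hm i) _
end NSer

lemma ny_relIndex {ι : Type} (x : ι → G) (i0 : ι) : (cl (ny p x i0)).relIndex (cl x) ≠ 0 := by
  rw [Subgroup.relIndex, Subgroup.index_ne_zero_iff_finite]
  refine Finite.of_surjective
      (fun l : Fin p => (QuotientGroup.mk ((⟨x i0, y_mem i0⟩ : cl x) ^ (l : ℕ))⁻¹ :
        cl x ⧸ (cl (ny p x i0)).subgroupOf (cl x))) ?_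
  intro a
  induction a using QuotientGroup.induction_on with | _ a => ?_
  obtain ⟨c, hc, k, hk, hh⟩ := G2 (p := p) x i0 (inv_mem a.2)
  refine ⟨⟨k, hk⟩, ?_⟩
  rw [QuotientGroup.eq, Subgroup.mem_subgroupOf]
  simp only [Subgroup.coe_mul, Subgroup.coe_inv, Subgroup.coe_pow, inv_inv]
  have e : x i0 ^ k * (a : G) = c⁻¹ := by
    have : x i0 ^ k = c⁻¹ * (a : G)⁻¹ := by rw [hh]; group
    rw [this]; group
  rw [e]
  exact inv_mem hc

lemma round_aux {E : ℝ → Subgroup G} (hE : NSer p E) (n : ℕ) : ∀ (ι : Type) [Fintype ι] (h : ι → G) (u : ι → ℝ)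
    (A : Finset ι), A.card = n → (∀ i, h i ∈ E (u i)) → (∀ i, 0 < u i) → (∀ i, u i < 1) → ∑ i, u i ≤ 1 →
    ∃ (ι' : Type) (_ : Fintype ι') (h' : ι' → G) (u' : ι' → ℝ), (∀ i, h' i ∈ E (u' i)) ∧ (∀ i, 0 < u' i) ∧
      (∀ i, u' i < 1) ∧ cl h' ≤ cl h ∧ (cl h').relIndex (cl h) ≠ 0 ∧
      (1 - ∑ i, u i) * ∏ i ∈ A, (1 + u i) ≤ 1 - ∑ i, u' i := by
  classical
  induction n with
  | zero =>
    intro ι _ h u A hA h1 h2 h3 h4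
    rw [Finset.card_eq_zero] at hA
    subst hA
    exact ⟨ι, inferInstance, h, u, h1, h2, h3, le_rfl, by simp, by simp⟩
  | succ n ih =>
    intro ι _ h u A hA h1 h2 h3 h4
    obtain ⟨i0, hi0⟩ : A.Nonempty := by rw [← Finset.card_pos]; omega
    let f : {i // i ≠ i0} → Option ({i // i ≠ i0} × Fin p) := fun i => some (i, ⟨0, p_pos⟩)
    have hf : Function.Injective f := by intro a b hab; simpa [f] using hab
    let B : Finset {i // i ≠ i0} := (A.erase i0).subtype (fun i => i ≠ i0)
    have hprod : ∏ i ∈ A.erase i0, (1 + u i) = ∏ i ∈ B, (1 + u i) := by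
      rw [Finset.prod_subtype_of_mem (fun i => 1 + u i)]
      intro x hx; exact (Finset.mem_erase.1 hx).1
    have hB : B.card = n := by
      rw [Finset.card_subtype, Finset.filter_true_of_mem (fun x hx => (Finset.mem_erase.1 hx).1),
        Finset.card_erase_of_mem hi0]; omega
    have hs := sum_nw (p := p) u i0
    have hg := geo_ge (p := p) (h2 i0).le
    have h0 := h2 i0
    have hle : ∑ o, nw p u i0 o ≤ 1 := by nlinarith
    obtain ⟨ι', f', h', u', k1, k2, k3, k4, k5, k6⟩ := ih _ (ny p h i0) (nw p u i0) (B.image f)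
      (by rw [Finset.card_image_of_injective _ hf, hB]) (hE.ny_mem h1 i0) (nw_pos u i0 h2) (nw_lt u i0 h2 h3) hle
    refine ⟨ι', f', h', u', k1, k2, k3, k4.trans (ny_le h i0), ?_, le_trans ?_ k6⟩
    · exact Subgroup.relIndex_ne_zero_trans k5 (ny_relIndex h i0)
    · rw [Finset.prod_image (fun a _ b _ hab => hf hab)]
      have : ∀ i, nw p u i0 (f i) = u i := by intro i; simp [f, nw]
      simp only [this]
      rw [← hprod, ← Finset.mul_prod_erase A _ hi0]
      have hP : 0 ≤ ∏ i ∈ A.erase i0, (1 + u i) :=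
        Finset.prod_nonneg fun i _ => by have := h2 i; linarith
      rw [← mul_assoc]
      refine mul_le_mul_of_nonneg_right ?_ hP
      nlinarith

lemma one_add_sum_le {ι : Type} (A : Finset ι) (u : ι → ℝ) (h : ∀ i, 0 ≤ u i) :
    1 + ∑ i ∈ A, u i ≤ ∏ i ∈ A, (1 + u i) := by
  classical
  induction A using Finset.induction_on with
  | empty => simp
  | insert a s ha ih =>
    rw [Finset.sum_insert ha, Finset.prod_insert ha]
    have := h a
    have h3 : 0 ≤ ∑ i ∈ s, u i := Finset.sum_nonneg fun i _ => h i
    nlinarith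

lemma round_iter {E : ℝ → Subgroup G} (hE : NSer p E) {ι : Type} [Fintype ι] (h : ι → G) (u : ι → ℝ)
    (h1 : ∀ i, h i ∈ E (u i)) (h2 : ∀ i, 0 < u i) (h3 : ∀ i, u i < 1) (h4 : ∑ i, u i < 1) (n : ℕ) :
    ∃ (ι' : Type) (_ : Fintype ι') (h' : ι' → G) (u' : ι' → ℝ), (∀ i, h' i ∈ E (u' i)) ∧ (∀ i, 0 < u' i) ∧
      (∀ i, u' i < 1) ∧ cl h' ≤ cl h ∧ (cl h').relIndex (cl h) ≠ 0 ∧ ∑ i, u' i ≤ (∑ i, u i) ^ 2 ^ n := by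
  have hS : 0 ≤ ∑ i, u i := Finset.sum_nonneg fun i _ => (h2 i).le
  induction n with
  | zero => exact ⟨ι, inferInstance, h, u, h1, h2, h3, le_rfl, by simp, by simp⟩
  | succ n ih =>
    obtain ⟨ι', f', h', u', k1, k2, k3, k4, k5, k6⟩ := ih
    have hlt : ∑ i, u' i ≤ 1 := k6.trans (pow_le_one₀ hS h4.le)
    obtain ⟨ι'', f'', h'', u'', l1, l2, l3, l4, l5, l6⟩ := round_aux hE _ ι' h' u' Finset.univ rfl k1 k2 k3 hlt
    refine ⟨ι'', f'', h'', u'', l1, l2, l3, l4.trans k4, Subgroup.relIndex_ne_zero_trans l5 k5, ?_⟩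
    have m1 := one_add_sum_le Finset.univ u' (fun i => (k2 i).le)
    have m2 : (1 - ∑ i, u' i) * (1 + ∑ i, u' i) ≤ 1 - ∑ i, u'' i :=
      le_trans (mul_le_mul_of_nonneg_left m1 (by linarith)) l6
    have hS' : 0 ≤ ∑ i, u' i := Finset.sum_nonneg fun i _ => (k2 i).le
    rw [pow_succ 2, pow_mul]
    nlinarith

lemma round {E : ℝ → Subgroup G} (hE : NSer p E) {ι : Type} [Fintype ι] (h : ι → G) (u : ι → ℝ)
    (h1 : ∀ i, h i ∈ E (u i)) (h2 : ∀ i, 0 < u i) (h4 : ∑ i, u i < 1) {ε : ℝ} (hε : 0 < ε) :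
    ∃ (ι' : Type) (_ : Fintype ι') (h' : ι' → G) (u' : ι' → ℝ), (∀ i, h' i ∈ E (u' i)) ∧ (∀ i, 0 < u' i) ∧
      (∀ i, u' i < 1) ∧ cl h' ≤ cl h ∧ (cl h').relIndex (cl h) ≠ 0 ∧ ∑ i, u' i < ε := by
  have hS : 0 ≤ ∑ i, u i := Finset.sum_nonneg fun i _ => (h2 i).le
  obtain ⟨n, hn⟩ := exists_pow_lt_of_lt_one hε h4
  have h3 : ∀ i, u i < 1 := fun i =>
    lt_of_le_of_lt (Finset.single_le_sum (fun j _ => (h2 j).le) (Finset.mem_univ i)) h4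
  obtain ⟨ι', f', h', u', k1, k2, k3, k4, k5, k6⟩ := round_iter hE h u h1 h2 h3 h4 n
  refine ⟨ι', f', h', u', k1, k2, k3, k4, k5, k6.trans_lt (lt_of_le_of_lt ?_ hn)⟩
  exact pow_le_pow_of_le_one hS h4.le (Nat.lt_two_pow_self).le

namespace St
variable (X : St p G)
def E (u : ℝ) : Subgroup G := X.S.D u ⊔ X.N

lemma mem_E {u : ℝ} {g : G} : g ∈ X.E u ↔ ∃ d ∈ X.S.D u, ∃ n ∈ X.N, g = d * n := by
  have := X.hNn
  rw [E, Subgroup.mem_sup_of_normal_right]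
  simp only [eq_comm]

lemma mem_E' {u : ℝ} {g : G} : g ∈ X.E u ↔ ∃ d ∈ X.S.D u, (QuotientGroup.mk g : G ⧸ X.N) = QuotientGroup.mk d := by
  rw [mem_E]
  constructor
  · rintro ⟨d, hd, n, hn, rfl⟩
    exact ⟨d, hd, by rw [eq_comm, QuotientGroup.eq]; simpa using hn⟩
  · rintro ⟨d, hd, h⟩
    rw [eq_comm, QuotientGroup.eq] at h
    exact ⟨d, hd, _, h, by group⟩

lemma E_ser : NSer p X.E := by
  have := X.hNn
  constructor
  · intro u t a b ha hb
    obtain ⟨d, hd, h1⟩ := X.mem_E'.1 ha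
    obtain ⟨d', hd', h2⟩ := X.mem_E'.1 hb
    refine X.mem_E'.2 ⟨_, Vf_comm hd hd', ?_⟩
    simp only [QuotientGroup.mk_mul, QuotientGroup.mk_inv, h1, h2]
  · intro u a ha
    obtain ⟨d, hd, h1⟩ := X.mem_E'.1 ha
    have h := Vf_pow hd 1
    rw [pow_one] at h
    refine X.mem_E'.2 ⟨_, h, ?_⟩
    simp only [QuotientGroup.mk_pow, h1]

lemma E_mono {u t : ℝ} (h : u ≤ t) : X.E u ≤ X.E t := sup_le_sup_right (X.S.D_mono h) _
lemma N_le_E (u : ℝ) : X.N ≤ X.E u := le_sup_right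
lemma N_le_V : X.N ≤ X.S.V := Sys.Gen.le _ X.gen
lemma E_one : X.E 1 = X.S.V := by rw [E, X.S.D_one]; exact sup_eq_left.2 X.N_le_V

def Ext (X X' : St p G) : Prop := X'.S.V ≤ X.S.V ∧ X.N ≤ X'.N
lemma Ext.trans {X Y Z : St p G} (h : Ext X Y) (h' : Ext Y Z) : Ext X Z := ⟨h'.1.trans h.1, h.2.trans h'.2⟩
lemma Ext.refl (X : St p G) : Ext X X := ⟨le_rfl, le_rfl⟩

theorem shrink (X : St p G) : ∃ X', Ext X X' ∧ ¬ X.S.V ≤ X'.S.V := by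
  obtain ⟨Ch⟩ := exists_chain X
  obtain ⟨k, hk0, hk⟩ := Ch.exists_threshold 0
  obtain ⟨X', h1, h2, -⟩ := switch Ch hk one_pos le_rfl (by have := Ch.e_ge k; linarith)
  refine ⟨X', ⟨?_, h1.ge⟩, ?_⟩
  · rw [h2, ← Ch.V_zero]; exact Ch.V_anti (Nat.zero_le _)
  · rw [h2, ← Ch.V_zero]
    intro h
    obtain ⟨v, hv, hv'⟩ := Ch.strict 0
    exact hv' (Ch.V_anti hk0 (h hv))

theorem torsion (X : St p G) (g : G) : ∃ X', Ext X X' ∧ ∃ a : ℕ, g ^ p ^ a ∈ X'.N := by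
  obtain ⟨a, ha⟩ := X.tor g
  obtain ⟨μ, hμ0, hμ1, hμ⟩ := exists_mu X.S.w X.S.hw1
  have hV : X.S.D μ = X.S.V := Vf_mu hμ
  rw [← hV] at ha
  have hi : (0 : ℝ) < X.S.V.index := by exact_mod_cast Nat.pos_of_ne_zero X.Vi
  obtain ⟨b, hb⟩ := exists_pow_lt_of_lt_one (div_pos X.e_pos hi) hμ1
  have hb' : μ ^ p ^ b < X.S.e / X.S.V.index := lt_of_le_of_lt
    (pow_le_pow_of_le_one hμ0.le hμ1.le (Nat.lt_pow_self (Fact.out : p.Prime).one_lt).le) hb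
  have hm := Vf_pow ha b
  obtain ⟨X', h1, h2, h3, h4, h5⟩ := kill X (τ := Unit) (fun _ => (g ^ p ^ a) ^ p ^ b) (fun _ => μ ^ p ^ b)
    (fun _ => hm) (fun _ => by positivity) (fun _ => pow_lt_one₀ hμ0.le hμ1 (pow_pos p_pos _).ne') (by
      rw [lt_div_iff₀ hi] at hb'
      simp
      linarith)
  refine ⟨X', ⟨h1.le, h3⟩, a + b, ?_⟩
  rw [pow_add, pow_mul]
  exact h4 ()
end St

end LZO

set_option linter.unusedSectionVars false
set_option linter.unusedSimpArgs false
namespace LZO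
variable {p : ℕ} [Fact p.Prime] {G : Type} [Group G] {X : St p G}

def Rk (Ch : Chain X) (H : Subgroup G) (i : ℕ) (ρ : ℝ) : Prop :=
  ∃ (ι : Type) (_ : Fintype ι) (h : ι → G) (u : ι → ℝ), (∀ j, h j ∈ X.E (u j)) ∧ (∀ j, 0 < u j) ∧
    (∀ j, u j ≤ 1) ∧ cl h = H ⊓ Ch.V i ∧ ∑ j, u j ≤ ρ

lemma relIndex_ne_of_index {A B : Subgroup G} (h : A.index ≠ 0) : A.relIndex B ≠ 0 := by
  have : A.FiniteIndex := ⟨h⟩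
  exact (Subgroup.isFiniteRelIndex_iff_relIndex_ne_zero).1 Subgroup.isFiniteRelIndex_of_finiteIndex

lemma Rk_zero (Ch : Chain X) {H : Subgroup G} (hH : H.FG) : ∃ m : ℝ, 0 < m ∧ Rk Ch H 0 (1 + m) := by
  have hi : (H ⊓ Ch.V 0).relIndex H ≠ 0 := by
    rw [Subgroup.inf_relIndex_left]
    exact relIndex_ne_of_index (Ch.index_ne 0)
  obtain ⟨S, hS⟩ := fg_of_relIndex inf_le_left hH hi
  refine ⟨S.card + 1, by positivity, S, inferInstance, fun s => s, fun _ => 1, ?_, fun _ => one_pos,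
    fun _ => le_rfl, ?_, ?_⟩
  · intro j
    rw [X.E_one, ← Ch.V_zero]
    have : (j : G) ∈ H ⊓ Ch.V 0 := by rw [← hS]; exact Subgroup.subset_closure j.2
    exact this.2
  · rw [← hS, cl, Subtype.range_coe_subtype]; rfl
  · simp; linarith

lemma Rk_missing (Ch : Chain X) {H : Subgroup G} {i : ℕ} {ρ : ℝ} (h : Rk Ch H i ρ)
    (hm : H ⊓ Ch.V i ≤ Ch.V (i + 1)) : Rk Ch H (i + 1) ρ := by
  obtain ⟨ι, f, h, u, h1, h2, h3, h4, h5⟩ := h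
  refine ⟨ι, f, h, u, h1, h2, h3, h4.trans ?_, h5⟩
  exact le_antisymm (le_inf inf_le_left hm) (inf_le_inf_left _ (Ch.V_succ i))

lemma Rk_step (Ch : Chain X) {H : Subgroup G} {i : ℕ} {ρ : ℝ} (h : Rk Ch H i ρ)
    (hm : ¬ H ⊓ Ch.V i ≤ Ch.V (i + 1)) : Rk Ch H (i + 1) (1 + geo p (Ch.s i) * (ρ - 1)) := by
  classical
  obtain ⟨ι, f, h, u, h1, h2, h3, h4, h5⟩ := h
  have hchar : IsChar (cl h) (Ch.χ i) := by
    rw [h4]; exact fun a ha b hb => (Ch.rel i).char a ha.2 b hb.2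
  have hV : ∀ j, h j ∈ Ch.V i := fun j => by
    have : h j ∈ cl h := y_mem j
    rw [h4] at this; exact this.2
  have hmem : ∀ v, v ∈ Ch.V (i + 1) ↔ v ∈ Ch.V i ∧ Ch.χ i v = 0 := (Ch.rel i).memV
  set χ := Ch.χ i with hχ
  obtain ⟨i0, hi0⟩ : ∃ i0, χ (h i0) ≠ 0 := by
    by_contra hcon
    push Not at hcon
    apply hm
    rw [← h4, cl, Subgroup.closure_le]
    rintro _ ⟨j, rfl⟩
    exact (hmem _).2 ⟨hV j, hcon j⟩
  let u' : ι → ℝ := fun j => if χ (h j) = 0 then u j else Ch.s i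
  have hu' : ∀ j, u' j ≤ u j := by
    intro j
    simp only [u']
    split_ifs with hj
    · exact le_rfl
    · by_contra hlt
      push Not at hlt
      obtain ⟨d, hd, n, hn, e⟩ := X.mem_E.1 (h1 j)
      have hdV : d ∈ Ch.V i := by
        have := mul_mem (hV j) (inv_mem (Ch.N_le i hn))
        rw [e] at this; simpa using this
      have := mul_mem (Ch.c2 i hlt ⟨hd, hdV⟩) (Ch.N_le (i + 1) hn)
      rw [← e] at this
      exact hj ((hmem _).1 this).2
  have hs0 := Ch.s_pos i
  have hs1 := Ch.s_lt i
  have hu'0 : ∀ j, 0 < u' j := by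
    intro j; simp only [u']; split_ifs; exacts [h2 j, hs0]
  have hEs : ∀ j, h j ∈ X.E (Ch.s i) := by
    intro j
    obtain ⟨d, hd, _, n, hn, e⟩ := Ch.c3 i (hV j)
    exact X.mem_E.2 ⟨d, hd, n, hn, e⟩
  have hE' : ∀ j, h j ∈ X.E (u' j) := by
    intro j; simp only [u']; split_ifs; exacts [h1 j, hEs j]
  let χ' : G → ZMod p := fun g => χ g * (χ (h i0))⁻¹
  have hχ' : IsChar (cl h) χ' := by
    intro a ha b hb
    simp only [χ', hchar a ha b hb, add_mul]
  let k : ι → ℕ := fun j => if j = i0 then 0 else (χ' (h j)).val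
  have hk0 : k i0 = 0 := by simp [k]
  set x := nx h i0 k with hx
  have hcl : cl x = cl h := cl_nx h i0 k hk0
  have hx0 : x i0 = h i0 := nx_i0 h i0 k hk0
  have hxE : ∀ j, x j ∈ X.E (u' j) := by
    intro j
    by_cases hj : χ (h j) = 0
    · have : k j = 0 := by simp [k, χ', hj]
      simp only [x, nx, this, pow_zero, inv_one, mul_one]
      exact hE' j
    · have : u' j = Ch.s i := by simp [u', hj]
      rw [this]
      exact mul_mem (hEs j) (inv_mem (pow_mem (hEs i0) _))
  have hχx : IsChar (cl x) χ' := by rw [hcl]; exact hχ'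
  have hc1 : χ' (x i0) = 1 := by rw [hx0]; exact mul_inv_cancel₀ hi0
  have hc0 : ∀ j, j ≠ i0 → χ' (x j) = 0 := by
    intro j hj
    have m1 : h i0 ∈ cl h := y_mem i0
    have m2 : h j ∈ cl h := y_mem j
    have hone : χ' (h i0) = 1 := mul_inv_cancel₀ hi0
    simp only [x, nx]
    rw [hχ' _ m2 _ (inv_mem (pow_mem m1 _)), hχ'.inv (pow_mem m1 _), hχ'.pow m1, hone]
    simp [k, hj]
  refine ⟨_, inferInstance, ny p x i0, nw p u' i0, X.E_ser.ny_mem hxE i0, nw_pos u' i0 hu'0, ?_, ?_, ?_⟩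
  · have hle : ∀ j, u' j ≤ 1 := fun j => (hu' j).trans (h3 j)
    rintro (_ | ⟨j, l⟩)
    · exact pow_le_one₀ (hu'0 i0).le (hle i0)
    · exact mul_le_one₀ (hle j) (pow_nonneg (hu'0 i0).le _) (pow_le_one₀ (hu'0 i0).le (hle i0))
  · rw [G1 x i0 hχx hc1 hc0]
    ext v
    rw [mem_kerc, hcl, h4]
    simp only [Subgroup.mem_inf, hmem, χ', mul_eq_zero, inv_eq_zero, hi0, or_false]
    tauto
  · have hsum := sum_nw (p := p) u' i0
    have hui : u' i0 = Ch.s i := by simp [u', hi0]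
    rw [hui] at hsum
    have hg := geo_ge (p := p) hs0.le
    have h6 : ∑ j, u' j ≤ ρ := (Finset.sum_le_sum fun j _ => hu' j).trans h5
    have : geo p (Ch.s i) * (∑ j, u' j - 1) ≤ geo p (Ch.s i) * (ρ - 1) :=
      mul_le_mul_of_nonneg_left (by linarith) (by linarith)
    linarith

open Classical in
lemma Rk_all (Ch : Chain X) {H : Subgroup G} {m : ℝ} (h : Rk Ch H 0 (1 + m)) (k : ℕ) :
    Rk Ch H k (1 + m * ∏ l ∈ (Finset.range k).filter (fun l => ¬ H ⊓ Ch.V l ≤ Ch.V (l + 1)), geo p (Ch.s l)) := by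
  induction k with
  | zero => simpa using h
  | succ k ih =>
    rw [Finset.range_add_one, Finset.filter_insert]
    by_cases hm : H ⊓ Ch.V k ≤ Ch.V (k + 1)
    · rw [if_neg (by simpa using hm)]
      exact Rk_missing Ch ih hm
    · rw [if_pos hm, Finset.prod_insert (by simp)]
      convert Rk_step Ch ih hm using 1
      ring

lemma case2 (Ch : Chain X) {H : Subgroup G} {k : ℕ} (hk : ∀ l < k, Ch.s k < Ch.s l) {ρ : ℝ} (hρ : 1 ≤ ρ)
    (hR : Rk Ch H k ρ) (hlt : ρ < 1 + (Ch.C k).e) :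
    ∃ X', St.Ext X X' ∧ ∃ H0 ≤ H, H0 ≤ X'.N ∧ H0.relIndex H ≠ 0 := by
  obtain ⟨ρ', hr1, hr2⟩ := exists_between hlt
  have hr0 : 0 < ρ' := by linarith
  have hc1 : ρ'⁻¹ ≤ 1 := inv_le_one_of_one_le₀ (by linarith)
  have hc0 : 0 < ρ'⁻¹ := inv_pos.2 hr0
  obtain ⟨X', hN, hV, hD⟩ := switch Ch hk hc0 hc1 (by
    rw [inv_mul_eq_div, lt_div_iff₀ hr0]; linarith)
  obtain ⟨ι, _, h, u, h1, h2, h3, h4, h5⟩ := hR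
  have hVk : ∀ j, h j ∈ Ch.V k := fun j => by
    have : h j ∈ cl h := y_mem j
    rw [h4] at this; exact this.2
  have hE : ∀ j, h j ∈ X'.E (ρ'⁻¹ * u j) := by
    intro j
    have key : ∀ t < 1, h j ∈ X.E t → h j ∈ X'.E (ρ'⁻¹ * t) := by
      intro t ht hm
      obtain ⟨d, hd, n, hn, e⟩ := X.mem_E.1 hm
      have hdV : d ∈ Ch.V k := by
        have := mul_mem (hVk j) (inv_mem (Ch.N_le k hn))
        rw [e] at this; simpa using this
      exact X'.mem_E.2 ⟨d, hD t ht ⟨hd, hdV⟩, n, hN ▸ hn, e⟩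
    rcases (h3 j).lt_or_eq with h | h
    · exact key _ h (h1 j)
    · obtain ⟨d, hd, _, n, hn, e⟩ := Ch.c3 k (hVk j)
      refine X'.E_mono ?_ (key _ (Ch.s_lt k) (X.mem_E.2 ⟨d, hd, n, hn, e⟩))
      rw [h]
      exact mul_le_mul_of_nonneg_left (Ch.s_lt k).le hc0.le
  have hi : (0 : ℝ) < X'.S.V.index := by exact_mod_cast Nat.pos_of_ne_zero X'.Vi
  obtain ⟨ι', _, h', u', k1, k2, k3, k4, k5, k6⟩ := round X'.E_ser h (fun j => ρ'⁻¹ * u j) hE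
    (fun j => mul_pos hc0 (h2 j)) (by
      rw [← Finset.mul_sum, inv_mul_eq_div, div_lt_one hr0]; linarith) (div_pos X'.e_pos hi)
  choose d hd n hn e using fun j => X'.mem_E.1 (k1 j)
  rw [lt_div_iff₀ hi] at k6
  obtain ⟨X'', l1, l2, l3, l4, l5⟩ := kill X' d u' hd k2 k3 (by linarith)
  refine ⟨X'', ⟨?_, ?_⟩, cl h', ?_, ?_, ?_⟩
  · rw [l1, hV, ← Ch.V_zero]; exact Ch.V_anti (Nat.zero_le _)
  · rw [← hN]; exact l3
  · exact k4.trans (h4.le.trans inf_le_left)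
  · rw [cl, Subgroup.closure_le]
    rintro _ ⟨j, rfl⟩
    rw [e j]
    exact mul_mem (l4 j) (l3 (hn j))
  · refine Subgroup.relIndex_ne_zero_trans k5 ?_
    rw [h4, Subgroup.inf_relIndex_left]
    exact relIndex_ne_of_index (Ch.index_ne k)

lemma reach (Ch : Chain X) (L : Subgroup G) (k K : ℕ) (hkK : k ≤ K)
    (hL : ∀ i, k ≤ i → i < K → ∃ x ∈ L, x ∈ Ch.V i ∧ x ∉ Ch.V (i + 1)) {v : G} (hv : v ∈ Ch.V k) :
    ∃ g ∈ L, g⁻¹ * v ∈ Ch.V K := by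
  induction K, hkK using Nat.le_induction with
  | base => exact ⟨1, one_mem _, by simpa using hv⟩
  | succ K hkK ih =>
    obtain ⟨g, hg, hgv⟩ := ih fun i h1 h2 => hL i h1 (by omega)
    obtain ⟨x, hx, h1, h2⟩ := hL K hkK (by omega)
    obtain ⟨l, hl⟩ := Ch.cyc K h1 h2 hgv
    exact ⟨g * x ^ l, mul_mem hg (pow_mem hx _), by rw [mul_inv_rev, mul_assoc]; exact hl⟩

open Classical in
lemma case1 (Ch : Chain X) {H : Subgroup G} {M : ℝ}
    (hM : ∀ k, ∏ l ∈ (Finset.range k).filter (fun l => H ⊓ Ch.V l ≤ Ch.V (l + 1)), geo p (Ch.s l) ≤ M) :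
    ∃ X', St.Ext X X' ∧ (H ⊔ X'.N).index ≠ 0 := by
  let a : ℕ → ℝ := fun l => if H ⊓ Ch.V l ≤ Ch.V (l + 1) then Ch.s l else 0
  have ha0 : ∀ l, 0 ≤ a l := fun l => by
    simp only [a]; split_ifs; exacts [(Ch.s_pos l).le, le_rfl]
  have hsum : ∀ k, ∑ l ∈ Finset.range k, a l ≤ M := by
    intro k
    refine le_trans ?_ (hM k)
    rw [← Finset.sum_filter]
    have h1 := one_add_sum_le ((Finset.range k).filter (fun l => H ⊓ Ch.V l ≤ Ch.V (l + 1))) Ch.s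
      (fun l => (Ch.s_pos l).le)
    have h2 : ∏ l ∈ (Finset.range k).filter (fun l => H ⊓ Ch.V l ≤ Ch.V (l + 1)), (1 + Ch.s l) ≤
        ∏ l ∈ (Finset.range k).filter (fun l => H ⊓ Ch.V l ≤ Ch.V (l + 1)), geo p (Ch.s l) :=
      Finset.prod_le_prod (fun l _ => by have := Ch.s_pos l; linarith) fun l _ => geo_ge (Ch.s_pos l).le
    linarith
  have hS : Summable a := summable_of_sum_range_le ha0 hsum
  have hi : (0 : ℝ) < X.S.V.index := by exact_mod_cast Nat.pos_of_ne_zero X.Vi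
  have hε : 0 < X.S.e / (2 * X.S.V.index) := div_pos X.e_pos (by linarith)
  obtain ⟨k, hk⟩ : ∃ k, ∀ K, k ≤ K → ∑ l ∈ Finset.Ico k K, a l < X.S.e / (2 * X.S.V.index) := by
    have ht := hS.hasSum.tendsto_sum_nat
    obtain ⟨k, hk⟩ := ((tendsto_order.1 ht).1 (∑' l, a l - X.S.e / (2 * X.S.V.index)) (by linarith)).exists
    refine ⟨k, fun K hK => ?_⟩
    rw [Finset.sum_Ico_eq_sub _ hK]
    have := hS.sum_le_tsum (Finset.range K) fun l _ => ha0 l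
    linarith
  let n : ℝ := Fintype.card (Ch.C k).ι
  have hn : 0 ≤ n := Nat.cast_nonneg _
  obtain ⟨K0, hK0⟩ := Ch.s_small (u := X.S.e / (2 * X.S.V.index) / (n + 1)) (div_pos hε (by linarith))
  obtain ⟨K, hKk, hKs⟩ : ∃ K, k ≤ K ∧ Ch.s K < X.S.e / (2 * X.S.V.index) / (n + 1) :=
    ⟨max k K0, le_max_left _ _, hK0 _ (le_max_right _ _)⟩
  have hkK := hk K hKk
  rw [lt_div_iff₀ (by linarith)] at hKs
  have hxs : ∀ i, ∃ x ∈ X.S.D (Ch.s i), x ∈ Ch.V i ∧ x ∉ Ch.V (i + 1) := by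
    intro i
    obtain ⟨v, hv, hv'⟩ := Ch.strict i
    obtain ⟨d, hd, hdV, n, hn, rfl⟩ := Ch.c3 i hv
    exact ⟨d, hd, hdV, fun h => hv' (mul_mem h (Ch.N_le _ hn))⟩
  choose x hxD hxV hxV' using hxs
  let A := (Finset.Ico k K).filter (fun l => H ⊓ Ch.V l ≤ Ch.V (l + 1))
  let L : Subgroup G := H ⊔ Subgroup.closure (x '' (A : Set ℕ))
  have hL : ∀ i, k ≤ i → i < K → ∃ x ∈ L, x ∈ Ch.V i ∧ x ∉ Ch.V (i + 1) := by
    intro i h1 h2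
    by_cases hm : H ⊓ Ch.V i ≤ Ch.V (i + 1)
    · refine ⟨x i, Subgroup.mem_sup_right (Subgroup.subset_closure ⟨i, ?_, rfl⟩), hxV i, hxV' i⟩
      simp only [A, Finset.coe_filter, Finset.mem_Ico, Set.mem_ofPred_eq]
      exact ⟨⟨h1, h2⟩, hm⟩
    · obtain ⟨v, hv, hv'⟩ := SetLike.not_le_iff_exists.1 hm
      exact ⟨v, Subgroup.mem_sup_left hv.1, hv.2, hv'⟩
  choose g hgL hgV using fun j => reach Ch L k K hKk hL (v := (Ch.C k).y j) (y_mem j)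
  choose d hd hdV n' hn' hdn using fun j => Ch.c3 K (hgV j)
  obtain ⟨X', h1, h2, h3, h4, h5⟩ := kill X (τ := A ⊕ (Ch.C k).ι) (Sum.elim (fun i => x i) d)
    (Sum.elim (fun i => Ch.s i) (fun _ => Ch.s K))
    (by rintro (i | j); exacts [hxD i, hd j])
    (by rintro (i | j); exacts [Ch.s_pos _, Ch.s_pos _])
    (by rintro (i | j); exacts [Ch.s_lt _, Ch.s_lt _])
    (by
      rw [Fintype.sum_sum_type]
      simp only [Sum.elim_inl, Sum.elim_inr, Finset.sum_const, nsmul_eq_mul, Finset.card_univ]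
      rw [Finset.sum_coe_sort A Ch.s, Finset.sum_filter]
      have e1 : (X.S.V.index : ℝ) * (X.S.e / (2 * X.S.V.index)) = X.S.e / 2 := by field_simp
      have e2 := Ch.s_pos K
      have e3 : ∑ l ∈ Finset.Ico k K, a l + n * Ch.s K <
        X.S.e / (2 * X.S.V.index) + X.S.e / (2 * X.S.V.index) := by nlinarith
      have e4 := mul_lt_mul_of_pos_left e3 hi
      rw [mul_add _ (X.S.e / (2 * X.S.V.index)), e1] at e4
      refine lt_of_lt_of_eq e4 ?_
      ring)
  refine ⟨X', ⟨h1.le, h3⟩, ?_⟩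
  have hLN : L ≤ H ⊔ X'.N := by
    refine sup_le le_sup_left (((Subgroup.closure_le _).2 ?_).trans le_sup_right)
    rintro _ ⟨i, hi, rfl⟩
    exact h4 (Sum.inl ⟨i, hi⟩)
  have hVk : Ch.V k ≤ H ⊔ X'.N := by
    show cl (Ch.C k).y ≤ _
    rw [cl, Subgroup.closure_le]
    rintro _ ⟨j, rfl⟩
    have e : (Ch.C k).y j = g j * (d j * n' j) := by rw [← hdn]; group
    rw [e]
    exact mul_mem (hLN (hgL j)) (mul_mem (Subgroup.mem_sup_right (h4 (Sum.inr j)))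
      (Subgroup.mem_sup_right (h3 (hn' j))))
  intro h0
  have := Subgroup.index_dvd_of_le hVk
  rw [h0] at this
  exact Ch.index_ne k (Nat.eq_zero_of_zero_dvd this)

theorem taskH (X : St p G) {H : Subgroup G} (hH : H.FG) :
    ∃ X', St.Ext X X' ∧ ((∃ H0 ≤ H, H0 ≤ X'.N ∧ H0.relIndex H ≠ 0) ∨ (H ⊔ X'.N).index ≠ 0) := by
  classical
  obtain ⟨Ch⟩ := exists_chain X
  obtain ⟨m, hm, hR⟩ := Rk_zero Ch hH
  by_cases hc : ∃ k, m < X.S.e *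
      ∏ l ∈ (Finset.range k).filter (fun l => H ⊓ Ch.V l ≤ Ch.V (l + 1)), geo p (Ch.s l)
  · obtain ⟨k0, hk0⟩ := hc
    obtain ⟨k, hk1, hk⟩ := Ch.exists_threshold k0
    have hg : ∀ l, 1 ≤ geo p (Ch.s l) := fun l => by
      have := geo_ge (p := p) (Ch.s_pos l).le
      have := Ch.s_pos l
      linarith
    have hnm : 1 ≤ ∏ l ∈ (Finset.range k).filter (fun l => ¬ H ⊓ Ch.V l ≤ Ch.V (l + 1)), geo p (Ch.s l) :=
      Finset.one_le_prod fun l _ => hg l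
    have hmono : ∏ l ∈ (Finset.range k0).filter (fun l => H ⊓ Ch.V l ≤ Ch.V (l + 1)), geo p (Ch.s l) ≤
        ∏ l ∈ (Finset.range k).filter (fun l => H ⊓ Ch.V l ≤ Ch.V (l + 1)), geo p (Ch.s l) := by
      refine Finset.prod_le_prod_of_subset_of_one_le ?_ ?_ ?_
      · exact Finset.filter_subset_filter _ (Finset.range_mono hk1.le)
      · exact fun l _ => by linarith [hg l]
      · exact fun l _ _ => hg l
    obtain ⟨X', h1, h2⟩ := case2 Ch hk (by nlinarith) (Rk_all Ch hR k) (by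
      rw [Ch.e_eq, ← Finset.prod_filter_mul_prod_filter_not (Finset.range k)
        (fun l => H ⊓ Ch.V l ≤ Ch.V (l + 1)), ← mul_assoc]
      have := mul_le_mul_of_nonneg_left hmono X.e_pos.le
      have : m < X.S.e * ∏ l ∈ (Finset.range k).filter (fun l => H ⊓ Ch.V l ≤ Ch.V (l + 1)), geo p (Ch.s l) := by
        linarith
      have := mul_lt_mul_of_pos_right this (lt_of_lt_of_le one_pos hnm)
      linarith)
    exact ⟨X', h1, Or.inl h2⟩
  · push Not at hc
    obtain ⟨X', h1, h2⟩ := case1 Ch (H := H) (M := m / X.S.e) (fun k => by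
      rw [le_div_iff₀ X.e_pos, mul_comm]; exact hc k)
    exact ⟨X', h1, Or.inr h2⟩
end LZO

namespace LZO
variable {p : ℕ} [Fact p.Prime]

noncomputable def initSys (p : ℕ) [Fact p.Prime] : Sys p (FreeGroup (Fin 3)) where
  ι := Fin 3
  κ := Empty
  fι := inferInstance
  fκ := inferInstance
  y := FreeGroup.of
  w := fun _ => 1 / 2
  r := fun k => k.elim
  q := fun k => k.elim
  hw := fun _ => by norm_num
  hw1 := fun _ => by norm_num
  hq := fun k => k.elim
  hq1 := fun k => k.elim
  fr := Fr_free
  hr := fun k => k.elim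

lemma initV : (initSys p).V = ⊤ := FreeGroup.closure_range_of _

lemma initN : (initSys p).V.Normal := by rw [initV]; infer_instance
lemma initI : (initSys p).V.index ≠ 0 := by rw [initV]; simp
lemma initM (g) : g ∈ (initSys p).V := by rw [initV]; trivial

lemma exists_init : Nonempty (St p (FreeGroup (Fin 3))) := by
  refine ⟨{ S := initSys p, N := ⊥, hNn := inferInstance, gen := ⟨fun k => k.elim, bot_le⟩,
            Vn := initN, Vi := initI, tor := fun g => ⟨0, initM _⟩,
            inv := ?_, e_pos := ?_ }⟩
  · intro f u v hv
    refine Vf_conj ?_ hv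
    exact initM (p := p) f
  · show 0 < ∑ i : Fin 3, (1 / 2 : ℝ) - ∑ k : Empty, (fun k : Empty => k.elim) k - 1
    simp; norm_num

lemma full {G : Type} [Group G] (X : St p G) (T : Finset G) (g : G) : ∃ X', St.Ext X X' ∧ ¬ X.S.V ≤ X'.S.V ∧
    (∃ a : ℕ, g ^ p ^ a ∈ X'.N) ∧
    ((∃ H0 ≤ Subgroup.closure (T : Set G), H0 ≤ X'.N ∧ H0.relIndex (Subgroup.closure (T : Set G)) ≠ 0) ∨
      (Subgroup.closure (T : Set G) ⊔ X'.N).index ≠ 0) := by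
  obtain ⟨X1, h1, h2⟩ := X.shrink
  obtain ⟨X2, h3, a, h4⟩ := X1.torsion g
  obtain ⟨X3, h5, h6⟩ := taskH X2 (H := Subgroup.closure (T : Set G)) ⟨T, rfl⟩
  exact ⟨X3, (h1.trans h3).trans h5, fun h => h2 (h.trans (h3.trans h5).1), ⟨a, h5.2 h4⟩, h6⟩

theorem main (p : ℕ) (hp : p.Prime) :
    ∃ (Ω : Type) (_ : Group Ω),
      Group.FG Ω ∧ Infinite Ω ∧ ResiduallyFinite Ω ∧
      (∀ g : Ω, ∃ k : ℕ, orderOf g = p ^ k) ∧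
      (∀ H : Subgroup Ω, H.FG → (H : Set Ω).Finite ∨ H.FiniteIndex) := by
  classical
  have : Fact p.Prime := ⟨hp⟩
  let F := FreeGroup (Fin 3)
  obtain ⟨X0⟩ := exists_init (p := p)
  have hcF : Countable F := inferInstanceAs (Countable (Quot _))
  obtain ⟨en, hen⟩ := exists_surjective_nat (Finset F × F)
  choose nxt n1 n2 n3 n4 using fun (X : St p F) (n : ℕ) => full X (en n).1 (en n).2
  let X : ℕ → St p F := fun n => Nat.rec X0 (fun n Y => nxt Y n) n
  have hX : ∀ n, X (n + 1) = nxt (X n) n := fun n => rfl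
  have hV : Antitone fun n => (X n).S.V := antitone_nat_of_succ_le fun n => (n1 (X n) n).1
  have hN : Monotone fun n => (X n).N := monotone_nat_of_le_succ fun n => (n1 (X n) n).2
  let D : Subgroup F := ⨅ n, (X n).S.V
  have hDn : D.Normal := Subgroup.normal_iInf_normal fun n => (X n).Vn
  have hDV : ∀ n, D ≤ (X n).S.V := fun n => iInf_le _ n
  have hND : ∀ n, (X n).N ≤ D := fun n => le_iInf fun m =>
    (hN (le_max_left n m)).trans ((X (max n m)).N_le_V.trans (hV (le_max_right n m)))
  refine ⟨F ⧸ D, inferInstance, inferInstance, ?_, ?_, ?_, ?_⟩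
  · rw [← not_finite_iff_infinite, ← Subgroup.index_ne_zero_iff_finite, not_not]
    by_contra h0
    have hlt : ∀ n, n < (X n).S.V.index := by
      intro n
      induction n with
      | zero => exact Nat.pos_of_ne_zero (X 0).Vi
      | succ n ih =>
        have h1 := Subgroup.relIndex_mul_index (hV (Nat.le_succ n))
        have h2 : (X (n + 1)).S.V.relIndex (X n).S.V ≠ 1 := by
          rw [Ne, Subgroup.relIndex_eq_one]; exact n2 (X n) n
        have h3 : (X (n + 1)).S.V.relIndex (X n).S.V ≠ 0 := by
          intro h
          simp only [Nat.succ_eq_add_one, h, zero_mul] at h1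
          exact (X (n + 1)).Vi h1.symm
        have h4 : 2 ≤ (X (n + 1)).S.V.relIndex (X n).S.V := by omega
        simp only [Nat.succ_eq_add_one] at h1
        rw [← h1]; nlinarith
    have h5 := Nat.le_of_dvd (Nat.pos_of_ne_zero h0) (Subgroup.index_dvd_of_le (hDV D.index))
    have := hlt D.index
    omega
  · intro g hg
    induction g using QuotientGroup.induction_on with | _ f => ?_
    have hf : f ∉ D := fun h => hg ((QuotientGroup.eq_one_iff f).2 h)
    obtain ⟨n, hn⟩ : ∃ n, f ∉ (X n).S.V := by
      by_contra hcon
      push Not at hcon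
      exact hf (Subgroup.mem_iInf.2 hcon)
    have hVn := (X n).Vn
    have hfin : Finite (F ⧸ (X n).S.V) := Subgroup.index_ne_zero_iff_finite.1 (X n).Vi
    let φ : F ⧸ D →* F ⧸ (X n).S.V := QuotientGroup.map D _ (MonoidHom.id F) (hDV n)
    refine ⟨φ.ker, inferInstance, inferInstance, ?_⟩
    intro h
    rw [MonoidHom.mem_ker] at h
    exact hn ((QuotientGroup.eq_one_iff f).1 h)
  · intro g
    induction g using QuotientGroup.induction_on with | _ f => ?_
    obtain ⟨n, hn⟩ := hen (∅, f)
    obtain ⟨a, ha⟩ := n3 (X n) n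
    rw [hn, ← hX] at ha
    have : orderOf (QuotientGroup.mk f : F ⧸ D) ∣ p ^ a := by
      rw [orderOf_dvd_iff_pow_eq_one, ← QuotientGroup.mk_pow]
      exact (QuotientGroup.eq_one_iff _).2 (hND (n + 1) ha)
    obtain ⟨k, _, hk⟩ := (Nat.dvd_prime_pow hp).1 this
    exact ⟨k, hk⟩
  · rintro H ⟨S, hS⟩
    let T : Finset F := S.image Quotient.out
    let K : Subgroup F := Subgroup.closure (T : Set F)
    have hK : K.map (QuotientGroup.mk' D) = H := by
      rw [MonoidHom.map_closure, ← hS]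
      congr 1
      ext x
      simp only [T, Finset.coe_image, Set.mem_image, Finset.mem_coe, exists_exists_and_eq_and]
      constructor
      · rintro ⟨a, ha, rfl⟩
        rw [QuotientGroup.mk'_apply, QuotientGroup.out_eq']; exact ha
      · intro h; exact ⟨x, h, QuotientGroup.out_eq' x⟩
    obtain ⟨n, hn⟩ := hen (T, 1)
    have h := n4 (X n) n
    rw [hn, ← hX] at h
    rcases h with ⟨H0, -, h2, h3⟩ | h
    · left
      have h4 : D.relIndex K ≠ 0 := by
        intro h0
        have := Subgroup.relIndex_dvd_of_le_left K (h2.trans (hND (n + 1)))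
        rw [h0] at this
        exact h3 (Nat.eq_zero_of_zero_dvd this)
      have h5 := Subgroup.relIndex_ker K (QuotientGroup.mk' D)
      rw [QuotientGroup.ker_mk', hK] at h5
      rw [h5] at h4
      have : Finite H := Nat.finite_of_card_ne_zero h4
      exact Set.toFinite (H : Set (F ⧸ D))
    · right
      constructor
      rw [← Subgroup.index_comap_of_surjective H (QuotientGroup.mk'_surjective D)]
      intro h0
      have hle : K ⊔ (X (n + 1)).N ≤ H.comap (QuotientGroup.mk' D) := by
        refine sup_le ?_ ?_
        · rw [← hK]; exact Subgroup.le_comap_map _ _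
        · intro x hx
          have : QuotientGroup.mk' D x = 1 := (QuotientGroup.eq_one_iff x).2 (hND (n + 1) hx)
          rw [Subgroup.mem_comap, this]; exact one_mem _
      have := Subgroup.index_dvd_of_le hle
      rw [h0] at this
      exact h (Nat.eq_zero_of_zero_dvd this)
end LZO

/-- For every prime `p` there exists a finitely generated, infinite, residually finite
`p`-torsion group in which every finitely generated subgroup is either finite or of
finite index (a residually finite locally zero-one `p`-torsion group). -/
theorem exists_residually_finite_locally_zero_one_p_torsion (p : ℕ) (hp : p.Prime) :
    ∃ (Ω : Type) (_ : Group Ω),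
      Group.FG Ω ∧ Infinite Ω ∧ ResiduallyFinite Ω ∧
      (∀ g : Ω, ∃ k : ℕ, orderOf g = p ^ k) ∧
      (∀ H : Subgroup Ω, H.FG → (H : Set Ω).Finite ∨ H.FiniteIndex) := by
  exact LZO.main p hp
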